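/- Let μ ∈ {1, −1} and β ≤ 0. For any initial condition w₀ ∈ S^β(ℝ → ℂ), there exists T > 0 and a solution w ∈ S^β(ℝ×[0,T] → ℂ) of the initial value problem i∂_t w + ∂_x² w + μ|w|²w = 0, w(x,0) = w₀(x); moreover w is the unique solution of this initial value problem in S^β(ℝ×[0,T] → ℂ). Furthermore, if w₀ has asymptotic expansions with coefficients a_k^± + i b_k^± and exponents β_k at ±∞, and j is the smallest index such that a_j^+ + i b_j^+ ≠ 0 (respectively a_j^− + i b_j^− ≠ 0), then the coefficient a_j^+(t) + i b_j^+(t) (respectively a_j^−(t) + i b_j^−(t)) in the asymptotic expansion of the solution w is a nonvanishing continuous function of t on [0,T], and all coefficients with index less than j are identically zero. -/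

import Mathlib

noncomputable section

/-- Mixed partial derivative `∂_t^i ∂_x^j u (x, t)`. -/
def pd (u : ℝ → ℝ → ℂ) (i j : ℕ) (x t : ℝ) : ℂ :=
  iteratedDeriv i (fun s => iteratedDeriv j (fun y => u y s) x) t

/-- Joint smoothness (`C^∞`) of a function of two real variables. -/
def Smooth2 (u : ℝ → ℝ → ℂ) : Prop := ∀ n : ℕ, ContDiff ℝ n (Function.uncurry u)

/-- A valid sequence of exponents for the space `S^β`:
`β = β₀ > β₁ > β₂ > ⋯` with `β_k → −∞`. -/
def IsExp (β : ℝ) (e : ℕ → ℝ) : Prop :=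
  e 0 = β ∧ StrictAnti e ∧ Filter.Tendsto e Filter.atTop Filter.atBot

/-- Partial sum `Σ_{k=0}^N (a_k(t) + i b_k(t)) x^{β_k}` of an asymptotic expansion at `+∞`. -/
def psumP (e : ℕ → ℝ) (a b : ℕ → ℝ → ℝ) (N : ℕ) (x t : ℝ) : ℂ :=
  ∑ k ∈ Finset.range (N + 1), ((a k t : ℂ) + Complex.I * (b k t : ℂ)) * ((x ^ e k : ℝ) : ℂ)

/-- Partial sum `Σ_{k=0}^N (a_k(t) + i b_k(t)) (−x)^{β_k}` of an asymptotic expansion at `−∞`. -/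
def psumM (e : ℕ → ℝ) (a b : ℕ → ℝ → ℝ) (N : ℕ) (x t : ℝ) : ℂ :=
  ∑ k ∈ Finset.range (N + 1), ((a k t : ℂ) + Complex.I * (b k t : ℂ)) * (((-x) ^ e k : ℝ) : ℂ)

/-- `w` is asymptotic (on the time interval `[0,T]`) to the expansions at `±∞` with exponents `e`
and coefficients `ap + i bp` (at `+∞`) and `am + i bm` (at `−∞`). -/
def AsymOn (w : ℝ → ℝ → ℂ) (T : ℝ) (e : ℕ → ℝ) (ap bp am bm : ℕ → ℝ → ℝ) : Prop :=
  (∀ N i j : ℕ, ∃ C > (0 : ℝ), ∀ x : ℝ, 1 ≤ x → ∀ t ∈ Set.Icc (0 : ℝ) T,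
    ‖pd (fun y s => w y s - psumP e ap bp N y s) i j x t‖ ≤ C * x ^ (e (N + 1) - (j : ℝ))) ∧
  (∀ N i j : ℕ, ∃ C > (0 : ℝ), ∀ x : ℝ, x ≤ -1 → ∀ t ∈ Set.Icc (0 : ℝ) T,
    ‖pd (fun y s => w y s - psumM e am bm N y s) i j x t‖ ≤ C * (-x) ^ (e (N + 1) - (j : ℝ)))

/-- Membership in `S^β(ℝ × [0,T] → ℂ)`. -/
def SBetaOn (β : ℝ) (w : ℝ → ℝ → ℂ) (T : ℝ) : Prop :=
  Smooth2 w ∧ ∃ e : ℕ → ℝ, IsExp β e ∧ ∃ ap bp am bm : ℕ → ℝ → ℝ,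
    (∀ k : ℕ, (∀ n : ℕ, ContDiff ℝ n (ap k)) ∧ (∀ n : ℕ, ContDiff ℝ n (bp k)) ∧
      (∀ n : ℕ, ContDiff ℝ n (am k)) ∧ (∀ n : ℕ, ContDiff ℝ n (bm k))) ∧
    AsymOn w T e ap bp am bm

/-- The NLS equation `i w_t + w_xx + μ |w|² w = 0` on `ℝ × [0,T]`. -/
def NLSEq (μ : ℝ) (w : ℝ → ℝ → ℂ) (T : ℝ) : Prop :=
  ∀ x : ℝ, ∀ t ∈ Set.Icc (0 : ℝ) T,
    Complex.I * pd w 1 0 x t + pd w 0 2 x t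
      + (μ : ℂ) * ((w x t) ^ 2 * (starRingEnd ℂ) (w x t)) = 0

namespace NLS

open Filter Topology
open scoped ContDiff

/-! ### Smooth functions of two real variables -/

/-- Smoothness of a function of two real variables. -/
def Sm (u : ℝ → ℝ → ℂ) : Prop := ContDiff ℝ ∞ (Function.uncurry u)

/-- The partial derivative in the first variable. -/
def Dx (u : ℝ → ℝ → ℂ) : ℝ → ℝ → ℂ := fun x t => deriv (fun y => u y t) x

/-- The partial derivative in the second variable. -/
def Dt (u : ℝ → ℝ → ℂ) : ℝ → ℝ → ℂ := fun x t => deriv (fun s => u x s) t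

variable {u v : ℝ → ℝ → ℂ}

theorem Sm.smooth2 (h : Sm u) : Smooth2 u := contDiff_infty.1 h

theorem Smooth2.sm (h : Smooth2 u) : Sm u := contDiff_infty.2 h

theorem Sm.slice_x (h : Sm u) (t : ℝ) : ContDiff ℝ ∞ (fun y => u y t) :=
  ContDiff.comp (g := Function.uncurry u) h (contDiff_id.prodMk contDiff_const)

theorem Sm.slice_t (h : Sm u) (x : ℝ) : ContDiff ℝ ∞ (fun s => u x s) :=
  ContDiff.comp (g := Function.uncurry u) h (contDiff_const.prodMk contDiff_id)

theorem Sm.hasDerivAt_x (h : Sm u) (x t : ℝ) : HasDerivAt (fun y => u y t) (Dx u x t) x :=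
  ((h.slice_x t).differentiable (by simp) x).hasDerivAt

theorem Sm.hasDerivAt_t (h : Sm u) (x t : ℝ) : HasDerivAt (fun s => u x s) (Dt u x t) t :=
  ((h.slice_t x).differentiable (by simp) t).hasDerivAt

theorem Sm.hasFDerivAt (h : Sm u) (z : ℝ × ℝ) :
    HasFDerivAt (Function.uncurry u) (fderiv ℝ (Function.uncurry u) z) z :=
  (ContDiff.differentiable h (by simp) z).hasFDerivAt

theorem Sm.dx_eq (h : Sm u) (x t : ℝ) :
    Dx u x t = fderiv ℝ (Function.uncurry u) (x, t) (1, 0) := by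
  have h1 : HasDerivAt (fun y : ℝ => (y, t)) ((1 : ℝ), (0 : ℝ)) x :=
    (hasDerivAt_id x).prodMk (hasDerivAt_const x t)
  exact ((h.hasFDerivAt (x, t)).comp_hasDerivAt x h1).deriv

theorem Sm.dt_eq (h : Sm u) (x t : ℝ) :
    Dt u x t = fderiv ℝ (Function.uncurry u) (x, t) (0, 1) := by
  have h1 : HasDerivAt (fun s : ℝ => (x, s)) ((0 : ℝ), (1 : ℝ)) t :=
    (hasDerivAt_const t x).prodMk (hasDerivAt_id t)
  exact ((h.hasFDerivAt (x, t)).comp_hasDerivAt t h1).deriv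

theorem Sm.fderiv_smooth (h : Sm u) : ContDiff ℝ ∞ (fderiv ℝ (Function.uncurry u)) :=
  ContDiff.fderiv_right h (by simp)

theorem Sm.dx (h : Sm u) : Sm (Dx u) := by
  have : Function.uncurry (Dx u) = fun z => fderiv ℝ (Function.uncurry u) z (1, 0) := by
    ext ⟨x, t⟩; exact h.dx_eq x t
  rw [Sm, this]
  exact h.fderiv_smooth.clm_apply contDiff_const

theorem Sm.dt (h : Sm u) : Sm (Dt u) := by
  have : Function.uncurry (Dt u) = fun z => fderiv ℝ (Function.uncurry u) z (0, 1) := by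
    ext ⟨x, t⟩; exact h.dt_eq x t
  rw [Sm, this]
  exact h.fderiv_smooth.clm_apply contDiff_const

theorem Sm.continuous (h : Sm u) : Continuous (Function.uncurry u) := ContDiff.continuous h

theorem Sm.dx_dt (h : Sm u) : Dx (Dt u) = Dt (Dx u) := by
  ext x t
  have hs : IsSymmSndFDerivAt ℝ (Function.uncurry u) (x, t) :=
    ContDiffAt.isSymmSndFDerivAt (n := ∞) (ContDiff.contDiffAt h)
      (by rw [minSmoothness_of_isRCLikeNormedField]; exact WithTop.coe_le_coe.2 le_top)
  have h2 : HasFDerivAt (fderiv ℝ (Function.uncurry u))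
      (fderiv ℝ (fderiv ℝ (Function.uncurry u)) (x, t)) (x, t) :=
    (h.fderiv_smooth.differentiable (by simp) _).hasFDerivAt
  have key : ∀ a b : ℝ × ℝ, ∀ c : ℝ → ℝ × ℝ, ∀ r, c r = (x, t) → HasDerivAt c a r →
      deriv (fun s => fderiv ℝ (Function.uncurry u) (c s) b) r
        = fderiv ℝ (fderiv ℝ (Function.uncurry u)) (x, t) a b := by
    intro a b c r hr hc
    have h3 := ((ContinuousLinearMap.apply ℝ ℂ b).hasFDerivAt.comp (x, t) h2)
    rw [← hr] at h3
    have h4 := (h3.comp_hasDerivAt r hc).deriv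
    rw [hr] at h4
    exact h4
  have e1 : Dx (Dt u) x t = fderiv ℝ (fderiv ℝ (Function.uncurry u)) (x, t) (1, 0) (0, 1) := by
    have : (fun y => Dt u y t) = fun y => fderiv ℝ (Function.uncurry u) (y, t) (0, 1) := by
      ext y; exact h.dt_eq y t
    rw [Dx, this]
    exact key _ _ (fun y => (y, t)) x rfl ((hasDerivAt_id x).prodMk (hasDerivAt_const x t))
  have e2 : Dt (Dx u) x t = fderiv ℝ (fderiv ℝ (Function.uncurry u)) (x, t) (0, 1) (1, 0) := by
    have : (fun s => Dx u x s) = fun s => fderiv ℝ (Function.uncurry u) (x, s) (1, 0) := by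
      ext y; exact h.dx_eq x y
    rw [Dt, this]
    exact key _ _ (fun s => (x, s)) t rfl ((hasDerivAt_const t x).prodMk (hasDerivAt_id t))
  rw [e1, e2]
  exact hs _ _

theorem pd_zero_zero (u : ℝ → ℝ → ℂ) : pd u 0 0 = u := by
  ext x t; simp [pd]

theorem pd_succ_left (u : ℝ → ℝ → ℂ) (i j : ℕ) : pd u (i + 1) j = Dt (pd u i j) := by
  ext x t; simp only [pd, iteratedDeriv_succ, Dt]

theorem pd_zero_succ (u : ℝ → ℝ → ℂ) (j : ℕ) : pd u 0 (j + 1) = Dx (pd u 0 j) := by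
  ext x t; simp [pd, iteratedDeriv_succ, Dx]

theorem pd_dx (u : ℝ → ℝ → ℂ) (i j : ℕ) : pd (Dx u) i j = pd u i (j + 1) := by
  ext x t; simp only [pd, iteratedDeriv_succ', Dx]

theorem Sm.pd (h : Sm u) (i j : ℕ) : Sm (pd u i j) := by
  induction i with
  | zero =>
    induction j with
    | zero => rwa [pd_zero_zero]
    | succ j ih => rw [pd_zero_succ]; exact ih.dx
  | succ i ih => rw [pd_succ_left]; exact ih.dt

theorem Sm.dx_pd (h : Sm u) (i j : ℕ) : Dx (_root_.pd u i j) = _root_.pd u i (j + 1) := by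
  induction i with
  | zero => rw [pd_zero_succ]
  | succ i ih => rw [pd_succ_left, (h.pd i j).dx_dt, ih, pd_succ_left]

theorem Sm.pd_dt (h : Sm u) (i j : ℕ) : _root_.pd (Dt u) i j = _root_.pd u (i + 1) j := by
  induction i with
  | zero =>
    induction j with
    | zero => rw [pd_succ_left, pd_zero_zero, pd_zero_zero]
    | succ j ih => rw [pd_zero_succ, ih, h.dx_pd]
  | succ i ih => rw [pd_succ_left, ih, ← pd_succ_left]

theorem Dx_eq_pd (u : ℝ → ℝ → ℂ) : Dx u = pd u 0 1 := by
  rw [pd_zero_succ, pd_zero_zero]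

theorem Dt_eq_pd (u : ℝ → ℝ → ℂ) : Dt u = pd u 1 0 := by
  rw [pd_succ_left, pd_zero_zero]

/-- A family of continuous functions closed under partial differentiation consists of
smooth functions. -/
theorem sm_of_family {f : ℕ → ℕ → ℝ → ℝ → ℂ} (hc : ∀ i j, Continuous (Function.uncurry (f i j)))
    (hx : ∀ i j x t, HasDerivAt (fun y => f i j y t) (f i (j + 1) x t) x)
    (ht : ∀ i j x t, HasDerivAt (fun s => f i j x s) (f (i + 1) j x t) t) :
    ∀ i j, Sm (f i j) := by
  have key : ∀ i j (z : ℝ × ℝ), HasFDerivAt (Function.uncurry (f i j))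
      ((ContinuousLinearMap.toSpanSingleton ℝ (f i (j + 1) z.1 z.2)).coprod
        (ContinuousLinearMap.toSpanSingleton ℝ (f (i + 1) j z.1 z.2))) z := by
    intro i j z
    refine (hasStrictFDerivAt_uncurry_coprod (𝕜 := ℝ) (f := f i j)
      (f₁ := fun x t => ContinuousLinearMap.toSpanSingleton ℝ (f i (j + 1) x t))
      (f₂ := fun x t => ContinuousLinearMap.toSpanSingleton ℝ (f (i + 1) j x t))
      (Eventually.of_forall fun w => ?_) (Eventually.of_forall fun w => ?_) ?_ ?_).hasFDerivAt
    · exact (hx i j w.1 w.2).hasFDerivAt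
    · exact (ht i j w.1 w.2).hasFDerivAt
    · exact ((ContinuousLinearMap.toSpanSingletonCLE (𝕜 := ℝ) (E := ℂ)).continuous.comp
        (hc i (j + 1))).continuousAt
    · exact ((ContinuousLinearMap.toSpanSingletonCLE (𝕜 := ℝ) (E := ℂ)).continuous.comp
        (hc (i + 1) j)).continuousAt
  have hn : ∀ n : ℕ, ∀ i j, ContDiff ℝ n (Function.uncurry (f i j)) := by
    intro n
    induction n with
    | zero => intro i j; simpa using hc i j
    | succ n ih =>
      intro i j
      rw [Nat.cast_succ, contDiff_succ_iff_hasFDerivAt]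
      refine ⟨_, ?_, key i j⟩
      have h1 : ContDiff ℝ n fun z : ℝ × ℝ =>
          ContinuousLinearMap.toSpanSingleton ℝ (f i (j + 1) z.1 z.2) :=
        (ContinuousLinearMap.toSpanSingletonCLE (𝕜 := ℝ) (E := ℂ)).contDiff.comp (ih i (j + 1))
      have h2 : ContDiff ℝ n fun z : ℝ × ℝ =>
          ContinuousLinearMap.toSpanSingleton ℝ (f (i + 1) j z.1 z.2) :=
        (ContinuousLinearMap.toSpanSingletonCLE (𝕜 := ℝ) (E := ℂ)).contDiff.comp (ih (i + 1) j)
      have h3 := (h1.clm_comp (f := fun _ => ContinuousLinearMap.fst ℝ ℝ ℝ) contDiff_const).add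
        (h2.clm_comp (f := fun _ => ContinuousLinearMap.snd ℝ ℝ ℝ) contDiff_const)
      convert! h3 using 2
  exact fun i j => contDiff_infty.2 fun n => hn n i j

theorem pd_of_family {f : ℕ → ℕ → ℝ → ℝ → ℂ}
    (hx : ∀ i j x t, HasDerivAt (fun y => f i j y t) (f i (j + 1) x t) x)
    (ht : ∀ i j x t, HasDerivAt (fun s => f i j x s) (f (i + 1) j x t) t) (i j : ℕ) :
    pd (f 0 0) i j = f i j := by
  induction i with
  | zero =>
    induction j with
    | zero => exact pd_zero_zero _
    | succ j ih => rw [pd_zero_succ, ih]; ext x t; exact (hx _ _ _ _).deriv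
  | succ i ih => rw [pd_succ_left, ih]; ext x t; exact (ht _ _ _ _).deriv

theorem Sm.add (hu : Sm u) (hv : Sm v) : Sm (u + v) := ContDiff.add hu hv
theorem Sm.sub (hu : Sm u) (hv : Sm v) : Sm (u - v) := ContDiff.sub hu hv
theorem Sm.mul (hu : Sm u) (hv : Sm v) : Sm (u * v) := ContDiff.mul hu hv
theorem Sm.star (hu : Sm u) : Sm (star u) :=
  (starL' ℝ (A := ℂ)).contDiff.comp (ContDiff.of_le hu le_rfl)
theorem Sm.const (c : ℂ) : Sm (fun _ _ => c) := contDiff_const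
theorem Sm.smul (c : ℂ) (hu : Sm u) : Sm (c • u) := ContDiff.const_smul c hu

theorem Sm.of_x {f : ℝ → ℂ} (hf : ContDiff ℝ ∞ f) : Sm (fun x _ => f x) :=
  hf.comp contDiff_fst
theorem Sm.of_t {f : ℝ → ℂ} (hf : ContDiff ℝ ∞ f) : Sm (fun _ t => f t) :=
  hf.comp contDiff_snd

theorem Sm.sum {ι : Type*} {s : Finset ι} {w : ι → ℝ → ℝ → ℂ} (h : ∀ k ∈ s, Sm (w k)) :
    Sm (∑ k ∈ s, w k) := by
  classical
  induction s using Finset.induction_on with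
  | empty => simpa using! Sm.const 0
  | insert a s ha ih =>
    rw [Finset.sum_insert ha]
    exact (h a (by simp)).add (ih fun k hk => h k (by simp [hk]))

theorem dx_add (hu : Sm u) (hv : Sm v) : Dx (u + v) = Dx u + Dx v := by
  ext x t; exact ((hu.hasDerivAt_x x t).add (hv.hasDerivAt_x x t)).deriv
theorem dt_add (hu : Sm u) (hv : Sm v) : Dt (u + v) = Dt u + Dt v := by
  ext x t; exact ((hu.hasDerivAt_t x t).add (hv.hasDerivAt_t x t)).deriv
theorem dx_sub (hu : Sm u) (hv : Sm v) : Dx (u - v) = Dx u - Dx v := by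
  ext x t; exact ((hu.hasDerivAt_x x t).sub (hv.hasDerivAt_x x t)).deriv
theorem dt_sub (hu : Sm u) (hv : Sm v) : Dt (u - v) = Dt u - Dt v := by
  ext x t; exact ((hu.hasDerivAt_t x t).sub (hv.hasDerivAt_t x t)).deriv
theorem dx_mul (hu : Sm u) (hv : Sm v) : Dx (u * v) = Dx u * v + u * Dx v := by
  ext x t; exact ((hu.hasDerivAt_x x t).mul (hv.hasDerivAt_x x t)).deriv
theorem dt_mul (hu : Sm u) (hv : Sm v) : Dt (u * v) = Dt u * v + u * Dt v := by
  ext x t; exact ((hu.hasDerivAt_t x t).mul (hv.hasDerivAt_t x t)).deriv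
theorem dx_star (hu : Sm u) : Dx (star u) = star (Dx u) := by
  ext x t; exact (hu.hasDerivAt_x x t).star.deriv
theorem dt_star (hu : Sm u) : Dt (star u) = star (Dt u) := by
  ext x t; exact (hu.hasDerivAt_t x t).star.deriv

theorem pd_add (hu : Sm u) (hv : Sm v) (i j : ℕ) : pd (u + v) i j = pd u i j + pd v i j := by
  induction i with
  | zero =>
    induction j with
    | zero => simp only [pd_zero_zero]
    | succ j ih => simp only [pd_zero_succ]; rw [ih, dx_add (hu.pd _ _) (hv.pd _ _)]
  | succ i ih => simp only [pd_succ_left]; rw [ih, dt_add (hu.pd _ _) (hv.pd _ _)]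

theorem pd_sub (hu : Sm u) (hv : Sm v) (i j : ℕ) : pd (u - v) i j = pd u i j - pd v i j := by
  induction i with
  | zero =>
    induction j with
    | zero => simp only [pd_zero_zero]
    | succ j ih => simp only [pd_zero_succ]; rw [ih, dx_sub (hu.pd _ _) (hv.pd _ _)]
  | succ i ih => simp only [pd_succ_left]; rw [ih, dt_sub (hu.pd _ _) (hv.pd _ _)]

theorem pd_star (hu : Sm u) (i j : ℕ) : pd (star u) i j = star (pd u i j) := by
  induction i with
  | zero =>
    induction j with
    | zero => simp only [pd_zero_zero]
    | succ j ih => simp only [pd_zero_succ]; rw [ih, dx_star (hu.pd _ _)]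
  | succ i ih => simp only [pd_succ_left]; rw [ih, dt_star (hu.pd _ _)]

theorem pd_sum {ι : Type*} {s : Finset ι} {w : ι → ℝ → ℝ → ℂ} (h : ∀ k ∈ s, Sm (w k)) (i j : ℕ) :
    pd (∑ k ∈ s, w k) i j = ∑ k ∈ s, pd (w k) i j := by
  classical
  induction s using Finset.induction_on with
  | empty =>
    ext x t
    simp [pd]
  | insert a s ha ih =>
    rw [Finset.sum_insert ha, Finset.sum_insert ha,
      pd_add (h a (by simp)) (Sm.sum fun k hk => h k (by simp [hk])),
      ih fun k hk => h k (by simp [hk])]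

theorem pd_zero_mul (hu : Sm u) (hv : Sm v) (j : ℕ) :
    pd (u * v) 0 j = ∑ q ∈ Finset.range (j + 1), (j.choose q : ℂ) • (pd u 0 q * pd v 0 (j - q)) := by
  ext x t
  have h := iteratedDeriv_fun_mul (n := j) (x := x) ((hu.slice_x t).contDiffAt.of_le (by exact_mod_cast le_top))
    ((hv.slice_x t).contDiffAt.of_le (by exact_mod_cast le_top))
  simp only [pd, iteratedDeriv_zero, Finset.sum_apply, Pi.smul_apply, Pi.mul_apply, smul_eq_mul]
  rw [h]
  exact Finset.sum_congr rfl fun q _ => by ring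

theorem pd_tensor (f g : ℝ → ℂ) (i j : ℕ) (x t : ℝ) :
    pd (fun x t => f t * g x) i j x t = iteratedDeriv i f t * iteratedDeriv j g x := by
  simp only [pd, iteratedDeriv_const_mul_field, iteratedDeriv_mul_const_field]

theorem pd_mul (hu : Sm u) (hv : Sm v) (i j : ℕ) :
    pd (u * v) i j = ∑ p ∈ Finset.range (i + 1), ∑ q ∈ Finset.range (j + 1),
      ((i.choose p * j.choose q : ℕ) : ℂ) • (pd u p q * pd v (i - p) (j - q)) := by
  have h0 : pd (u * v) i j = fun x t => iteratedDeriv i (fun s => pd (u * v) 0 j x s) t := by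
    ext x t; simp [pd]
  have h1 : ∀ (w : ℝ → ℝ → ℂ) i j x t, iteratedDeriv i (fun s => pd w 0 j x s) t = pd w i j x t := by
    intro w i j x t; simp [pd]
  ext x t
  rw [h0, pd_zero_mul hu hv]
  simp only [Finset.sum_apply, Pi.smul_apply, Pi.mul_apply, smul_eq_mul]
  rw [iteratedDeriv_fun_sum]
  · rw [Finset.sum_comm]
    refine Finset.sum_congr rfl fun q hq => ?_
    rw [iteratedDeriv_const_mul_field, iteratedDeriv_fun_mul, Finset.mul_sum]
    · refine Finset.sum_congr rfl fun p _ => ?_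
      rw [h1, h1]; push_cast; ring
    · exact (((hu.pd 0 q).slice_t x).contDiffAt.of_le (by exact_mod_cast le_top))
    · exact (((hv.pd 0 (j - q)).slice_t x).contDiffAt.of_le (by exact_mod_cast le_top))
  · intro q _
    exact contDiffAt_const.mul ((((hu.pd 0 q).slice_t x).mul
      ((hv.pd 0 (j - q)).slice_t x)).contDiffAt.of_le (by exact_mod_cast le_top))

theorem pd_neg_x (u : ℝ → ℝ → ℂ) (i j : ℕ) (x t : ℝ) :
    pd (fun x t => u (-x) t) i j x t = (-1) ^ j * pd u i j (-x) t := by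
  have h : ∀ s, iteratedDeriv j (fun y => u (-y) s) x
      = (-1) ^ j * iteratedDeriv j (fun y => u y s) (-x) := by
    intro s
    rw [iteratedDeriv_comp_neg j (fun y => u y s)]; simp
  simp only [pd, h, iteratedDeriv_const_mul_field]

theorem Sm.neg_x (hu : Sm u) : Sm (fun x t => u (-x) t) :=
  ContDiff.comp (g := Function.uncurry u) hu (contDiff_fst.neg.prodMk contDiff_snd)

/-- `pd` only depends on the values for nearby `x`. -/
theorem pd_congr_nhds {x : ℝ} (h : ∀ᶠ y in 𝓝 x, ∀ t, u y t = v y t) (i j : ℕ) (t : ℝ) :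
    pd u i j x t = pd v i j x t := by
  have h1 : ∀ s, iteratedDeriv j (fun y => u y s) x = iteratedDeriv j (fun y => v y s) x :=
    fun s => Filter.EventuallyEq.iteratedDeriv_eq j (h.mono fun y hy => hy s)
  simp only [pd, h1]

end NLS

namespace NLS

open Filter Topology
open scoped ContDiff

/-! ### Symbol classes -/

/-- The weight `max 1 |x|`. -/
def jb (x : ℝ) : ℝ := max 1 |x|

theorem one_le_jb (x : ℝ) : 1 ≤ jb x := le_max_left _ _
theorem jb_pos (x : ℝ) : 0 < jb x := one_pos.trans_le (one_le_jb x)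
theorem abs_le_jb (x : ℝ) : |x| ≤ jb x := le_max_right _ _
theorem jb_neg (x : ℝ) : jb (-x) = jb x := by simp [jb]
theorem jb_of_one_le {x : ℝ} (h : 1 ≤ x) : jb x = x := by
  rw [jb, abs_of_nonneg (by linarith), max_eq_right h]
theorem jb_of_le {x : ℝ} (h : x ≤ -1) : jb x = -x := by
  rw [jb, abs_of_nonpos (by linarith), max_eq_right (by linarith)]
theorem jb_of_abs_le {x : ℝ} (h : |x| ≤ 1) : jb x = 1 := by rw [jb, max_eq_left h]
theorem continuous_jb : Continuous jb := continuous_const.max continuous_abs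

theorem jb_rpow_pos (x γ : ℝ) : 0 < jb x ^ γ := Real.rpow_pos_of_pos (jb_pos x) γ

variable {ι : Type*} {k : ℕ} {ρ ρ' : ι → ℝ} {γ γ' : ℝ} {u v : ι → ℝ → ℝ → ℂ}

/-- A family of symbols of order `γ`, with at most `k` time derivatives controlled, whose
seminorms are `O(ρ)`. -/
def Sy (k : ℕ) (ρ : ι → ℝ) (γ : ℝ) (u : ι → ℝ → ℝ → ℂ) : Prop :=
  (∀ n, Sm (u n)) ∧ ∀ i j : ℕ, i ≤ k → ∃ C : ℝ, ∀ n x t,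
    ‖pd (u n) i j x t‖ ≤ C * ρ n * jb x ^ (γ - j)

theorem Sy.mono_order (h : Sy k ρ γ u) (hγ : γ ≤ γ') : Sy k ρ γ' u := by
  refine ⟨h.1, fun i j hi => ?_⟩
  obtain ⟨C, hC⟩ := h.2 i j hi
  refine ⟨C, fun n x t => (hC n x t).trans ?_⟩
  have h0 : 0 ≤ C * ρ n :=
    nonneg_of_mul_nonneg_left ((norm_nonneg _).trans (hC n x t)) (jb_rpow_pos x _)
  exact mul_le_mul_of_nonneg_left
    (Real.rpow_le_rpow_of_exponent_le (one_le_jb x) (by linarith)) h0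

theorem Sy.add (hu : Sy k ρ γ u) (hv : Sy k ρ γ v) : Sy k ρ γ (fun n => u n + v n) := by
  refine ⟨fun n => (hu.1 n).add (hv.1 n), fun i j hi => ?_⟩
  obtain ⟨C, hC⟩ := hu.2 i j hi
  obtain ⟨C', hC'⟩ := hv.2 i j hi
  refine ⟨C + C', fun n x t => ?_⟩
  rw [pd_add (hu.1 n) (hv.1 n), add_mul, add_mul]
  exact norm_add_le_of_le (hC n x t) (hC' n x t)

theorem Sy.sub (hu : Sy k ρ γ u) (hv : Sy k ρ γ v) : Sy k ρ γ (fun n => u n - v n) := by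
  refine ⟨fun n => (hu.1 n).sub (hv.1 n), fun i j hi => ?_⟩
  obtain ⟨C, hC⟩ := hu.2 i j hi
  obtain ⟨C', hC'⟩ := hv.2 i j hi
  refine ⟨C + C', fun n x t => ?_⟩
  rw [pd_sub (hu.1 n) (hv.1 n), add_mul, add_mul]
  exact norm_sub_le_of_le (hC n x t) (hC' n x t)

theorem Sy.star (hu : Sy k ρ γ u) : Sy k ρ γ (fun n => star (u n)) := by
  refine ⟨fun n => (hu.1 n).star, fun i j hi => ?_⟩
  obtain ⟨C, hC⟩ := hu.2 i j hi
  refine ⟨C, fun n x t => ?_⟩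
  rw [pd_star (hu.1 n)]
  simpa using hC n x t

theorem Sy.mul (hu : Sy k ρ γ u) (hv : Sy k ρ' γ' v) :
    Sy k (fun n => ρ n * ρ' n) (γ + γ') (fun n => u n * v n) := by
  refine ⟨fun n => (hu.1 n).mul (hv.1 n), fun i j hi => ?_⟩
  have h1 : ∀ p q : ℕ, ∃ C : ℝ, p ≤ k → ∀ n x t,
      ‖pd (u n) p q x t‖ ≤ C * ρ n * jb x ^ (γ - q) := fun p q => by
    by_cases hp : p ≤ k
    · obtain ⟨C, hC⟩ := hu.2 p q hp
      exact ⟨C, fun _ => hC⟩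
    · exact ⟨0, fun h => absurd h hp⟩
  have h2 : ∀ p q : ℕ, ∃ C : ℝ, p ≤ k → ∀ n x t,
      ‖pd (v n) p q x t‖ ≤ C * ρ' n * jb x ^ (γ' - q) := fun p q => by
    by_cases hp : p ≤ k
    · obtain ⟨C, hC⟩ := hv.2 p q hp
      exact ⟨C, fun _ => hC⟩
    · exact ⟨0, fun h => absurd h hp⟩
  choose A hA using h1
  choose B hB using h2
  refine ⟨∑ p ∈ Finset.range (i + 1), ∑ q ∈ Finset.range (j + 1),
    (i.choose p * j.choose q : ℕ) * (A p q * B (i - p) (j - q)), fun n x t => ?_⟩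
  rw [pd_mul (hu.1 n) (hv.1 n)]
  simp only [Finset.sum_apply, Finset.sum_mul]
  refine norm_sum_le_of_le _ fun p hp => norm_sum_le_of_le _ fun q hq => ?_
  have hp' : p ≤ i := Nat.lt_succ_iff.1 (Finset.mem_range.1 hp)
  have hq' : q ≤ j := Nat.lt_succ_iff.1 (Finset.mem_range.1 hq)
  have a := hA p q (hp'.trans hi) n x t
  have b := hB (i - p) (j - q) ((Nat.sub_le _ _).trans hi) n x t
  simp only [Pi.smul_apply, Pi.mul_apply, smul_eq_mul, norm_mul, Complex.norm_natCast]
  have e : jb x ^ (γ + γ' - j) = jb x ^ (γ - q) * jb x ^ (γ' - (j - q : ℕ)) := by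
    rw [← Real.rpow_add (jb_pos x), Nat.cast_sub hq']; congr 1; ring
  rw [e]
  calc ((i.choose p * j.choose q : ℕ) : ℝ) * (‖pd (u n) p q x t‖ * ‖pd (v n) (i - p) (j - q) x t‖)
      ≤ ((i.choose p * j.choose q : ℕ) : ℝ) * ((A p q * ρ n * jb x ^ (γ - q)) *
        (B (i - p) (j - q) * ρ' n * jb x ^ (γ' - (j - q : ℕ)))) := by
        refine mul_le_mul_of_nonneg_left ?_ (Nat.cast_nonneg _)
        exact mul_le_mul a b (norm_nonneg _) ((norm_nonneg _).trans a)
    _ = _ := by ring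

theorem Sy.dx (hu : Sy k ρ γ u) : Sy k ρ (γ - 1) (fun n => Dx (u n)) := by
  refine ⟨fun n => (hu.1 n).dx, fun i j hi => ?_⟩
  obtain ⟨C, hC⟩ := hu.2 i (j + 1) hi
  refine ⟨C, fun n x t => ?_⟩
  rw [pd_dx]
  convert hC n x t using 3
  push_cast; ring

theorem Sy.dt (hu : Sy (k + 1) ρ γ u) : Sy k ρ γ (fun n => Dt (u n)) := by
  refine ⟨fun n => (hu.1 n).dt, fun i j hi => ?_⟩
  obtain ⟨C, hC⟩ := hu.2 (i + 1) j (by omega)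
  refine ⟨C, fun n x t => ?_⟩
  rw [(hu.1 n).pd_dt]
  exact hC n x t

theorem Sy.succ_index (h0 : Sy 0 ρ γ u) (hu : Sy k ρ γ (fun n => Dt (u n))) :
    Sy (k + 1) ρ γ u := by
  refine ⟨h0.1, fun i j hi => ?_⟩
  cases i with
  | zero => exact h0.2 0 j le_rfl
  | succ i =>
    obtain ⟨C, hC⟩ := hu.2 i j (by omega)
    refine ⟨C, fun n x t => ?_⟩
    rw [← (h0.1 n).pd_dt]
    exact hC n x t

theorem Sy.comp {κ : Type*} (f : κ → ι) (hu : Sy k ρ γ u) :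
    Sy k (fun n => ρ (f n)) γ (fun n => u (f n)) :=
  ⟨fun _ => hu.1 _, fun i j hi => (hu.2 i j hi).imp fun _ hC _ => hC _⟩

theorem Sy.mono_weight (c : ℝ) (hu : Sy k ρ γ u) (h0 : ∀ n, 0 ≤ ρ n) (h : ∀ n, ρ n ≤ c * ρ' n) :
    Sy k ρ' γ u := by
  refine ⟨hu.1, fun i j hi => ?_⟩
  obtain ⟨C, hC⟩ := hu.2 i j hi
  refine ⟨|C| * c, fun n x t => (hC n x t).trans ?_⟩
  refine mul_le_mul_of_nonneg_right ?_ (jb_rpow_pos x _).le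
  calc C * ρ n ≤ |C| * ρ n := mul_le_mul_of_nonneg_right (le_abs_self C) (h0 n)
    _ ≤ |C| * (c * ρ' n) := mul_le_mul_of_nonneg_left (h n) (abs_nonneg C)
    _ = _ := by ring

/-- Symbols of order `γ`, with all time derivatives bounded. -/
def Sym (γ : ℝ) (u : ℝ → ℝ → ℂ) : Prop :=
  Sm u ∧ ∀ i j : ℕ, ∃ C : ℝ, ∀ x t, ‖pd u i j x t‖ ≤ C * jb x ^ (γ - j)

section
variable {u v : ℝ → ℝ → ℂ}

theorem sym_iff : Sym γ u ↔ ∀ k, Sy k (fun _ : Unit => 1) γ (fun _ => u) := by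
  constructor
  · intro h k
    refine ⟨fun _ => h.1, fun i j _ => ?_⟩
    obtain ⟨C, hC⟩ := h.2 i j
    exact ⟨C, fun _ x t => by simpa using hC x t⟩
  · intro h
    refine ⟨(h 0).1 (), fun i j => ?_⟩
    obtain ⟨C, hC⟩ := (h i).2 i j le_rfl
    exact ⟨C, fun x t => by simpa using hC () x t⟩

theorem Sym.sy (h : Sym γ u) (k : ℕ) (ι : Type*) : Sy k (fun _ : ι => 1) γ (fun _ => u) :=
  ((sym_iff.1 h) k).comp (fun _ : ι => ())

theorem Sym.mono (h : Sym γ u) (hγ : γ ≤ γ') : Sym γ' u :=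
  sym_iff.2 fun k => (sym_iff.1 h k).mono_order hγ

theorem Sym.add (hu : Sym γ u) (hv : Sym γ v) : Sym γ (u + v) :=
  sym_iff.2 fun k => (sym_iff.1 hu k).add (sym_iff.1 hv k)

theorem Sym.sub (hu : Sym γ u) (hv : Sym γ v) : Sym γ (u - v) :=
  sym_iff.2 fun k => (sym_iff.1 hu k).sub (sym_iff.1 hv k)

theorem Sym.star (hu : Sym γ u) : Sym γ (star u) :=
  sym_iff.2 fun k => (sym_iff.1 hu k).star

theorem Sym.mul (hu : Sym γ u) (hv : Sym γ' v) : Sym (γ + γ') (u * v) :=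
  sym_iff.2 fun k => by simpa using (sym_iff.1 hu k).mul (sym_iff.1 hv k)

theorem Sym.dx (hu : Sym γ u) : Sym (γ - 1) (Dx u) :=
  sym_iff.2 fun k => (sym_iff.1 hu k).dx

theorem Sym.dt (hu : Sym γ u) : Sym γ (Dt u) :=
  sym_iff.2 fun k => (sym_iff.1 hu (k + 1)).dt

theorem Sym.tensor {f g : ℝ → ℂ} (hf : ContDiff ℝ ∞ f) (hg : ContDiff ℝ ∞ g)
    (bf : ∀ i, ∃ C, ∀ t, ‖iteratedDeriv i f t‖ ≤ C)
    (bg : ∀ j : ℕ, ∃ C, ∀ x, ‖iteratedDeriv j g x‖ ≤ C * jb x ^ (γ - j)) :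
    Sym γ (fun x t => f t * g x) := by
  refine ⟨(Sm.of_t hf).mul (Sm.of_x hg), fun i j => ?_⟩
  obtain ⟨C, hC⟩ := bf i
  obtain ⟨C', hC'⟩ := bg j
  refine ⟨C * C', fun x t => ?_⟩
  rw [pd_tensor, norm_mul, mul_assoc]
  exact mul_le_mul (hC t) (hC' x) (norm_nonneg _) ((norm_nonneg _).trans (hC t))

theorem Sym.of_x {g : ℝ → ℂ} (hg : ContDiff ℝ ∞ g)
    (bg : ∀ j : ℕ, ∃ C, ∀ x, ‖iteratedDeriv j g x‖ ≤ C * jb x ^ (γ - j)) :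
    Sym γ (fun x _ => g x) := by
  have := Sym.tensor (f := fun _ => 1) (contDiff_const) hg (fun i => ⟨1, fun t => ?_⟩) bg
  · simpa using this
  · rw [iteratedDeriv_const]; split_ifs <;> simp

theorem iteratedDeriv_const_bound (c : ℂ) (j : ℕ) (x : ℝ) :
    ‖iteratedDeriv j (fun _ : ℝ => c) x‖ ≤ ‖c‖ * jb x ^ ((0 : ℝ) - j) := by
  rw [iteratedDeriv_const]; split_ifs with h
  · simp [h]
  · rw [norm_zero]; exact mul_nonneg (norm_nonneg _) (jb_rpow_pos x _).le

theorem Sym.of_t {f : ℝ → ℂ} (hf : ContDiff ℝ ∞ f)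
    (bf : ∀ i, ∃ C, ∀ t, ‖iteratedDeriv i f t‖ ≤ C) : Sym 0 (fun _ t => f t) := by
  have := Sym.tensor (g := fun _ => 1) (γ := 0) hf contDiff_const bf
    (fun j => ⟨‖(1 : ℂ)‖, iteratedDeriv_const_bound 1 j⟩)
  simpa using this

theorem Sym.const (c : ℂ) : Sym 0 (fun _ _ => c) :=
  Sym.of_x contDiff_const fun j => ⟨‖c‖, iteratedDeriv_const_bound c j⟩

theorem Sym.smul (c : ℂ) (hu : Sym γ u) : Sym γ (c • u) := by
  have := (Sym.const c).mul hu
  rw [zero_add] at this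
  exact this

theorem Sym.zero (γ : ℝ) : Sym γ (0 : ℝ → ℝ → ℂ) := by
  refine ⟨Sm.const 0, fun i j => ⟨0, fun x t => ?_⟩⟩
  have : pd (0 : ℝ → ℝ → ℂ) i j x t = 0 := by
    have := pd_sum (s := (∅ : Finset ℕ)) (w := fun _ _ _ => 0) (by simp) i j
    simp at this; rw [this]; rfl
  simp [this]

theorem Sym.sum {κ : Type*} {s : Finset κ} {w : κ → ℝ → ℝ → ℂ} (h : ∀ k ∈ s, Sym γ (w k)) :
    Sym γ (∑ k ∈ s, w k) := by
  classical
  induction s using Finset.induction_on with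
  | empty => simpa using Sym.zero γ
  | insert a s ha ih =>
    rw [Finset.sum_insert ha]
    exact (h a (by simp)).add (ih fun k hk => h k (by simp [hk]))

theorem Sym.id : Sym 1 (fun x _ => (x : ℂ)) := by
  refine Sym.of_x Complex.ofRealCLM.contDiff fun j => ⟨1, fun x => ?_⟩
  have hd : deriv (fun x : ℝ => (x : ℂ)) = fun _ => 1 := by
    ext y; exact Complex.ofRealCLM.hasDerivAt.deriv
  rcases j with _ | j
  · simpa using abs_le_jb x
  · rw [iteratedDeriv_succ', hd]
    refine (iteratedDeriv_const_bound 1 j x).trans (le_of_eq ?_)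
    simp

theorem Sym.neg_x (hu : Sym γ u) : Sym γ (fun x t => u (-x) t) := by
  refine ⟨hu.1.neg_x, fun i j => ?_⟩
  obtain ⟨C, hC⟩ := hu.2 i j
  refine ⟨C, fun x t => ?_⟩
  rw [pd_neg_x]
  simpa [jb_neg] using hC (-x) t

theorem Sym.of_pieces (h : Sm u)
    (hp : ∀ i j : ℕ, ∃ C : ℝ, ∀ x t, 1 ≤ x → ‖pd u i j x t‖ ≤ C * x ^ (γ - j))
    (hm : ∀ i j : ℕ, ∃ C : ℝ, ∀ x t, x ≤ -1 → ‖pd u i j x t‖ ≤ C * (-x) ^ (γ - j))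
    (h0 : ∀ i j : ℕ, ∃ C : ℝ, ∀ x t, |x| ≤ 1 → ‖pd u i j x t‖ ≤ C) : Sym γ u := by
  refine ⟨h, fun i j => ?_⟩
  obtain ⟨A, hA⟩ := hp i j
  obtain ⟨B, hB⟩ := hm i j
  obtain ⟨D, hD⟩ := h0 i j
  refine ⟨max A (max B D), fun x t => ?_⟩
  rcases le_total |x| 1 with hx | hx
  · rw [jb_of_abs_le hx, Real.one_rpow, mul_one]
    exact (hD x t hx).trans ((le_max_right _ _).trans (le_max_right _ _))
  · rcases le_abs.1 hx with hx | hx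
    · refine (hA x t hx).trans ?_
      rw [jb_of_one_le hx]
      exact mul_le_mul_of_nonneg_right (le_max_left _ _) (Real.rpow_nonneg (by linarith) _)
    · have hx' : x ≤ -1 := by linarith
      refine (hB x t hx').trans ?_
      rw [jb_of_le hx']
      exact mul_le_mul_of_nonneg_right ((le_max_left _ _).trans (le_max_right _ _))
        (Real.rpow_nonneg (by linarith) _)

/-- Functions all of whose derivatives are rapidly decreasing in `x`, uniformly in `t`. -/
def Rapid (u : ℝ → ℝ → ℂ) : Prop := ∀ γ, Sym γ u

theorem Rapid.sm (h : Rapid u) : Sm u := (h 0).1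
theorem Rapid.add (hu : Rapid u) (hv : Rapid v) : Rapid (u + v) := fun γ => (hu γ).add (hv γ)
theorem Rapid.sub (hu : Rapid u) (hv : Rapid v) : Rapid (u - v) := fun γ => (hu γ).sub (hv γ)
theorem Rapid.star (hu : Rapid u) : Rapid (star u) := fun γ => (hu γ).star
theorem Rapid.smul (c : ℂ) (hu : Rapid u) : Rapid (c • u) := fun γ => (hu γ).smul c
theorem Rapid.zero : Rapid (0 : ℝ → ℝ → ℂ) := fun γ => Sym.zero γ
theorem Rapid.dx (hu : Rapid u) : Rapid (Dx u) := fun γ => by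
  simpa using (hu (γ + 1)).dx
theorem Rapid.dt (hu : Rapid u) : Rapid (Dt u) := fun γ => (hu γ).dt
theorem Rapid.sym_mul (hu : Sym γ u) (hv : Rapid v) : Rapid (u * v) := fun γ' => by
  simpa using hu.mul (hv (γ' - γ))
theorem Rapid.mul_sym (hu : Rapid u) (hv : Sym γ v) : Rapid (u * v) := by
  rw [mul_comm]; exact Rapid.sym_mul hv hu
theorem Rapid.mul (hu : Rapid u) (hv : Rapid v) : Rapid (u * v) := Rapid.sym_mul (hu 0) hv
theorem Rapid.pd (hu : Rapid u) (i j : ℕ) : Rapid (pd u i j) := by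
  induction i with
  | zero =>
    induction j with
    | zero => rwa [pd_zero_zero]
    | succ j ih => rw [pd_zero_succ]; exact ih.dx
  | succ i ih => rw [pd_succ_left]; exact ih.dt

/-- A rapid function and its derivatives are bounded by any power. -/
theorem Rapid.bound (hu : Rapid u) (i j : ℕ) (γ : ℝ) :
    ∃ C, 0 ≤ C ∧ ∀ x t, ‖_root_.pd u i j x t‖ ≤ C * jb x ^ γ := by
  obtain ⟨C, hC⟩ := (hu (γ + j)).2 i j
  refine ⟨C, ?_, fun x t => by simpa using hC x t⟩
  exact nonneg_of_mul_nonneg_left ((norm_nonneg _).trans (hC 0 0)) (jb_rpow_pos 0 _)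

end

/-! ### Smooth functions that are eventually constant -/

/-- Smooth functions on the line which are constant near `±∞`. -/
def EC (f : ℝ → ℂ) : Prop :=
  ContDiff ℝ ∞ f ∧ ∃ R : ℝ, (∀ t, R ≤ t → f t = f R) ∧ ∀ t, t ≤ -R → f t = f (-R)

theorem EC.deriv {f : ℝ → ℂ} (h : EC f) : EC (deriv f) := by
  obtain ⟨h1, R, h2, h3⟩ := h
  refine ⟨(contDiff_infty_iff_deriv.1 h1).2, R + 1, ?_, ?_⟩
  · have : ∀ t, R + 1 ≤ t → _root_.deriv f t = 0 := fun t ht => by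
      have : f =ᶠ[𝓝 t] fun _ => f R := by
        filter_upwards [lt_mem_nhds (show R < t by linarith)] with s hs using h2 s hs.le
      rw [this.deriv_eq]; simp
    intro t ht; rw [this t ht, this _ le_rfl]
  · have : ∀ t, t ≤ -(R + 1) → _root_.deriv f t = 0 := fun t ht => by
      have : f =ᶠ[𝓝 t] fun _ => f (-R) := by
        filter_upwards [gt_mem_nhds (show t < -R by linarith)] with s hs using h3 s hs.le
      rw [this.deriv_eq]; simp
    intro t ht; rw [this t ht, this _ le_rfl]

theorem EC.bounded {f : ℝ → ℂ} (h : EC f) : ∃ C, ∀ t, ‖f t‖ ≤ C := by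
  obtain ⟨h1, R, h2, h3⟩ := h
  obtain ⟨C, hC⟩ := (isCompact_Icc (a := -|R|) (b := |R|)).exists_bound_of_continuousOn
    h1.continuous.continuousOn
  refine ⟨C, fun t => ?_⟩
  have hR := abs_nonneg R
  rcases le_total R t with h | h
  · rw [h2 t h]; exact hC _ ⟨neg_abs_le R, le_abs_self R⟩
  · rcases le_total t (-R) with h' | h'
    · rw [h3 t h']; exact hC _ ⟨by linarith [le_abs_self R], by linarith [neg_abs_le R]⟩
    · exact hC _ ⟨by linarith [le_abs_self R], by linarith [le_abs_self R]⟩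

theorem EC.iteratedDeriv {f : ℝ → ℂ} (h : EC f) (i : ℕ) : EC (iteratedDeriv i f) := by
  induction i with
  | zero => simpa using h
  | succ i ih => rw [iteratedDeriv_succ]; exact ih.deriv

theorem EC.bounded_iteratedDeriv {f : ℝ → ℂ} (h : EC f) (i : ℕ) :
    ∃ C, ∀ t, ‖_root_.iteratedDeriv i f t‖ ≤ C := (h.iteratedDeriv i).bounded

theorem EC.sym {f : ℝ → ℂ} (h : EC f) : Sym 0 (fun _ t => f t) :=
  Sym.of_t h.1 h.bounded_iteratedDeriv

theorem EC.smul (c : ℂ) {f : ℝ → ℂ} (h : EC f) : EC (fun t => c * f t) := by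
  obtain ⟨h1, R, h2, h3⟩ := h
  exact ⟨contDiff_const.mul h1, R, fun t ht => congrArg (c * ·) (h2 t ht),
    fun t ht => congrArg (c * ·) (h3 t ht)⟩

theorem EC.add {f g : ℝ → ℂ} (hf : EC f) (hg : EC g) : EC (fun t => f t + g t) := by
  obtain ⟨h1, R, h2, h3⟩ := hf
  obtain ⟨h1', R', h2', h3'⟩ := hg
  refine ⟨h1.add h1', max R R', fun t ht => ?_, fun t ht => ?_⟩
  · beta_reduce
    rw [h2 t ((le_max_left _ _).trans ht), h2' t ((le_max_right _ _).trans ht),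
      h2 _ (le_max_left _ _), h2' _ (le_max_right _ _)]
  · have a := le_max_left R R'
    have b := le_max_right R R'
    beta_reduce
    rw [h3 t (by linarith), h3' t (by linarith), h3 (-max R R') (by linarith), h3' (-max R R') (by linarith)]

end NLS

namespace NLS

open Filter Topology
open scoped ContDiff

/-- Strong recursion for sequences of witnesses. -/
theorem exists_seq_of_local {α : Type*} [Inhabited α] (Q : ℕ → (ℕ → α) → α → Prop)
    (hQ : ∀ n f, ∃ a, Q n f a)
    (hloc : ∀ n f g a, (∀ m < n, f m = g m) → Q n f a → Q n g a) :
    ∃ c : ℕ → α, ∀ n, Q n c (c n) := by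
  classical
  let F : ∀ n : ℕ, (∀ m, m < n → α) → α := fun n ih =>
    (hQ n (fun m => if h : m < n then ih m h else default)).choose
  let c : ℕ → α := WellFounded.fix (C := fun _ => α) Nat.lt_wfRel.wf F
  have hc : ∀ n, c n = F n (fun m _ => c m) := fun n => WellFounded.fix_eq _ F n
  refine ⟨c, fun n => ?_⟩
  refine hloc n (fun m => if m < n then c m else default) c _ (fun m hm => if_pos hm) ?_
  rw [hc n]
  exact (hQ n (fun m => if h : m < n then (fun m _ => c m) m h else default)).choose_spec

/-! ### Series of smooth functions -/

section tsum
variable {d : ℕ → ℝ → ℝ → ℂ}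

theorem tsum_family (hd : ∀ k, Sm (d k))
    (hb : ∀ i j, ∃ g : ℕ → ℝ, Summable g ∧ ∀ k x t, ‖pd (d k) i j x t‖ ≤ g k) :
    Sm (fun x t => ∑' k, d k x t) ∧
      ∀ i j, pd (fun x t => ∑' k, d k x t) i j = fun x t => ∑' k, pd (d k) i j x t := by
  choose g hg hb using hb
  obtain ⟨f, hf⟩ : ∃ f : ℕ → ℕ → ℝ → ℝ → ℂ, ∀ i j x t, f i j x t = ∑' k, pd (d k) i j x t :=
    ⟨_, fun _ _ _ _ => rfl⟩
  have hfx : ∀ i j t, (fun x => f i j x t) = fun x => ∑' k, pd (d k) i j x t :=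
    fun i j t => funext fun x => hf i j x t
  have hft : ∀ i j x, (fun t => f i j x t) = fun t => ∑' k, pd (d k) i j x t :=
    fun i j x => funext fun t => hf i j x t
  have h0 : f 0 0 = fun x t => ∑' k, d k x t := by ext x t; simp [hf, pd_zero_zero]
  have hsum : ∀ i j x t, Summable fun k => pd (d k) i j x t := fun i j x t =>
    Summable.of_norm_bounded (hg i j) fun k => hb i j k x t
  have hc : ∀ i j, Continuous (Function.uncurry (f i j)) := fun i j => by
    have h1 : Function.uncurry (f i j) = fun z => ∑' k, Function.uncurry (pd (d k) i j) z :=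
      funext fun z => hf i j z.1 z.2
    rw [h1]
    have h2 : ∀ k, Continuous (Function.uncurry (pd (d k) i j)) := fun k => Sm.continuous (hd k |>.pd i j)
    have h3 : ∀ k z, ‖Function.uncurry (pd (d k) i j) z‖ ≤ g i j k := fun k z => by
      obtain ⟨x, t⟩ := z
      rw [Function.uncurry_apply_pair]
      exact hb i j k x t
    exact continuous_tsum h2 (hg i j) h3
  have hx : ∀ i j x t, HasDerivAt (fun y => f i j y t) (f i (j + 1) x t) x := fun i j x t => by
    rw [hfx, hf]
    have h1 : ∀ k y, HasDerivAt (fun y => pd (d k) i j y t) (pd (d k) i (j + 1) y t) y :=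
      fun k y => by rw [← (hd k).dx_pd]; exact ((hd k).pd i j).hasDerivAt_x y t
    have h2 : ∀ k y, ‖pd (d k) i (j + 1) y t‖ ≤ g i (j + 1) k := fun k y => hb i (j + 1) k y t
    exact hasDerivAt_tsum (hg i (j + 1)) h1 h2 (hsum i j 0 t) x
  have ht : ∀ i j x t, HasDerivAt (fun s => f i j x s) (f (i + 1) j x t) t := fun i j x t => by
    rw [hft, hf]
    have h1 : ∀ k y, HasDerivAt (fun y => pd (d k) i j x y) (pd (d k) (i + 1) j x y) y :=
      fun k y => by rw [pd_succ_left]; exact ((hd k).pd i j).hasDerivAt_t x y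
    have h2 : ∀ k y, ‖pd (d k) (i + 1) j x y‖ ≤ g (i + 1) j k := fun k y => hb (i + 1) j k x y
    exact hasDerivAt_tsum (hg (i + 1) j) h1 h2 (hsum i j x 0) t
  rw [← h0]
  refine ⟨sm_of_family hc hx ht 0 0, fun i j => ?_⟩
  rw [pd_of_family hx ht i j]
  ext x t; exact hf i j x t

end tsum

/-! ### Cut-off powers -/

/-- Eventually constant functions that vanish on the negative half line. -/
def EC0 (ψ : ℝ → ℂ) : Prop := EC ψ ∧ ∀ y ≤ 0, ψ y = 0

theorem EC0.deriv {ψ : ℝ → ℂ} (h : EC0 ψ) : EC0 (deriv ψ) := by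
  refine ⟨h.1.deriv, ?_⟩
  have h1 : ∀ y < 0, _root_.deriv ψ y = 0 := fun y hy => by
    have : ψ =ᶠ[𝓝 y] fun _ => 0 := by
      filter_upwards [gt_mem_nhds hy] with s hs using h.2 s hs.le
    rw [this.deriv_eq]; simp
  intro y hy
  have h2 : Set.EqOn (_root_.deriv ψ) (fun _ => 0) (closure (Set.Iio 0)) :=
    Set.EqOn.closure (fun y hy => h1 y hy) h.1.deriv.1.continuous continuous_const
  rw [closure_Iio] at h2
  exact h2 hy

theorem EC0.lin {ψ φ : ℝ → ℂ} (c : ℂ) (h : EC0 ψ) (h' : EC0 φ) :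
    EC0 (fun y => c * ψ y + φ y) :=
  ⟨(h.1.smul c).add h'.1, fun y hy => by simp [h.2 y hy, h'.2 y hy]⟩

/-- The function `x^γ ψ(log x - ρ)` on the positive half line, extended by `0`. -/
def cutPow (γ : ℝ) (ψ : ℝ → ℂ) (ρ x : ℝ) : ℂ :=
  if x ≤ 0 then 0 else ((x ^ γ : ℝ) : ℂ) * ψ (Real.log x - ρ)

/-- The profiles of the derivatives of `cutPow`. -/
def prof (γ : ℝ) (ψ : ℝ → ℂ) : ℕ → ℝ → ℂ
  | 0 => ψ
  | j + 1 => fun y => ((γ - j : ℝ) : ℂ) * prof γ ψ j y + deriv (prof γ ψ j) y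

theorem EC0.prof {ψ : ℝ → ℂ} (h : EC0 ψ) (γ : ℝ) (j : ℕ) : EC0 (prof γ ψ j) := by
  induction j with
  | zero => exact h
  | succ j ih => exact ih.lin _ ih.deriv

theorem cutPow_eq_zero {γ ρ x : ℝ} {ψ : ℝ → ℂ} (h : EC0 ψ) (hx : x ≤ Real.exp ρ) :
    cutPow γ ψ ρ x = 0 := by
  unfold cutPow
  split_ifs with h0
  · rfl
  · rw [h.2, mul_zero]
    have := Real.log_le_log (not_le.1 h0) hx
    rw [Real.log_exp] at this
    linarith

theorem hasDerivAt_cutPow {ψ : ℝ → ℂ} (h : EC0 ψ) (γ ρ x : ℝ) :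
    HasDerivAt (cutPow γ ψ ρ)
      (cutPow (γ - 1) (fun y => (γ : ℂ) * ψ y + deriv ψ y) ρ x) x := by
  rcases le_or_gt x 0 with hx | hx
  · have h1 : cutPow γ ψ ρ =ᶠ[𝓝 x] fun _ => 0 := by
      filter_upwards [gt_mem_nhds (hx.trans_lt (Real.exp_pos ρ))] with y hy
      exact cutPow_eq_zero h hy.le
    rw [cutPow, if_pos hx]
    exact (hasDerivAt_const x (0 : ℂ)).congr_of_eventuallyEq h1
  · have h1 : cutPow γ ψ ρ =ᶠ[𝓝 x] fun y => ((y ^ γ : ℝ) : ℂ) * ψ (Real.log y - ρ) := by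
      filter_upwards [lt_mem_nhds hx] with y hy
      rw [cutPow, if_neg (not_le.2 hy)]
    refine HasDerivAt.congr_of_eventuallyEq ?_ h1
    have h2 : HasDerivAt (fun y : ℝ => ((y ^ γ : ℝ) : ℂ)) ((γ * x ^ (γ - 1) : ℝ) : ℂ) x :=
      (Real.hasDerivAt_rpow_const (Or.inl hx.ne')).ofReal_comp
    have h3 : HasDerivAt (fun y => Real.log y - ρ) x⁻¹ x :=
      (Real.hasDerivAt_log hx.ne').sub_const ρ
    have h4 : HasDerivAt ψ (deriv ψ (Real.log x - ρ)) (Real.log x - ρ) :=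
      (h.1.1.differentiable (by simp) _).hasDerivAt
    have h5 := h2.mul (h4.scomp x h3)
    convert! h5 using 1
    have e0 : ∀ (γ : ℝ) (ψ : ℝ → ℂ),
        cutPow γ ψ ρ x = ((x ^ γ : ℝ) : ℂ) * ψ (Real.log x - ρ) :=
      fun γ ψ => if_neg (not_le.2 hx)
    rw [e0]
    have e : x ^ γ = x ^ (γ - 1) * x := by
      rw [← Real.rpow_add_one hx.ne']; congr 1; ring
    have hx' : (x : ℂ) ≠ 0 := by exact_mod_cast hx.ne'
    rw [e]
    simp only [Function.comp, Complex.real_smul]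
    push_cast
    field_simp

theorem iteratedDeriv_cutPow {ψ : ℝ → ℂ} (h : EC0 ψ) (γ ρ : ℝ) (j : ℕ) :
    iteratedDeriv j (cutPow γ ψ ρ) = cutPow (γ - j) (prof γ ψ j) ρ := by
  induction j with
  | zero => simp [prof]
  | succ j ih =>
    rw [iteratedDeriv_succ, ih]
    ext x
    rw [(hasDerivAt_cutPow (h.prof γ j) (γ - j) ρ x).deriv]
    simp only [prof]
    congr 1
    push_cast; ring

theorem contDiff_cutPow {ψ : ℝ → ℂ} (h : EC0 ψ) (γ ρ : ℝ) : ContDiff ℝ ∞ (cutPow γ ψ ρ) := by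
  refine contDiff_of_differentiable_iteratedDeriv fun j _ => ?_
  rw [iteratedDeriv_cutPow h]
  exact fun x => (hasDerivAt_cutPow (h.prof γ j) (γ - j) ρ x).differentiableAt

/-- Derivatives of `cutPow`: the constant does not depend on the position of the cut-off. -/
theorem cutPow_bound {ψ : ℝ → ℂ} (h : EC0 ψ) (γ : ℝ) (j : ℕ) : ∃ B, 0 ≤ B ∧ ∀ ρ x, 0 < x →
    ‖iteratedDeriv j (cutPow γ ψ ρ) x‖ ≤ B * x ^ (γ - j) := by
  obtain ⟨B, hB⟩ := (h.prof γ j).1.bounded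
  refine ⟨B, (norm_nonneg _).trans (hB 0), fun ρ x hx => ?_⟩
  rw [iteratedDeriv_cutPow h, cutPow, if_neg (not_le.2 hx), norm_mul, mul_comm, Complex.norm_real,
    Real.norm_of_nonneg (Real.rpow_nonneg hx.le _)]
  exact mul_le_mul_of_nonneg_right (hB _) (Real.rpow_nonneg hx.le _)

theorem iteratedDeriv_cutPow_eq_zero {γ ρ x : ℝ} {ψ : ℝ → ℂ} (h : EC0 ψ) (j : ℕ)
    (hx : x ≤ Real.exp ρ) : iteratedDeriv j (cutPow γ ψ ρ) x = 0 := by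
  rw [iteratedDeriv_cutPow h]; exact cutPow_eq_zero (h.prof γ j) hx

theorem cutPow_symbol {ψ : ℝ → ℂ} (h : EC0 ψ) (γ ρ : ℝ) (j : ℕ) :
    ∃ C, ∀ x, ‖iteratedDeriv j (cutPow γ ψ ρ) x‖ ≤ C * jb x ^ (γ - j) := by
  obtain ⟨B, hB0, hB⟩ := cutPow_bound h γ j
  obtain ⟨D, hD⟩ := (isCompact_Icc (a := (0 : ℝ)) (b := 1)).exists_bound_of_continuousOn
    ((contDiff_cutPow h γ ρ).continuous_iteratedDeriv j (by exact_mod_cast le_top)).continuousOn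
  have hD0 : 0 ≤ D := (norm_nonneg _).trans (hD 0 (by simp))
  refine ⟨B + D, fun x => ?_⟩
  rcases le_or_gt x 0 with hx | hx
  · rw [iteratedDeriv_cutPow_eq_zero h j (hx.trans (Real.exp_pos ρ).le), norm_zero]
    exact mul_nonneg (by linarith) (jb_rpow_pos x _).le
  · rcases le_total x 1 with h1 | h1
    · rw [jb_of_abs_le (abs_le.2 ⟨by linarith, h1⟩), Real.one_rpow]
      linarith [hD x ⟨hx.le, h1⟩]
    · rw [jb_of_one_le h1]
      refine (hB ρ x hx).trans (mul_le_mul_of_nonneg_right (by linarith) ?_)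
      exact Real.rpow_nonneg hx.le _

/-- The standard profile. -/
def psi0 (y : ℝ) : ℂ := (Real.smoothTransition y : ℂ)

theorem ec0_psi0 : EC0 psi0 := by
  refine ⟨⟨?_, 1, fun t ht => ?_, fun t ht => ?_⟩, fun y hy => ?_⟩
  · exact Complex.ofRealCLM.contDiff.comp (Real.smoothTransition.contDiff (n := ⊤))
  · simp [psi0, Real.smoothTransition.one_of_one_le ht]
  · rw [psi0, psi0, Real.smoothTransition.zero_of_nonpos (by linarith),
      Real.smoothTransition.zero_of_nonpos (by linarith)]
  · rw [psi0, Real.smoothTransition.zero_of_nonpos hy]; simp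

theorem cutPow_psi0_eq {γ ρ x : ℝ} (hx : Real.exp (ρ + 1) ≤ x) :
    cutPow γ psi0 ρ x = ((x ^ γ : ℝ) : ℂ) := by
  have h0 : 0 < x := (Real.exp_pos _).trans_le hx
  have h1 := Real.log_le_log (Real.exp_pos _) hx
  rw [Real.log_exp] at h1
  rw [cutPow, if_neg (not_le.2 h0), psi0, Real.smoothTransition.one_of_one_le (by linarith)]
  simp

/-- Smooth functions with compact support are symbols of every order. -/
theorem symbol_of_compact {g : ℝ → ℂ} (hg : ContDiff ℝ ∞ g) {R : ℝ} (h0 : ∀ x, R ≤ |x| → g x = 0)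
    (γ : ℝ) (j : ℕ) : ∃ C, ∀ x, ‖iteratedDeriv j g x‖ ≤ C * jb x ^ (γ - j) := by
  have h1 : ∀ x, R < |x| → iteratedDeriv j g x = 0 := by
    intro x hx
    have : g =ᶠ[𝓝 x] fun _ => 0 := by
      filter_upwards [continuous_abs.continuousAt.eventually (lt_mem_nhds hx)] with y hy
        using h0 y (le_of_lt hy)
    rw [this.iteratedDeriv_eq]
    simp
  have hcont : Continuous fun x => ‖iteratedDeriv j g x‖ / jb x ^ (γ - j) :=
    (hg.continuous_iteratedDeriv j (by exact_mod_cast le_top)).norm.div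
      (continuous_jb.rpow_const fun x => Or.inl (jb_pos x).ne') fun x => (jb_rpow_pos x _).ne'
  obtain ⟨D, hD⟩ := (isCompact_Icc (a := -|R|) (b := |R|)).exists_bound_of_continuousOn
    hcont.continuousOn
  have hD0 : 0 ≤ D := (norm_nonneg _).trans (hD 0 (by simp))
  refine ⟨D, fun x => ?_⟩
  by_cases hx : R < |x|
  · rw [h1 x hx, norm_zero]; exact mul_nonneg hD0 (jb_rpow_pos x _).le
  · have := hD x (abs_le.1 ((not_lt.1 hx).trans (le_abs_self R)))
    rw [Real.norm_of_nonneg (div_nonneg (norm_nonneg _) (jb_rpow_pos x _).le),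
      div_le_iff₀ (jb_rpow_pos x _)] at this
    exact this

theorem cutPow_sub_symbol (γ ρ ρ' γ' : ℝ) (j : ℕ) :
    ∃ C, ∀ x, ‖iteratedDeriv j (fun x => cutPow γ psi0 ρ x - cutPow γ psi0 ρ' x) x‖
      ≤ C * jb x ^ (γ' - j) := by
  refine symbol_of_compact (R := max (Real.exp (ρ + 1)) (Real.exp (ρ' + 1)))
    ((contDiff_cutPow ec0_psi0 γ ρ).sub (contDiff_cutPow ec0_psi0 γ ρ')) (fun x hx => ?_) γ' j
  rcases le_abs.1 hx with hx | hx
  · rw [cutPow_psi0_eq ((le_max_left _ _).trans hx), cutPow_psi0_eq ((le_max_right _ _).trans hx),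
      sub_self]
  · have : 0 < max (Real.exp (ρ + 1)) (Real.exp (ρ' + 1)) :=
      (Real.exp_pos _).trans_le (le_max_left _ _)
    have hx' : x ≤ 0 := by linarith
    rw [cutPow, cutPow, if_pos hx', if_pos hx', sub_self]

/-- The power `x^γ`, smoothly cut off near `0`. -/
def hpow (γ : ℝ) : ℝ → ℂ := cutPow γ psi0 (-2)

theorem contDiff_hpow (γ : ℝ) : ContDiff ℝ ∞ (hpow γ) := contDiff_cutPow ec0_psi0 _ _

theorem hpow_eq {γ x : ℝ} (hx : Real.exp (-1) ≤ x) : hpow γ x = ((x ^ γ : ℝ) : ℂ) :=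
  cutPow_psi0_eq (by norm_num; exact hx)

theorem hpow_sym {C : ℝ → ℂ} (hC : EC C) (γ : ℝ) : Sym γ (fun x t => C t * hpow γ x) :=
  Sym.tensor hC.1 (contDiff_hpow γ) hC.bounded_iteratedDeriv (cutPow_symbol ec0_psi0 γ _)

/-! ### Borel summation -/

theorem borel {e : ℕ → ℝ} (he : StrictAnti e) (he0 : e 0 ≤ 0) {C : ℕ → ℝ → ℂ}
    (hC : ∀ k, EC (C k)) :
    ∃ W : ℝ → ℝ → ℂ, Sm W ∧ (∀ x ≤ 1, ∀ t, W x t = 0) ∧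
      ∀ N, Sym (e (N + 1))
        (W - ∑ k ∈ Finset.range (N + 1), fun x t => C k t * hpow (e k) x) := by
  have he0' : ∀ k, e k ≤ 0 := fun k => (he.antitone (Nat.zero_le k)).trans he0
  have hB := fun k j => cutPow_bound ec0_psi0 (e k) j
  choose B hB0 hB using hB
  have hA := fun k i => (hC k).bounded_iteratedDeriv i
  choose A hA using hA
  have hA0 : ∀ k i, 0 ≤ A k i := fun k i => (norm_nonneg _).trans (hA k i 0)
  -- choice of the cut-off positions
  have hρ : ∀ k : ℕ, ∃ ρ : ℝ, 0 ≤ ρ ∧ ∀ i ≤ k, ∀ j ≤ k, 1 ≤ k →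
      A k i * B k j * Real.exp (-(ρ * (e (k - 1) - e k))) ≤ (1 / 2) ^ k := by
    intro k
    rcases Nat.eq_zero_or_pos k with rfl | hk
    · exact ⟨0, le_rfl, fun i _ j _ h => absurd h (by norm_num)⟩
    have hδ : 0 < e (k - 1) - e k := sub_pos.2 (he (by omega))
    have ht : ∀ i j, Tendsto (fun ρ => A k i * B k j * Real.exp (-(ρ * (e (k - 1) - e k)))) atTop
        (𝓝 0) := fun i j => by
      have := (Real.tendsto_exp_neg_atTop_nhds_zero.comp
        (tendsto_id.atTop_mul_const hδ)).const_mul (A k i * B k j)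
      simpa using this
    have hev : ∀ᶠ ρ in atTop, ∀ i ∈ Finset.range (k + 1), ∀ j ∈ Finset.range (k + 1),
        A k i * B k j * Real.exp (-(ρ * (e (k - 1) - e k))) ≤ (1 / 2) ^ k := by
      rw [Finset.eventually_all]; intro i _
      rw [Finset.eventually_all]; intro j _
      exact ((ht i j).eventually (gt_mem_nhds (by positivity))).mono fun _ h => h.le
    obtain ⟨ρ, h1, h2⟩ := ((eventually_ge_atTop 0).and hev).exists
    exact ⟨ρ, h1, fun i hi j hj _ => h2 i (by simp; omega) j (by simp; omega)⟩
  choose ρ hρ0 hρ using hρ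
  let D : ℕ → ℝ → ℝ → ℂ := fun k x t => C k t * cutPow (e k) psi0 (ρ k) x
  have hDsym : ∀ k, Sym (e k) (D k) := fun k =>
    Sym.tensor (hC k).1 (contDiff_cutPow ec0_psi0 _ _) (hC k).bounded_iteratedDeriv
      (cutPow_symbol ec0_psi0 _ _)
  have hDpd : ∀ k i j x t, pd (D k) i j x t
      = iteratedDeriv i (C k) t * iteratedDeriv j (cutPow (e k) psi0 (ρ k)) x :=
    fun k i j x t => pd_tensor _ _ i j x t
  have hDb : ∀ k i j x t, i ≤ k → j ≤ k → 1 ≤ k →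
      ‖pd (D k) i j x t‖ ≤ (1 / 2) ^ k * jb x ^ (e (k - 1) - j) := by
    intro k i j x t hi hj hk
    rcases le_or_gt x (Real.exp (ρ k)) with hx | hx
    · rw [hDpd, iteratedDeriv_cutPow_eq_zero ec0_psi0 j hx, mul_zero, norm_zero]
      exact mul_nonneg (by positivity) (jb_rpow_pos x _).le
    · have hx1 : 1 ≤ x := (Real.one_le_exp (hρ0 k)).trans hx.le
      have hx0 : 0 < x := by linarith
      have hδ : 0 ≤ e (k - 1) - e k := (sub_pos.2 (he (by omega))).le
      have e1 : x ^ (e k - j) = x ^ (-(e (k - 1) - e k)) * x ^ (e (k - 1) - j) := by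
        rw [← Real.rpow_add hx0]; congr 1; ring
      have e2 : x ^ (-(e (k - 1) - e k)) ≤ Real.exp (-(ρ k * (e (k - 1) - e k))) := by
        rw [Real.rpow_neg hx0.le, Real.exp_neg, Real.exp_mul]
        exact inv_anti₀ (Real.rpow_pos_of_pos (Real.exp_pos _) _)
          (Real.rpow_le_rpow (Real.exp_pos _).le hx.le hδ)
      rw [hDpd, norm_mul, jb_of_one_le hx1]
      calc _ ≤ A k i * (B k j * x ^ (e k - j)) :=
            mul_le_mul (hA k i t) (hB k j _ x hx0) (norm_nonneg _) (hA0 k i)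
        _ = A k i * B k j * x ^ (-(e (k - 1) - e k)) * x ^ (e (k - 1) - j) := by
            rw [e1]; ring
        _ ≤ A k i * B k j * Real.exp (-(ρ k * (e (k - 1) - e k))) * x ^ (e (k - 1) - j) := by
            have := mul_nonneg (hA0 k i) (hB0 k j)
            gcongr
        _ ≤ _ := mul_le_mul_of_nonneg_right (hρ k i hi j hj hk) (Real.rpow_nonneg hx0.le _)
  have hgeo : Summable fun k : ℕ => (1 / 2 : ℝ) ^ k := summable_geometric_two
  have hbnd : ∀ M i j, i ≤ M → j ≤ M → 1 ≤ M → ∀ k x t,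
      ‖pd (D (k + M)) i j x t‖ ≤ (1 / 2) ^ k * jb x ^ (e (M - 1) - j) := by
    intro M i j hi hj hM k x t
    refine (hDb (k + M) i j x t (by omega) (by omega) (by omega)).trans ?_
    refine mul_le_mul (pow_le_pow_of_le_one (by norm_num) (by norm_num) (by omega))
      (Real.rpow_le_rpow_of_exponent_le (one_le_jb x) ?_) (jb_rpow_pos x _).le (by positivity)
    have := he.antitone (show M - 1 ≤ k + M - 1 by omega)
    linarith
  have hjb : ∀ x (γ : ℝ) (j : ℕ), γ ≤ 0 → jb x ^ (γ - j) ≤ 1 := fun x γ j hγ =>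
    Real.rpow_le_one_of_one_le_of_nonpos (one_le_jb x) (by
      have : (0 : ℝ) ≤ j := Nat.cast_nonneg j
      linarith)
  have hb : ∀ i j, ∃ g : ℕ → ℝ, Summable g ∧ ∀ k x t, ‖pd (D k) i j x t‖ ≤ g k := by
    intro i j
    have h1 := fun k => (hDsym k).2 i j
    choose K hK using h1
    have hK0 : ∀ k, 0 ≤ K k := fun k =>
      nonneg_of_mul_nonneg_left ((norm_nonneg _).trans (hK k 0 0)) (jb_rpow_pos 0 _)
    let M := max i (max j 1)
    have hM1 : i ≤ M := le_max_left _ _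
    have hM2 : j ≤ M := (le_max_left _ _).trans (le_max_right _ _)
    have hM3 : 1 ≤ M := (le_max_right _ _).trans (le_max_right _ _)
    refine ⟨fun k => if k < M then K k else (1 / 2) ^ (k - M), ?_, fun k x t => ?_⟩
    · rw [← summable_nat_add_iff M]
      convert! hgeo using 2 with k
      rw [if_neg (by omega), Nat.add_sub_cancel]
    · beta_reduce
      split_ifs with hk
      · refine (hK k x t).trans ?_
        exact mul_le_of_le_one_right (hK0 k) (hjb x _ j (he0' k))
      · have := hbnd M i j hM1 hM2 hM3 (k - M) x t
        rw [Nat.sub_add_cancel (not_lt.1 hk)] at this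
        exact this.trans (mul_le_of_le_one_right (by positivity) (hjb x _ j (he0' _)))
  have hDsm : ∀ k, Sm (D k) := fun k => (hDsym k).1
  obtain ⟨hW1, hW2⟩ := tsum_family hDsm hb
  refine ⟨fun x t => ∑' k, D k x t, hW1, fun x hx t => ?_, fun N => ⟨?_, fun i j => ?_⟩⟩
  · have : ∀ k, D k x t = 0 := fun k => by
      simp only [D]
      rw [cutPow_eq_zero ec0_psi0 (hx.trans (Real.one_le_exp (hρ0 k))), mul_zero]
    simp [this]
  · exact hW1.sub (Sm.sum fun k _ => (hpow_sym (hC k) (e k)).1)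
  · let M := max i (max j (N + 2))
    have hM1 : i ≤ M := le_max_left _ _
    have hM2 : j ≤ M := (le_max_left _ _).trans (le_max_right _ _)
    have hM3 : N + 2 ≤ M := (le_max_right _ _).trans (le_max_right _ _)
    have hS : Sm (∑ k ∈ Finset.range M, D k) := Sm.sum fun k _ => hDsm k
    have hrest : Sym (e (N + 1)) ((∑ k ∈ Finset.range M, D k)
        - ∑ k ∈ Finset.range (N + 1), fun x t => C k t * hpow (e k) x) := by
      have e1 : (∑ k ∈ Finset.range M, D k)
          - ∑ k ∈ Finset.range (N + 1), (fun x t => C k t * hpow (e k) x)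
          = (∑ k ∈ Finset.range (N + 1), fun x t =>
              C k t * (cutPow (e k) psi0 (ρ k) x - cutPow (e k) psi0 (-2) x))
            + ∑ k ∈ Finset.Ico (N + 1) M, D k := by
        rw [← Finset.sum_range_add_sum_Ico _ (show N + 1 ≤ M by omega), add_sub_right_comm,
          ← Finset.sum_sub_distrib]
        congr 1
        refine Finset.sum_congr rfl fun k _ => ?_
        ext x t
        simp only [D, hpow, Pi.sub_apply]; ring
      rw [e1]
      refine (Sym.sum fun k _ => ?_).add (Sym.sum fun k hk => ?_)
      · exact Sym.tensor (hC k).1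
          ((contDiff_cutPow ec0_psi0 _ _).sub (contDiff_cutPow ec0_psi0 _ _))
          (hC k).bounded_iteratedDeriv (cutPow_sub_symbol _ _ _ _)
      · exact (hDsym k).mono (he.antitone (Finset.mem_Ico.1 hk).1)
    obtain ⟨K, hK⟩ := hrest.2 i j
    refine ⟨(∑' k : ℕ, (1 / 2 : ℝ) ^ k) + K, fun x t => ?_⟩
    have e2 : (fun x t => ∑' k, D k x t)
        - (∑ k ∈ Finset.range (N + 1), fun x t => C k t * hpow (e k) x)
        = ((fun x t => ∑' k, D k x t) - ∑ k ∈ Finset.range M, D k)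
          + ((∑ k ∈ Finset.range M, D k)
            - ∑ k ∈ Finset.range (N + 1), fun x t => C k t * hpow (e k) x) := by abel
    rw [e2, pd_add (hW1.sub hS) hrest.1, add_mul]
    refine norm_add_le_of_le ?_ (hK x t)
    rw [pd_sub hW1 hS, hW2, pd_sum fun k _ => hDsm k]
    obtain ⟨g, hg1, hg2⟩ := hb i j
    have hsum : Summable fun k => pd (D k) i j x t :=
      Summable.of_norm_bounded hg1 fun k => hg2 k x t
    simp only [Pi.sub_apply, Finset.sum_apply]
    rw [← hsum.sum_add_tsum_nat_add M, add_sub_cancel_left]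
    rw [← tsum_mul_right]
    refine tsum_of_norm_bounded (hgeo.mul_right _).hasSum fun k => ?_
    refine (hbnd M i j hM1 hM2 (by omega) k x t).trans ?_
    refine mul_le_mul_of_nonneg_left (Real.rpow_le_rpow_of_exponent_le (one_le_jb x) ?_)
      (by positivity)
    have := he.antitone (show N + 1 ≤ M - 1 by omega)
    linarith

end NLS

namespace NLS

open Filter Topology
open scoped ContDiff

/-! ### The exponents of the solution -/

section exponents
variable {e : ℕ → ℝ}

/-- The additive monoid generated by the negated exponents and `2`. -/
def expMonoid (e : ℕ → ℝ) : AddSubmonoid ℝ :=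
  AddSubmonoid.closure (Set.range (fun k => -e k) ∪ {2})

/-- The set of exponents of the solution. -/
def expSet (e : ℕ → ℝ) : Set ℝ := {γ | ∃ k, ∃ c ∈ expMonoid e, γ = e k - c}

theorem expMonoid_nonneg (he : ∀ k, e k ≤ 0) {c : ℝ} (hc : c ∈ expMonoid e) : 0 ≤ c := by
  have : expMonoid e ≤ AddSubmonoid.nonneg ℝ := by
    refine AddSubmonoid.closure_le.2 ?_
    rintro x (⟨k, rfl⟩ | rfl)
    · simpa [AddSubmonoid.mem_nonneg] using he k
    · simp
  exact AddSubmonoid.mem_nonneg.1 (this hc)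

theorem finite_ge_of_tendsto (ht : Tendsto e atTop atBot) (M : ℝ) :
    {k | -M ≤ e k}.Finite := by
  obtain ⟨N, hN⟩ := eventually_atTop.1 (ht.eventually_lt_atBot (-M))
  refine (Set.finite_lt_nat N).subset fun k hk => ?_
  by_contra h
  exact absurd (hN k (not_lt.1 h)) (not_lt.2 hk)

theorem expMonoid_finite (he : ∀ k, e k ≤ 0) (ht : Tendsto e atTop atBot) (M : ℝ) :
    {c | c ∈ expMonoid e ∧ c ≤ M}.Finite := by
  let G : Set ℝ := {g | g ∈ Set.range (fun k => -e k) ∪ {2} ∧ 0 < g}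
  have hG : ∀ M, {g | g ∈ G ∧ g ≤ M}.Finite := fun M => by
    refine (((finite_ge_of_tendsto ht M).image fun k => -e k).union (Set.finite_singleton 2)).subset
      ?_
    rintro g ⟨⟨⟨k, rfl⟩ | h, -⟩, hM⟩
    · exact Or.inl ⟨k, by simpa using neg_le_neg hM, rfl⟩
    · exact Or.inr h
  obtain ⟨ε, hε, hεG⟩ : ∃ ε > 0, ∀ g ∈ G, ε ≤ g := by
    have h2 : (2 : ℝ) ∈ {g | g ∈ G ∧ g ≤ 2} := ⟨⟨Or.inr rfl, by norm_num⟩, le_rfl⟩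
    obtain ⟨ε, hε, hmin⟩ := Set.exists_min_image _ id (hG 2) ⟨2, h2⟩
    refine ⟨ε, hε.1.2, fun g hg => ?_⟩
    rcases le_total g 2 with h | h
    · exact hmin g ⟨hg, h⟩
    · exact (hmin 2 h2).trans h
  have hsplit : ∀ c ∈ expMonoid e, c = 0 ∨ ∃ g ∈ G, ∃ c' ∈ expMonoid e, c = g + c' := by
    intro c hc
    refine AddSubmonoid.closure_induction_left (motive := fun c _ => c = 0 ∨ ∃ g ∈ G,
      ∃ c' ∈ expMonoid e, c = g + c') (Or.inl rfl) (fun x hx y hy ih => ?_) hc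
    have hx0 : 0 ≤ x := expMonoid_nonneg he (AddSubmonoid.subset_closure hx)
    rcases hx0.eq_or_lt with h | h
    · rw [← h, zero_add]; exact ih
    · exact Or.inr ⟨x, ⟨hx, h⟩, y, hy, rfl⟩
  have hn : ∀ n : ℕ, {c | c ∈ expMonoid e ∧ c ≤ n * ε}.Finite := by
    intro n
    induction n with
    | zero =>
      refine (Set.finite_singleton 0).subset fun c hc => ?_
      have h1 := expMonoid_nonneg he hc.1
      have h2 := hc.2
      simp only [Nat.cast_zero, zero_mul] at h2
      exact le_antisymm h2 h1
    | succ n ih =>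
      refine ((Set.finite_singleton 0).union
        (Set.Finite.image2 (· + ·) (hG ((n + 1 : ℕ) * ε)) ih)).subset ?_
      rintro c ⟨hc, hcM⟩
      rcases hsplit c hc with h | ⟨g, hg, c', hc', rfl⟩
      · exact Or.inl h
      · have h1 := hεG g hg
        have h2 := expMonoid_nonneg he hc'
        refine Or.inr ⟨g, ⟨hg, by linarith⟩, c', ⟨hc', ?_⟩, rfl⟩
        push_cast at hcM
        linarith
  obtain ⟨n, hn'⟩ := exists_nat_ge (M / ε)
  refine (hn n).subset fun c hc => ⟨hc.1, hc.2.trans ?_⟩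
  rwa [div_le_iff₀ hε] at hn'

theorem expSet_finite (he : ∀ k, e k ≤ 0) (ht : Tendsto e atTop atBot) (M : ℝ) :
    {γ | γ ∈ expSet e ∧ -M ≤ γ}.Finite := by
  refine (Set.Finite.image2 (fun k c => e k - c) (finite_ge_of_tendsto ht M)
    (expMonoid_finite he ht M)).subset ?_
  rintro γ ⟨⟨k, c, hc, rfl⟩, hM⟩
  have h1 := expMonoid_nonneg he hc
  have h2 := he k
  exact ⟨k, by simp only [Set.mem_ofPred_eq]; linarith, c, ⟨hc, by linarith⟩, rfl⟩

theorem self_mem_expSet (k : ℕ) : e k ∈ expSet e := ⟨k, 0, zero_mem _, by simp⟩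

theorem sub_two_mem_expSet {γ : ℝ} (h : γ ∈ expSet e) : γ - 2 ∈ expSet e := by
  obtain ⟨k, c, hc, rfl⟩ := h
  exact ⟨k, c + 2, add_mem hc (AddSubmonoid.subset_closure (Or.inr rfl)), by ring⟩

theorem triple_mem_expSet {γ γ' γ'' : ℝ} (h : γ ∈ expSet e) (h' : γ' ∈ expSet e)
    (h'' : γ'' ∈ expSet e) : γ + γ' + γ'' ∈ expSet e := by
  obtain ⟨k, c, hc, rfl⟩ := h
  obtain ⟨k', c', hc', rfl⟩ := h'
  obtain ⟨k'', c'', hc'', rfl⟩ := h''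
  have hm : ∀ k, -e k ∈ expMonoid e := fun k => AddSubmonoid.subset_closure (Or.inl ⟨k, rfl⟩)
  exact ⟨k, c + (c' + (-e k') + (c'' + (-e k''))),
    add_mem hc (add_mem (add_mem hc' (hm k')) (add_mem hc'' (hm k''))), by ring⟩

theorem exists_enumeration {β : ℝ} (he : IsExp β e) (hβ : β ≤ 0) :
    ∃ e' : ℕ → ℝ, IsExp β e' ∧ ∃ s : ℕ → ℕ, ∃ t3 : ℕ → ℕ → ℕ → ℕ, ∃ σ : ℕ → ℕ,
      (∀ k, e' (s k) = e' k - 2) ∧ (∀ p q r, e' (t3 p q r) = e' p + e' q + e' r) ∧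
      ∀ j, e' (σ j) = e j := by
  obtain ⟨he0, hanti, ht⟩ := he
  have heβ : ∀ k, e k ≤ β := fun k => he0 ▸ hanti.antitone (Nat.zero_le k)
  have hle : ∀ k, e k ≤ 0 := fun k => (heβ k).trans hβ
  have hEβ : ∀ γ ∈ expSet e, γ ≤ β := by
    rintro γ ⟨k, c, hc, rfl⟩
    linarith [expMonoid_nonneg hle hc, heβ k]
  have hnext : ∀ x : expSet e, ∃ y : expSet e, y < x ∧ ∀ z : expSet e, z < x → z ≤ y := by
    rintro ⟨x, hx⟩
    have hfin : {γ | γ ∈ expSet e ∧ x - 2 ≤ γ ∧ γ < x}.Finite :=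
      (expSet_finite hle ht (-(x - 2))).subset fun γ hγ => ⟨hγ.1, by linarith [hγ.2.1]⟩
    have h2 : x - 2 ∈ {γ | γ ∈ expSet e ∧ x - 2 ≤ γ ∧ γ < x} :=
      ⟨sub_two_mem_expSet hx, le_rfl, by linarith⟩
    obtain ⟨y, hy, hmax⟩ := Set.exists_max_image _ id hfin ⟨_, h2⟩
    refine ⟨⟨y, hy.1⟩, hy.2.2, fun z hz => ?_⟩
    rcases le_total (x - 2) z.1 with h | h
    · exact hmax z.1 ⟨z.2, h, hz⟩
    · exact h.trans (hmax _ h2)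
  choose nx hnx1 hnx2 using hnext
  let E : ℕ → expSet e := fun n => Nat.rec ⟨e 0, self_mem_expSet 0⟩ (fun _ x => nx x) n
  have hE : StrictAnti E := strictAnti_nat_of_succ_lt fun n => hnx1 (E n)
  have hlow : ∀ M : ℝ, ∃ k, (E k).1 < M := by
    intro M
    by_contra! h
    have := Set.infinite_of_injective_forall_mem (f := fun k => (E k).1)
      (s := {γ | γ ∈ expSet e ∧ - -M ≤ γ})
      (Subtype.val_injective.comp hE.injective) fun k => ⟨(E k).2, by simpa using h k⟩
    exact this (expSet_finite hle ht (-M))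
  have hhit : ∀ γ ∈ expSet e, ∃ k, (E k).1 = γ := by
    intro γ hγ
    classical
    have hk := Nat.find_spec (hlow γ)
    obtain ⟨m, hm⟩ : ∃ m, Nat.find (hlow γ) = m + 1 := by
      refine Nat.exists_eq_succ_of_ne_zero fun h0 => ?_
      rw [h0] at hk
      have : (E 0).1 = β := he0
      linarith [hEβ γ hγ]
    have h1 : γ ≤ (E m).1 := not_lt.1 (Nat.find_min (hlow γ) (m := m) (by omega))
    refine ⟨m, le_antisymm (not_lt.1 fun h => ?_) h1⟩
    have h2 : (⟨γ, hγ⟩ : expSet e) ≤ E (m + 1) := hnx2 (E m) ⟨γ, hγ⟩ h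
    rw [hm] at hk
    exact absurd hk (not_lt.2 h2)
  refine ⟨fun k => (E k).1, ⟨he0, fun a b h => hE h, ?_⟩, ?_⟩
  · refine tendsto_atTop_atBot_of_antitone (fun a b h => hE.antitone h) fun M => ?_
    obtain ⟨k, hk⟩ := hlow M
    exact ⟨k, hk.le⟩
  · choose s hs using fun k => hhit _ (sub_two_mem_expSet (E k).2)
    choose t3 ht3 using fun p q r => hhit _ (triple_mem_expSet (E p).2 (E q).2 (E r).2)
    choose σ hσ using fun j => hhit _ (self_mem_expSet j)
    exact ⟨s, t3, σ, hs, ht3, hσ⟩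

end exponents

/-! ### The coefficients of the formal solution -/

theorem exists_antideriv {g : ℝ → ℂ} (hg : ContDiff ℝ ∞ g) :
    ∃ G : ℝ → ℂ, ContDiff ℝ ∞ G ∧ G 0 = 0 ∧ ∀ t, HasDerivAt G (g t) t := by
  have h : ∀ t, HasDerivAt (fun t => ∫ s in (0 : ℝ)..t, g s) (g t) t := fun t =>
    intervalIntegral.integral_hasDerivAt_right (hg.continuous.intervalIntegrable _ _)
      (hg.continuous.stronglyMeasurableAtFilter _ _) hg.continuous.continuousAt
  refine ⟨_, ?_, by simp, h⟩
  refine contDiff_infty_iff_deriv.2 ⟨fun t => (h t).differentiableAt, ?_⟩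
  rwa [show deriv (fun t => ∫ s in (0 : ℝ)..t, g s) = g from funext fun t => (h t).deriv]

theorem eq_of_hasDerivAt_eq {f g f' : ℝ → ℂ} (hf : ∀ t, HasDerivAt f (f' t) t)
    (hg : ∀ t, HasDerivAt g (f' t) t) (h0 : f 0 = g 0) (t : ℝ) : f t = g t := by
  have h : ∀ t, HasDerivAt (fun s => f s - g s) 0 t := fun t => by
    have h1 := (hf t).sub (hg t)
    rw [sub_self] at h1
    exact h1
  have := is_const_of_deriv_eq_zero (fun t => (h t).differentiableAt) (fun t => (h t).deriv) t 0
  rw [h0, sub_self] at this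
  exact sub_eq_zero.1 this

open Complex in
theorem exists_linear_ode (μ : ℝ) (Z0 c0 : ℂ) {f : ℝ → ℂ} (hf : ContDiff ℝ ∞ f) :
    ∃ c : ℝ → ℂ, ContDiff ℝ ∞ c ∧ c 0 = c0 ∧ ∀ t, HasDerivAt c
      (I * (f t + μ * (2 * (Z0 * star Z0) * c t
        + (Z0 * exp (I * (μ * (Z0 * star Z0)) * t)) ^ 2 * star (c t)))) t := by
  set w₁ : ℂ := μ * (Z0 * star Z0) with hw₁
  have hw₁s : star w₁ = w₁ := by simp [hw₁, mul_comm]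
  set E : ℝ → ℂ := fun t => exp (I * w₁ * t) with hE
  have hEd : ∀ t, HasDerivAt E (I * w₁ * E t) t := fun t => by
    have h1 : HasDerivAt (fun t : ℝ => I * w₁ * (t : ℂ)) (I * w₁) t := by
      simpa using (Complex.ofRealCLM.hasDerivAt (x := t)).const_mul (I * w₁)
    simpa [hE, mul_comm] using h1.cexp
  have hEs : ∀ t, star (E t) * E t = 1 := fun t => by
    have : star (E t) = exp (-(I * w₁ * t)) := by
      have h2 : (starRingEnd ℂ) w₁ = w₁ := hw₁s
      simp only [hE, Complex.star_def, ← Complex.exp_conj, map_mul, Complex.conj_I,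
        Complex.conj_ofReal, h2]
      congr 1; ring
    rw [this, hE, ← Complex.exp_add]; simp
  have hEc : ContDiff ℝ ∞ E := (contDiff_const.mul Complex.ofRealCLM.contDiff).cexp
  have hsc : ∀ {g : ℝ → ℂ}, ContDiff ℝ ∞ g → ContDiff ℝ ∞ fun t => star (g t) := fun hg =>
    (starL' ℝ (A := ℂ)).contDiff.comp hg
  have hF : ContDiff ℝ ∞ fun t => star (E t) * f t := (hsc hEc).mul hf
  obtain ⟨P, hP, hP0, hPd⟩ := exists_antideriv (contDiff_const.mul hF :
    ContDiff ℝ ∞ fun t => I * star Z0 * (star (E t) * f t))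
  set R : ℝ → ℂ := fun t => (star Z0 * c0 + P t) + star (star Z0 * c0 + P t) with hR
  have hRc : ContDiff ℝ ∞ R := (contDiff_const.add hP).add (hsc (contDiff_const.add hP))
  have hRs : ∀ t, star (R t) = R t := fun t => by simp [hR]; ring
  obtain ⟨Q, hQ, hQ0, hQd⟩ := exists_antideriv (((contDiff_const (c := I)).mul hF).add
    (contDiff_const.mul hRc) :
    ContDiff ℝ ∞ fun t => I * (star (E t) * f t) + I * μ * Z0 * R t)
  have hdd : ∀ t, HasDerivAt (fun t => c0 + Q t)
      (I * (star (E t) * f t) + I * μ * Z0 * R t) t := fun t => (hQd t).const_add c0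
  have key : ∀ t, star Z0 * (c0 + Q t) + star (star Z0 * (c0 + Q t)) = R t := by
    refine eq_of_hasDerivAt_eq (f' := fun t => I * star Z0 * (star (E t) * f t)
      + star (I * star Z0 * (star (E t) * f t))) (fun t => ?_) (fun t => ?_) ?_
    · have h1 := (hdd t).const_mul (star Z0)
      convert! h1.add h1.star using 1
      simp only [star_mul, star_add, hRs, Complex.star_def, Complex.conj_I, Complex.conj_ofReal,
        Complex.conj_conj]
      ring
    · have h1 := (hPd t).const_add (star Z0 * c0)
      exact h1.add h1.star
    · simp [hR, hP0, hQ0]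
  refine ⟨fun t => E t * (c0 + Q t), hEc.mul (contDiff_const.add hQ), by simp [hE, hQ0],
    fun t => ?_⟩
  convert! (hEd t).mul (hdd t) using 1
  rw [← key t]
  have h1 := hEs t
  rw [show exp (I * w₁ * t) = E t from rfl, hw₁]
  simp only [star_mul, star_add, star_star] at h1 ⊢
  linear_combination (I * Z0 ^ 2 * μ * E t * (star c0 + star (Q t)) - I * f t) * h1

end NLS

namespace NLS

open Filter Topology
open scoped ContDiff

/-- The index triples producing the exponent of index `k` in a cubic product. -/
def triples (t3 : ℕ → ℕ → ℕ → ℕ) (n k : ℕ) : Finset (ℕ × ℕ × ℕ) :=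
  (Finset.range n ×ˢ Finset.range n ×ˢ Finset.range n).filter
    fun p => t3 p.1 p.2.1 p.2.2 = k

theorem mem_triples {t3 : ℕ → ℕ → ℕ → ℕ} {n k : ℕ} {p : ℕ × ℕ × ℕ} :
    p ∈ triples t3 n k ↔ (p.1 < n ∧ p.2.1 < n ∧ p.2.2 < n) ∧ t3 p.1 p.2.1 p.2.2 = k := by
  simp [triples]

theorem sum_triples_succ {e : ℕ → ℝ} (he : StrictAnti e) (he0 : e 0 ≤ 0)
    {t3 : ℕ → ℕ → ℕ → ℕ} (ht : ∀ p q r, e (t3 p q r) = e p + e q + e r) {k : ℕ} (hk : 0 < k)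
    (g : ℕ × ℕ × ℕ → ℂ) :
    ∑ p ∈ triples t3 (k + 1) k, g p = ∑ p ∈ triples t3 k k, g p +
      if e 0 = 0 then g (k, 0, 0) + g (0, k, 0) + g (0, 0, k) else 0 := by
  have hneg : ∀ j, e j ≤ e 0 := fun j => he.antitone (Nat.zero_le j)
  have hsplit : triples t3 (k + 1) k = triples t3 k k ∪
      if e 0 = 0 then {(k, 0, 0), (0, k, 0), (0, 0, k)} else ∅ := by
    ext ⟨p, q, r⟩
    rw [Finset.mem_union, mem_triples, mem_triples]
    have hkk := he hk
    have hp : ∀ j, e j = 0 → e 0 = 0 ∧ j = 0 := fun j hj => by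
      have h0 : e 0 = 0 := le_antisymm he0 (hj ▸ hneg j)
      exact ⟨h0, he.injective (hj.trans h0.symm)⟩
    constructor
    · rintro ⟨⟨h1, h2, h3⟩, h⟩
      have hE := ht p q r
      simp only at h h1 h2 h3
      rw [h] at hE
      have a1 := hneg p
      have a2 := hneg q
      have a3 := hneg r
      by_cases hlt : p < k ∧ q < k ∧ r < k
      · exact Or.inl ⟨hlt, h⟩
      · right
        have h4 : p = k ∨ q = k ∨ r = k := by omega
        rcases h4 with h4 | h4 | h4
        · rw [h4] at hE
          obtain ⟨z, rfl⟩ := hp q (by linarith)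
          obtain ⟨-, rfl⟩ := hp r (by linarith)
          simp [z, h4]
        · rw [h4] at hE
          obtain ⟨z, rfl⟩ := hp p (by linarith)
          obtain ⟨-, rfl⟩ := hp r (by linarith)
          simp [z, h4]
        · rw [h4] at hE
          obtain ⟨z, rfl⟩ := hp p (by linarith)
          obtain ⟨-, rfl⟩ := hp q (by linarith)
          simp [z, h4]
    · rintro (⟨h, h'⟩ | h)
      · exact ⟨⟨by omega, by omega, by omega⟩, h'⟩
      · split_ifs at h with z
        · simp only [Finset.mem_insert, Finset.mem_singleton, Prod.mk.injEq] at h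
          rcases h with ⟨rfl, rfl, rfl⟩ | ⟨rfl, rfl, rfl⟩ | ⟨rfl, rfl, rfl⟩ <;>
          exact ⟨⟨by simp, by simp, by simp⟩, he.injective (by rw [ht]; simp [z])⟩
        · simp at h
  rw [hsplit, Finset.sum_union]
  · congr 1
    split_ifs
    · rw [Finset.sum_insert, Finset.sum_insert, Finset.sum_singleton, add_assoc] <;>
        simp [hk.ne', hk.ne]
    · simp
  · rw [Finset.disjoint_left]
    rintro ⟨p, q, r⟩ h h'
    rw [mem_triples] at h
    simp only at h
    split_ifs at h' with z
    · simp only [Finset.mem_insert, Finset.mem_singleton, Prod.mk.injEq] at h'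
      omega
    · simp at h'

/-- The right hand side of the equation for the coefficient of index `k`. -/
def coefRhs (e : ℕ → ℝ) (s : ℕ → ℕ) (t3 : ℕ → ℕ → ℕ → ℕ) (μ : ℝ) (n k : ℕ) (c : ℕ → ℂ) : ℂ :=
  ∑ p ∈ (Finset.range k).filter (fun p => s p = k), ((e p * (e p - 1) : ℝ) : ℂ) * c p
    + μ * ∑ p ∈ triples t3 n k, c p.1 * c p.2.1 * star (c p.2.2)

open Complex in
theorem exists_coefficients {e : ℕ → ℝ} (he : StrictAnti e) (he0 : e 0 ≤ 0) (s : ℕ → ℕ)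
    {t3 : ℕ → ℕ → ℕ → ℕ} (ht : ∀ p q r, e (t3 p q r) = e p + e q + e r)
    (μ : ℝ) (c₀ : ℕ → ℂ) :
    ∃ c : ℕ → ℝ → ℂ, (∀ k, ContDiff ℝ ∞ (c k)) ∧ (∀ k, c k 0 = c₀ k) ∧
      (∀ k t, HasDerivAt (c k) (I * coefRhs e s t3 μ (k + 1) k fun p => c p t) t) ∧
      ∀ j, (∀ m < j, c₀ m = 0) → c₀ j ≠ 0 →
        (∀ m < j, ∀ t, c m t = 0) ∧ ∀ t, c j t ≠ 0 := by
  set Z0 : ℂ := if e 0 = 0 then c₀ 0 else 0 with hZ0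
  set ω' : ℂ := μ * (Z0 * star Z0) with hω
  have hωs : (starRingEnd ℂ) ω' = ω' := by simp [hω, mul_comm]
  set E : ℝ → ℂ := fun t => exp (I * ω' * t) with hE
  have hEd : ∀ t, HasDerivAt E (I * ω' * E t) t := fun t => by
    have h1 : HasDerivAt (fun t : ℝ => I * ω' * (t : ℂ)) (I * ω') t := by
      simpa using (Complex.ofRealCLM.hasDerivAt (x := t)).const_mul (I * ω')
    simpa [hE, mul_comm] using h1.cexp
  have hEs : ∀ t, E t * star (E t) = 1 := fun t => by
    have : star (E t) = exp (-(I * ω' * t)) := by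
      simp only [hE, Complex.star_def, ← Complex.exp_conj, map_mul, Complex.conj_I,
        Complex.conj_ofReal, hωs]
      congr 1; ring
    rw [this, hE, ← Complex.exp_add]; simp
  have hEc : ContDiff ℝ ∞ E := (contDiff_const.mul Complex.ofRealCLM.contDiff).cexp
  let α := {a : ℝ → ℂ // ContDiff ℝ ∞ a}
  let Z : α := ⟨fun t => c₀ 0 * E t, contDiff_const.mul hEc⟩
  let S : ℕ → (ℕ → α) → ℝ → ℂ := fun k f t => coefRhs e s t3 μ k k fun p => (f p).1 t
  have hS : ∀ k f, ContDiff ℝ ∞ (S k f) := fun k f => by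
    refine ContDiff.add ?_ (contDiff_const.mul ?_)
    · exact ContDiff.sum fun p _ => contDiff_const.mul (f p).2
    · refine ContDiff.sum fun p _ => ((f _).2.mul (f _).2).mul ?_
      exact (starL' ℝ (A := ℂ)).contDiff.comp (f p.2.2).2
  let Q : ℕ → (ℕ → α) → α → Prop := fun n f a => (n = 0 → a = Z) ∧ (0 < n → a.1 0 = c₀ n ∧
    ∀ t, HasDerivAt a.1 (I * (S n f t + μ * (2 * (Z0 * star Z0) * a.1 t
        + (Z0 * exp (I * (μ * (Z0 * star Z0)) * t)) ^ 2 * star (a.1 t)))) t)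
  have : Inhabited α := ⟨Z⟩
  obtain ⟨c, hc⟩ := exists_seq_of_local Q (fun n f => by
    rcases Nat.eq_zero_or_pos n with rfl | hn
    · exact ⟨Z, fun _ => rfl, fun h => absurd h (lt_irrefl _)⟩
    · obtain ⟨a, ha, ha0, had⟩ := exists_linear_ode μ Z0 (c₀ n) (hS n f)
      exact ⟨⟨a, ha⟩, fun h => absurd h hn.ne', fun _ => ⟨ha0, had⟩⟩)
    (fun n f g a hfg ⟨h1, h2⟩ => ⟨h1, fun hn => ⟨(h2 hn).1, fun t => by
      have h3 : S n f t = S n g t := by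
        simp only [S, coefRhs]
        congr 1
        · refine Finset.sum_congr rfl fun p hp => ?_
          rw [hfg p (Finset.mem_range.1 (Finset.mem_filter.1 hp).1)]
        · congr 1
          refine Finset.sum_congr rfl fun p hp => ?_
          obtain ⟨⟨h1, h2, h3⟩, -⟩ := mem_triples.1 hp
          rw [hfg _ h1, hfg _ h2, hfg _ h3]
      rw [← h3]
      exact (h2 hn).2 t⟩⟩)
  have hc0 : ∀ t, (c 0).1 t = c₀ 0 * E t := fun t => by rw [(hc 0).1 rfl]
  have hcZ : ∀ {j}, 0 < j → (∀ m < j, c₀ m = 0) → Z0 = 0 := fun {j} hj h => by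
    simp [hZ0, h 0 hj]
  have hS0 : ∀ k t, (∀ m < k, (c m).1 t = 0) → S k c t = 0 := fun k t h => by
    simp only [S, coefRhs]
    rw [Finset.sum_eq_zero, Finset.sum_eq_zero]
    · simp
    · intro p hp
      obtain ⟨⟨h1, -, -⟩, -⟩ := mem_triples.1 hp
      rw [h _ h1]; simp
    · intro p hp
      rw [h p (Finset.mem_range.1 (Finset.mem_filter.1 hp).1)]; simp
  have hconst : ∀ k, 0 < k → Z0 = 0 → (∀ m < k, ∀ t, (c m).1 t = 0) →
      ∀ t, (c k).1 t = c₀ k := fun k hk hz hm t => by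
    have h1 : ∀ t, HasDerivAt (c k).1 0 t := fun t => by
      have := ((hc k).2 hk).2 t
      rw [hS0 k t fun m h => hm m h t, hz] at this
      simpa using this
    rw [← ((hc k).2 hk).1]
    exact is_const_of_deriv_eq_zero (fun t => (h1 t).differentiableAt) (fun t => (h1 t).deriv) t 0
  refine ⟨fun k => (c k).1, fun k => (c k).2, fun k => ?_, fun k t => ?_, fun j hj hne => ?_⟩
  · rcases Nat.eq_zero_or_pos k with rfl | hk
    · simp [hc0, hE]
    · exact ((hc k).2 hk).1
  · rcases Nat.eq_zero_or_pos k with rfl | hk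
    · have h1 := (hEd t).const_mul (c₀ 0)
      beta_reduce
      rw [show (c 0).1 = fun t => c₀ 0 * E t from funext hc0]
      refine HasDerivAt.congr_deriv h1 ?_
      simp only [coefRhs]
      have h000 : t3 0 0 0 = 0 ↔ e 0 = 0 :=
        ⟨fun h => by have := ht 0 0 0; rw [h] at this; linarith,
          fun h => he.injective (by rw [ht]; simp [h])⟩
      have hT : triples t3 (0 + 1) 0 = if e 0 = 0 then {(0, 0, 0)} else ∅ := by
        ext ⟨p, q, r⟩
        rw [mem_triples]
        split_ifs with z
        · simp only [zero_add, Nat.lt_one_iff, Finset.mem_singleton, Prod.mk.injEq]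
          constructor
          · exact fun h => h.1
          · rintro ⟨rfl, rfl, rfl⟩
            exact ⟨⟨rfl, rfl, rfl⟩, h000.2 z⟩
        · simp only [zero_add, Nat.lt_one_iff, Finset.notMem_empty, iff_false]
          rintro ⟨⟨rfl, rfl, rfl⟩, h⟩
          exact z (h000.1 h)
      rw [hT]
      by_cases z : e 0 = 0
      · have h2 := hEs t
        simp only [z, if_true, Finset.sum_singleton, Finset.range_zero, Finset.filter_empty,
          Finset.sum_empty, zero_add, hω, hZ0, hc0, star_mul] at h2 ⊢
        linear_combination (-I * μ * c₀ 0 ^ 2 * star (c₀ 0) * E t) * h2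
      · simp [z, hω, hZ0]
    · have h1 := ((hc k).2 hk).2 t
      refine h1.congr_deriv ?_
      have h2 := sum_triples_succ he he0 ht hk
        fun p => (c p.1).1 t * (c p.2.1).1 t * star ((c p.2.2).1 t)
      simp only [S, coefRhs]
      rw [h2]
      by_cases z : e 0 = 0
      · have h3 := hEs t
        rw [← hω, show exp (I * ω' * t) = E t from rfl]
        simp only [z, if_true, hc0, hZ0, star_mul]
        linear_combination (-2 * I * μ * c₀ 0 * star (c₀ 0) * (c k).1 t) * h3
      · simp [z, hZ0]
  · have hm : ∀ m < j, ∀ t, (c m).1 t = 0 := by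
      intro m
      induction m using Nat.strong_induction_on with
      | _ m ih =>
        intro hmj t
        rcases Nat.eq_zero_or_pos m with rfl | hm
        · rw [hc0, hj 0 hmj, zero_mul]
        · rw [hconst m hm (hcZ (hm.trans hmj) hj) (fun m' h => ih m' h (h.trans hmj)), hj m hmj]
    refine ⟨hm, fun t => ?_⟩
    rcases Nat.eq_zero_or_pos j with rfl | h
    · change (c 0).1 t ≠ 0
      rw [hc0]
      exact mul_ne_zero hne (exp_ne_zero _)
    · change (c j).1 t ≠ 0
      rw [hconst j h (hcZ h hj) hm]
      exact hne

end NLS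

namespace NLS

open Filter Topology
open scoped ContDiff

/-! ### The time cut-off -/

/-- `φ` is a smooth clock with speed `θ`, running at unit speed on `[-τ/2, τ/2]` and stopped
outside `[-τ, τ]`. -/
structure IsClock (τ : ℝ) (θ φ : ℝ → ℝ) : Prop where
  pos : 0 < τ
  smooth : ContDiff ℝ ∞ θ
  smooth' : ContDiff ℝ ∞ φ
  nonneg : ∀ t, 0 ≤ θ t
  le_one : ∀ t, θ t ≤ 1
  eq_one : ∀ t, |t| ≤ τ / 2 → θ t = 1
  eq_zero : ∀ t, τ ≤ |t| → θ t = 0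
  zero : φ 0 = 0
  deriv : ∀ t, HasDerivAt φ (θ t) t
  abs_le : ∀ t, |φ t| ≤ τ

theorem exists_clock {τ : ℝ} (hτ : 0 < τ) : ∃ θ φ : ℝ → ℝ, IsClock τ θ φ := by
  let f : ContDiffBump (0 : ℝ) := ⟨τ / 2, τ, by positivity, by linarith⟩
  have hd : ∀ t, HasDerivAt (fun t => ∫ s in (0 : ℝ)..t, f s) (f t) t := fun t =>
    intervalIntegral.integral_hasDerivAt_right (f.continuous.intervalIntegrable _ _)
      (f.continuous.stronglyMeasurableAtFilter _ _) f.continuous.continuousAt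
  have h0 : ∀ t, τ ≤ |t| → f t = 0 := fun t ht =>
    f.zero_of_le_dist (by simpa [Real.dist_eq] using ht)
  have hanti : Monotone (fun t => ∫ s in (0 : ℝ)..t, f s) :=
    monotone_of_deriv_nonneg (fun t => (hd t).differentiableAt)
      fun t => by rw [(hd t).deriv]; exact f.nonneg
  have hsmall : ∀ t, |t| ≤ τ → |∫ s in (0 : ℝ)..t, f s| ≤ τ := fun t ht => by
    have := intervalIntegral.norm_integral_le_of_norm_le_const (a := 0) (b := t) (C := 1)
      (f := fun s => f s) fun x _ => by
        rw [Real.norm_eq_abs, abs_of_nonneg f.nonneg]; exact f.le_one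
    simpa using this.trans (by simpa using ht)
  have h_const : ∀ a b, (∀ s ∈ Set.uIcc a b, τ ≤ |s|) →
      ∫ s in (0 : ℝ)..b, f s = ∫ s in (0 : ℝ)..a, f s := fun a b h => by
    rw [← intervalIntegral.integral_add_adjacent_intervals (b := a)
      (f.continuous.intervalIntegrable _ _) (f.continuous.intervalIntegrable _ _)]
    rw [intervalIntegral.integral_congr (a := a) (b := b) (g := fun _ => 0) fun s hs => h0 s (h s hs)]
    simp
  refine ⟨f, fun t => ∫ s in (0 : ℝ)..t, f s, ⟨hτ, f.contDiff, ?_, fun t => f.nonneg,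
    fun t => f.le_one, fun t ht => f.one_of_mem_closedBall (by simpa using ht), h0, by simp, hd, ?_⟩⟩
  · refine contDiff_infty_iff_deriv.2 ⟨fun t => (hd t).differentiableAt, ?_⟩
    rw [show _root_.deriv (fun t => ∫ s in (0 : ℝ)..t, f s) = f from funext fun t => (hd t).deriv]
    exact f.contDiff
  · intro t
    rcases le_total |t| τ with h | h
    · exact hsmall t h
    · rcases le_abs.1 h with h | h
      · rw [h_const τ t]
        · exact hsmall τ (by rw [abs_of_pos hτ])
        · intro s hs
          rw [Set.uIcc_of_le h] at hs
          exact hs.1.trans (le_abs_self s)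
      · rw [h_const (-τ) t]
        · exact hsmall (-τ) (by rw [abs_neg, abs_of_pos hτ])
        · intro s hs
          rw [Set.uIcc_of_ge (by linarith)] at hs
          exact le_trans (by linarith [hs.2]) (neg_le_abs s)

section clock
variable {τ : ℝ} {θ φ : ℝ → ℝ}

theorem IsClock.ec (hθ : IsClock τ θ φ) : EC (fun t => (θ t : ℂ)) := by
  have h := hθ.pos
  refine ⟨Complex.ofRealCLM.contDiff.comp hθ.smooth, τ, fun t ht => ?_, fun t ht => ?_⟩ <;> beta_reduce
  · rw [hθ.eq_zero t (ht.trans (le_abs_self t)), hθ.eq_zero τ (le_abs_self τ)]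
  · rw [hθ.eq_zero t (by linarith [neg_le_abs t]), hθ.eq_zero (-τ) (by simp [le_abs_self])]

theorem IsClock.sym (hθ : IsClock τ θ φ) : Sym 0 (fun _ t => (θ t : ℂ)) := hθ.ec.sym

theorem IsClock.eventually_const (hθ : IsClock τ θ φ) :
    (∀ t, τ ≤ t → φ t = φ τ) ∧ ∀ t, t ≤ -τ → φ t = φ (-τ) := by
  have h := hθ.pos
  have hc : ∀ s : Set ℝ, Convex ℝ s → (∀ t ∈ s, τ ≤ |t|) → ∀ a ∈ s, ∀ b ∈ s, φ a = φ b := by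
    intro s hs h0 a ha b hb
    have := hs.norm_image_sub_le_of_norm_hasDerivWithin_le (f := φ) (f' := θ) (C := 0)
      (fun t _ => (hθ.deriv t).hasDerivWithinAt)
      (fun t ht => by simp [hθ.eq_zero t (h0 t ht)]) ha hb
    simpa [sub_eq_zero, eq_comm] using this
  exact ⟨fun t ht => hc (Set.Ici τ) (convex_Ici _) (fun t ht => ht.trans (le_abs_self t)) _ ht _
    (Set.self_mem_Ici), fun t ht => hc (Set.Iic (-τ)) (convex_Iic _)
    (fun t ht => by have := Set.mem_Iic.1 ht; linarith [neg_le_abs t]) _ ht _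
    (Set.self_mem_Iic)⟩

theorem IsClock.comp_ec (hθ : IsClock τ θ φ) {c : ℝ → ℂ} (hc : ContDiff ℝ ∞ c) : EC (fun t => c (φ t)) :=
  ⟨hc.comp hθ.smooth', τ, fun t ht => by beta_reduce; rw [hθ.eventually_const.1 t ht],
    fun t ht => by beta_reduce; rw [hθ.eventually_const.2 t ht]⟩

end clock

end NLS

namespace NLS

open Filter Topology
open scoped ContDiff

/-! ### Approximate solutions -/

/-- The residual of `u` in the nonlinear Schrödinger equation run with clock speed `θ`. -/
def residual (θ : ℝ → ℝ) (μ : ℝ) (u : ℝ → ℝ → ℂ) : ℝ → ℝ → ℂ :=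
  Complex.I • Dt u + (fun _ t => (θ t : ℂ)) * (Dx (Dx u) + (μ : ℂ) • (u * u * star u))

theorem sym_residual_sub {τ : ℝ} {θ φ : ℝ → ℝ} (hθ : IsClock τ θ φ) (μ : ℝ) {γ : ℝ}
    {u v : ℝ → ℝ → ℂ} (hu : Sym 0 u) (hv : Sym 0 v) (h : Sym γ (u - v)) :
    Sym γ (residual θ μ u - residual θ μ v) := by
  have he : residual θ μ u - residual θ μ v = Complex.I • Dt (u - v)
      + (fun _ t => (θ t : ℂ)) * (Dx (Dx (u - v))
        + (μ : ℂ) • ((u + v) * star u * (u - v) + v * v * star (u - v))) := by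
    rw [dt_sub hu.1 hv.1, dx_sub hu.1 hv.1, dx_sub hu.1.dx hv.1.dx]
    funext x t
    simp only [residual, Pi.sub_apply, Pi.add_apply, Pi.mul_apply, Pi.smul_apply, Pi.star_apply,
      smul_eq_mul, star_sub]
    ring
  rw [he]
  have h1 : Sym γ ((u + v) * star u * (u - v)) := by
    simpa using ((hu.add hv).mul hu.star).mul h
  have h2 : Sym γ (v * v * star (u - v)) := by simpa using (hv.mul hv).mul h.star
  have h3 : Sym γ (Dx (Dx (u - v))) := h.dx.dx.mono (by linarith)
  exact (h.dt.smul _).add (by simpa using hθ.sym.mul (h3.add ((h1.add h2).smul (μ : ℂ))))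

theorem pd_zero (i j : ℕ) (x t : ℝ) : pd 0 i j x t = 0 := by
  have h := pd_tensor 0 0 i j x t
  have h0 : (fun x t => (0 : ℝ → ℂ) t * (0 : ℝ → ℂ) x : ℝ → ℝ → ℂ) = 0 := by
    ext; simp
  rw [h0] at h
  rw [h]
  simp

theorem hpow_mul {x : ℝ} (hx : Real.exp (-1) ≤ x) (γ γ' : ℝ) :
    hpow γ x * hpow γ' x = hpow (γ + γ') x := by
  rw [hpow_eq hx, hpow_eq hx, hpow_eq hx, ← Complex.ofReal_mul,
    Real.rpow_add ((Real.exp_pos _).trans_le hx)]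

theorem star_hpow {x : ℝ} (hx : Real.exp (-1) ≤ x) (γ : ℝ) : star (hpow γ x) = hpow γ x := by
  rw [hpow_eq hx, Complex.star_def, Complex.conj_ofReal]

theorem hasDerivAt_hpow {x : ℝ} (hx : Real.exp (-1) < x) (γ : ℝ) :
    HasDerivAt (hpow γ) (γ * hpow (γ - 1) x) x := by
  have h1 := (Real.hasDerivAt_rpow_const (p := γ)
    (Or.inl ((Real.exp_pos _).trans hx).ne')).ofReal_comp
  rw [hpow_eq hx.le, ← Complex.ofReal_mul]
  exact h1.congr_of_eventuallyEq
    ((eventually_gt_nhds hx).mono fun y hy => hpow_eq hy.le)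

theorem coefRhs_eq {e : ℕ → ℝ} (he : StrictAnti e) (he0 : e 0 ≤ 0) {s : ℕ → ℕ}
    (hs : ∀ k, e (s k) = e k - 2) {t3 : ℕ → ℕ → ℕ → ℕ}
    (ht : ∀ p q r, e (t3 p q r) = e p + e q + e r) (μ : ℝ) (c : ℕ → ℂ) {k N : ℕ} (hk : k ≤ N) :
    coefRhs e s t3 μ (k + 1) k c =
      ∑ p ∈ (Finset.range (N + 1)).filter (fun p => s p = k), ((e p * (e p - 1) : ℝ) : ℂ) * c p
        + μ * ∑ p ∈ triples t3 (N + 1) k, c p.1 * c p.2.1 * star (c p.2.2) := by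
  have hneg : ∀ j, e j ≤ 0 := fun j => (he.antitone (Nat.zero_le j)).trans he0
  have h1 : (Finset.range k).filter (fun p => s p = k)
      = (Finset.range (N + 1)).filter (fun p => s p = k) := by
    ext p
    simp only [Finset.mem_filter, Finset.mem_range]
    refine ⟨fun h => ⟨by omega, h.2⟩, fun h => ⟨?_, h.2⟩⟩
    have := hs p
    rw [h.2] at this
    exact he.lt_iff_gt.1 (by linarith)
  have h2 : triples t3 (k + 1) k = triples t3 (N + 1) k := by
    ext ⟨p, q, r⟩
    rw [mem_triples, mem_triples]
    refine ⟨fun h => ⟨⟨by omega, by omega, by omega⟩, h.2⟩, fun h => ⟨?_, h.2⟩⟩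
    have := ht p q r
    rw [h.2] at this
    simp only [Nat.lt_succ_iff, ← he.le_iff_ge]
    refine ⟨?_, ?_, ?_⟩ <;> linarith [hneg p, hneg q, hneg r]
  rw [coefRhs, h1, h2]

theorem exists_approx_half {e : ℕ → ℝ} (he : StrictAnti e) (he0 : e 0 ≤ 0)
    (hb : Tendsto e atTop atBot) {s : ℕ → ℕ} (hs : ∀ k, e (s k) = e k - 2)
    {t3 : ℕ → ℕ → ℕ → ℕ} (ht : ∀ p q r, e (t3 p q r) = e p + e q + e r) (μ : ℝ)
    {τ : ℝ} {θ φ : ℝ → ℝ} (hθ : IsClock τ θ φ) {c : ℕ → ℝ → ℂ} (hc : ∀ k, ContDiff ℝ ∞ (c k))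
    (hd : ∀ k t, HasDerivAt (c k) (Complex.I * coefRhs e s t3 μ (k + 1) k fun p => c p t) t) :
    ∃ W : ℝ → ℝ → ℂ, Sym (e 0) W ∧ (∀ x ≤ 1, ∀ t, W x t = 0) ∧
      (∀ N, Sym (e (N + 1))
        (W - ∑ k ∈ Finset.range (N + 1), fun x t => c k (φ t) * hpow (e k) x)) ∧
      Rapid (residual θ μ W) := by
  obtain ⟨W, hW, hW0, hWs⟩ := borel he he0 fun k => hθ.comp_ec (hc k)
  have hneg : ∀ j, e j ≤ 0 := fun j => (he.antitone (Nat.zero_le j)).trans he0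
  have hPs : ∀ N, Sym (e 0) (∑ k ∈ Finset.range (N + 1), fun x t => c k (φ t) * hpow (e k) x) :=
    fun N => Sym.sum fun k _ => (hpow_sym (hθ.comp_ec (hc k)) (e k)).mono
      (he.antitone (Nat.zero_le k))
  have hWe : Sym (e 0) W := by
    have := ((hWs 0).mono (he.antitone (Nat.zero_le _))).add (hPs 0)
    rwa [sub_add_cancel] at this
  refine ⟨W, hWe, hW0, hWs, ?_⟩
  -- the tail of the formal expansion
  let T : ℕ → ℝ → ℝ → ℂ := fun N => (fun _ t => (θ t : ℂ)) *
    (∑ p ∈ (Finset.range (N + 1)).filter (fun p => ¬ s p ≤ N),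
        ((e p * (e p - 1) : ℝ) : ℂ) • (fun x t => c p (φ t) * hpow (e (s p)) x)
      + (μ : ℂ) • ∑ p ∈ (Finset.range (N + 1) ×ˢ Finset.range (N + 1) ×ˢ
          Finset.range (N + 1)).filter (fun p => ¬ t3 p.1 p.2.1 p.2.2 ≤ N),
        (fun x t => (c p.1 (φ t) * c p.2.1 (φ t) * star (c p.2.2 (φ t)))
          * hpow (e (t3 p.1 p.2.1 p.2.2)) x))
  have hT : ∀ N, Sym (e (N + 1)) (T N) := fun N => by
    have h1 : ∀ p ∈ (Finset.range (N + 1)).filter (fun p => ¬ s p ≤ N), Sym (e (N + 1))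
        (((e p * (e p - 1) : ℝ) : ℂ) • (fun x t => c p (φ t) * hpow (e (s p)) x)) := fun p hp =>
      ((hpow_sym (hθ.comp_ec (hc p)) _).smul _).mono
        (he.antitone (by have := (Finset.mem_filter.1 hp).2; omega))
    have h2 : ∀ p ∈ (Finset.range (N + 1) ×ˢ Finset.range (N + 1) ×ˢ
        Finset.range (N + 1)).filter (fun p => ¬ t3 p.1 p.2.1 p.2.2 ≤ N), Sym (e (N + 1))
        (fun x t => (c p.1 (φ t) * c p.2.1 (φ t) * star (c p.2.2 (φ t)))
          * hpow (e (t3 p.1 p.2.1 p.2.2)) x) := fun p hp => by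
      have h3 : ContDiff ℝ ∞ fun t => c p.1 t * c p.2.1 t * star (c p.2.2 t) :=
        ((hc _).mul (hc _)).mul ((starL' ℝ (A := ℂ)).contDiff.comp (hc p.2.2))
      exact (hpow_sym (hθ.comp_ec h3) _).mono
        (he.antitone (by have := (Finset.mem_filter.1 hp).2; omega))
    have h3 := hθ.sym.mul ((Sym.sum h1).add ((Sym.sum h2).smul (μ : ℂ)))
    rwa [zero_add] at h3
  have hPT : ∀ N x, Real.exp (-1) < x → ∀ t,
      residual θ μ (∑ k ∈ Finset.range (N + 1), fun x t => c k (φ t) * hpow (e k) x) x t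
        = T N x t := by
    intro N x hx t
    set P : ℝ → ℝ → ℂ := ∑ k ∈ Finset.range (N + 1), fun x t => c k (φ t) * hpow (e k) x with hP
    have hPe : ∀ x t, P x t = ∑ k ∈ Finset.range (N + 1), c k (φ t) * hpow (e k) x := fun x t => by
      simp only [hP, Finset.sum_apply]
    have hPe' : ∀ x, P x = fun t => ∑ k ∈ Finset.range (N + 1), c k (φ t) * hpow (e k) x :=
      fun x => funext (hPe x)
    have hDt : Dt P x t = ∑ k ∈ Finset.range (N + 1), Complex.I * θ t *
        (coefRhs e s t3 μ (k + 1) k fun p => c p (φ t)) * hpow (e k) x := by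
      have h1 : HasDerivAt (fun t => ∑ k ∈ Finset.range (N + 1), c k (φ t) * hpow (e k) x)
          (∑ k ∈ Finset.range (N + 1), Complex.I * θ t *
            (coefRhs e s t3 μ (k + 1) k fun p => c p (φ t)) * hpow (e k) x) t := by
        refine HasDerivAt.fun_sum fun k _ => HasDerivAt.mul_const ?_ _
        have h2 := HasDerivAt.scomp t (hd k (φ t)) (hθ.deriv t)
        refine HasDerivAt.congr_deriv h2 ?_
        rw [Complex.real_smul]; ring
      rw [Dt, hPe']
      exact h1.deriv
    have hDx : ∀ x, Real.exp (-1) < x → ∀ t, Dx P x t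
        = ∑ k ∈ Finset.range (N + 1), c k (φ t) * (e k * hpow (e k - 1) x) := fun x hx t => by
      have h1 : HasDerivAt (fun x => ∑ k ∈ Finset.range (N + 1), c k (φ t) * hpow (e k) x)
          (∑ k ∈ Finset.range (N + 1), c k (φ t) * (e k * hpow (e k - 1) x)) x :=
        HasDerivAt.fun_sum fun k _ => (hasDerivAt_hpow hx _).const_mul _
      simp only [Dx, hPe]
      exact h1.deriv
    have hDxx : Dx (Dx P) x t = ∑ k ∈ Finset.range (N + 1),
        ((e k * (e k - 1) : ℝ) : ℂ) * (c k (φ t) * hpow (e (s k)) x) := by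
      have h1 : HasDerivAt (fun x => ∑ k ∈ Finset.range (N + 1),
          c k (φ t) * (e k * hpow (e k - 1) x))
          (∑ k ∈ Finset.range (N + 1),
            c k (φ t) * (e k * (((e k - 1 : ℝ) : ℂ) * hpow (e k - 1 - 1) x))) x :=
        HasDerivAt.fun_sum fun k _ => ((hasDerivAt_hpow hx _).const_mul _).const_mul _
      have h2 := (h1.congr_of_eventuallyEq
        ((eventually_gt_nhds hx).mono fun y hy => hDx y hy t)).deriv
      rw [Dx, h2]
      refine Finset.sum_congr rfl fun k _ => ?_
      rw [hs, show e k - 1 - 1 = e k - 2 by ring]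
      push_cast; ring
    have hcub : P x t * P x t * star (P x t) = ∑ p ∈ Finset.range (N + 1) ×ˢ
        Finset.range (N + 1) ×ˢ Finset.range (N + 1),
        (c p.1 (φ t) * c p.2.1 (φ t) * star (c p.2.2 (φ t)))
          * hpow (e (t3 p.1 p.2.1 p.2.2)) x := by
      rw [hPe, star_sum, mul_assoc, Finset.sum_mul_sum, Finset.sum_mul_sum, Finset.sum_product]
      refine Finset.sum_congr rfl fun p _ => ?_
      rw [Finset.sum_product]
      refine Finset.sum_congr rfl fun q _ => ?_
      rw [Finset.mul_sum]
      refine Finset.sum_congr rfl fun r _ => ?_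
      rw [star_mul, star_hpow hx.le, ht, ← hpow_mul hx.le, ← hpow_mul hx.le]
      ring
    have hcr : ∑ k ∈ Finset.range (N + 1),
        (coefRhs e s t3 μ (k + 1) k fun p => c p (φ t)) * hpow (e k) x =
        ∑ p ∈ (Finset.range (N + 1)).filter (fun p => s p ≤ N),
          ((e p * (e p - 1) : ℝ) : ℂ) * (c p (φ t) * hpow (e (s p)) x)
        + μ * ∑ p ∈ (Finset.range (N + 1) ×ˢ Finset.range (N + 1) ×ˢ
          Finset.range (N + 1)).filter (fun p => t3 p.1 p.2.1 p.2.2 ≤ N),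
          (c p.1 (φ t) * c p.2.1 (φ t) * star (c p.2.2 (φ t)))
            * hpow (e (t3 p.1 p.2.1 p.2.2)) x := by
      have m1 : ∀ p ∈ (Finset.range (N + 1)).filter (fun p => s p ≤ N),
          s p ∈ Finset.range (N + 1) := fun p hp => by
        simpa [Nat.lt_succ_iff] using (Finset.mem_filter.1 hp).2
      have m2 : ∀ p ∈ (Finset.range (N + 1) ×ˢ Finset.range (N + 1) ×ˢ
          Finset.range (N + 1)).filter (fun p => t3 p.1 p.2.1 p.2.2 ≤ N),
          t3 p.1 p.2.1 p.2.2 ∈ Finset.range (N + 1) := fun p hp => by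
        simpa [Nat.lt_succ_iff] using (Finset.mem_filter.1 hp).2
      rw [← Finset.sum_fiberwise_of_maps_to m1, ← Finset.sum_fiberwise_of_maps_to m2,
        Finset.mul_sum, ← Finset.sum_add_distrib]
      refine Finset.sum_congr rfl fun k hk => ?_
      have hkN : k ≤ N := Nat.lt_succ_iff.1 (Finset.mem_range.1 hk)
      have f1 : ((Finset.range (N + 1)).filter (fun p => s p ≤ N)).filter (fun p => s p = k)
          = (Finset.range (N + 1)).filter (fun p => s p = k) := by
        rw [Finset.filter_filter]
        exact Finset.filter_congr fun p _ => ⟨fun h => h.2, fun h => ⟨h ▸ hkN, h⟩⟩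
      have f2 : ((Finset.range (N + 1) ×ˢ Finset.range (N + 1) ×ˢ Finset.range (N + 1)).filter
          (fun p => t3 p.1 p.2.1 p.2.2 ≤ N)).filter (fun p => t3 p.1 p.2.1 p.2.2 = k)
          = triples t3 (N + 1) k := by
        rw [Finset.filter_filter]
        exact Finset.filter_congr fun p _ => ⟨fun h => h.2, fun h => ⟨h ▸ hkN, h⟩⟩
      rw [coefRhs_eq he he0 hs ht μ _ hkN, f1, f2, add_mul, mul_assoc (μ : ℂ), Finset.sum_mul,
        Finset.sum_mul]
      congr 1
      · refine Finset.sum_congr rfl fun p hp => ?_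
        rw [(Finset.mem_filter.1 hp).2]; ring
      · congr 1
        refine Finset.sum_congr rfl fun p hp => ?_
        rw [(mem_triples.1 hp).2]
    have h1 := Finset.sum_filter_add_sum_filter_not (Finset.range (N + 1)) (fun p => s p ≤ N)
      fun p => ((e p * (e p - 1) : ℝ) : ℂ) * (c p (φ t) * hpow (e (s p)) x)
    have h2 := Finset.sum_filter_add_sum_filter_not (Finset.range (N + 1) ×ˢ
      Finset.range (N + 1) ×ˢ Finset.range (N + 1)) (fun p => t3 p.1 p.2.1 p.2.2 ≤ N)
      fun p => (c p.1 (φ t) * c p.2.1 (φ t) * star (c p.2.2 (φ t)))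
          * hpow (e (t3 p.1 p.2.1 p.2.2)) x
    rw [← hDxx] at h1
    rw [← hcub] at h2
    simp only [residual, T, Pi.add_apply, Pi.mul_apply, Pi.smul_apply, Pi.star_apply,
      smul_eq_mul, Finset.sum_apply]
    rw [← h1, ← h2, hDt]
    simp only [mul_assoc (Complex.I * θ t : ℂ)]
    rw [← Finset.mul_sum, hcr]
    linear_combination (θ t * (∑ p ∈ (Finset.range (N + 1)).filter (fun p => s p ≤ N),
          ((e p * (e p - 1) : ℝ) : ℂ) * (c p (φ t) * hpow (e (s p)) x)
        + μ * ∑ p ∈ (Finset.range (N + 1) ×ˢ Finset.range (N + 1) ×ˢ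
          Finset.range (N + 1)).filter (fun p => t3 p.1 p.2.1 p.2.2 ≤ N),
          (c p.1 (φ t) * c p.2.1 (φ t) * star (c p.2.2 (φ t)))
            * hpow (e (t3 p.1 p.2.1 p.2.2)) x)) * Complex.I_mul_I
  have hW0' : Sym 0 W := hWe.mono he0
  have hres : Sm (residual θ μ W) :=
    (hW.dt.smul _).add (hθ.sym.1.mul (hW.dx.dx.add (((hW.mul hW).mul hW.star).smul _)))
  intro γ
  obtain ⟨N, hN⟩ : ∃ N, e (N + 1) ≤ γ := by
    obtain ⟨N, hN⟩ := (hb.eventually_le_atBot γ).exists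
    exact ⟨N, (he.antitone (Nat.le_succ N)).trans hN⟩
  have hD : Sym γ (residual θ μ W - residual θ μ
      (∑ k ∈ Finset.range (N + 1), fun x t => c k (φ t) * hpow (e k) x) + T N) :=
    ((sym_residual_sub hθ μ hW0' ((hPs N).mono he0) (hWs N)).add (hT N)).mono hN
  have hpos : ∀ i j x t, 1 ≤ x → pd (residual θ μ W) i j x t = pd (residual θ μ W - residual θ μ
      (∑ k ∈ Finset.range (N + 1), fun x t => c k (φ t) * hpow (e k) x) + T N) i j x t := by
    intro i j x t hx
    have hx' : Real.exp (-1) < x := lt_of_lt_of_le (by simp) hx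
    refine pd_congr_nhds ((eventually_gt_nhds hx').mono fun y hy t => ?_) i j t
    simp only [Pi.add_apply, Pi.sub_apply, hPT N y hy t]
    ring
  have hzero : ∀ i j x t, x < 1 → pd (residual θ μ W) i j x t = 0 := by
    intro i j x t hx
    have : pd (residual θ μ W) i j x t = pd 0 i j x t := by
      refine pd_congr_nhds ((eventually_lt_nhds hx).mono fun y hy t => ?_) i j t
      have hz : ∀ j, pd W 0 j y t = 0 := fun j => by
        have h1 : pd W 0 j y t = pd 0 0 j y t :=
          pd_congr_nhds ((eventually_lt_nhds hy).mono fun z hz t => hW0 z hz.le t) 0 j t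
        rw [h1, pd_zero]
      have hdt : Dt W y t = 0 := by
        have h2 : W y = fun _ => 0 := funext fun t => hW0 y hy.le t
        simp [Dt, h2]
      have hdx : Dx (Dx W) y t = 0 := by
        rw [Dx_eq_pd W, hW.dx_pd]; exact hz 2
      simp [residual, hdt, hdx, hW0 y hy.le t]
    rw [this, pd_zero]
  refine Sym.of_pieces hres (fun i j => ?_) (fun i j => ?_) (fun i j => ?_)
  · obtain ⟨C, hC⟩ := hD.2 i j
    exact ⟨C, fun x t hx => by rw [hpos i j x t hx]; simpa [jb_of_one_le hx] using hC x t⟩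
  · refine ⟨0, fun x t hx => ?_⟩
    rw [hzero i j x t (by linarith)]; simp
  · obtain ⟨C, hC⟩ := hD.2 i j
    refine ⟨C, fun x t hx => ?_⟩
    rcases lt_or_ge x 1 with h | h
    · rw [hzero i j x t h, norm_zero]
      have := hC 1 t
      rw [jb_of_one_le le_rfl, Real.one_rpow, mul_one] at this
      exact (norm_nonneg _).trans this
    · rw [hpos i j x t h]
      simpa [jb_of_abs_le hx] using hC x t

end NLS

namespace NLS

open Filter Topology
open scoped ContDiff

theorem rapid_of_x {g : ℝ → ℂ} (hg : ContDiff ℝ ∞ g)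
    (hp : ∀ (γ : ℝ) (j : ℕ), ∃ C, ∀ x, 1 ≤ x → ‖iteratedDeriv j g x‖ ≤ C * x ^ (γ - j))
    (hm : ∀ (γ : ℝ) (j : ℕ), ∃ C, ∀ x, 1 ≤ x →
      ‖iteratedDeriv j (fun y => g (-y)) x‖ ≤ C * x ^ (γ - j)) :
    Rapid (fun x _ => g x) := by
  intro γ
  refine Sym.of_x hg fun j => ?_
  obtain ⟨A, hA⟩ := hp γ j
  obtain ⟨B, hB⟩ := hm γ j
  obtain ⟨D, hD⟩ := (isCompact_Icc (a := (-1 : ℝ)) (b := 1)).exists_bound_of_continuousOn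
    ((hg.continuous_iteratedDeriv j (by exact_mod_cast le_top)).continuousOn)
  refine ⟨max A (max B D), fun x => ?_⟩
  have hj := jb_rpow_pos x (γ - j)
  rcases le_total 1 x with h | h
  · refine (hA x h).trans ?_
    rw [jb_of_one_le h] at hj ⊢
    exact mul_le_mul_of_nonneg_right (le_max_left _ _) hj.le
  · rcases le_total (-1) x with h' | h'
    · refine (hD x ⟨h', h⟩).trans ?_
      rw [jb_of_abs_le (abs_le.2 ⟨h', h⟩), Real.one_rpow, mul_one]
      exact (le_max_right _ _).trans (le_max_right _ _)
    · have h1 := hB (-x) (by linarith)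
      rw [iteratedDeriv_comp_neg, neg_neg, norm_smul] at h1
      simp only [norm_pow, norm_neg, norm_one, one_pow, one_mul] at h1
      refine h1.trans ?_
      rw [jb_of_le h'] at hj ⊢
      exact mul_le_mul_of_nonneg_right ((le_max_left _ _).trans (le_max_right _ _)) hj.le

theorem sum_subsequence {e e' : ℕ → ℝ} (he : StrictAnti e) (he' : StrictAnti e') {σ : ℕ → ℕ}
    (hσ : ∀ j, e' (σ j) = e j) (a : ℕ → ℂ) :
    StrictMono σ ∧ ∃ c₀ : ℕ → ℂ, (∀ j, c₀ (σ j) = a j) ∧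
      (∀ m, c₀ m ≠ 0 → ∃ j, σ j = m) ∧
      ∀ N (f : ℕ → ℂ), ∑ k ∈ Finset.range (σ N + 1), c₀ k * f k
        = ∑ j ∈ Finset.range (N + 1), a j * f (σ j) := by
  classical
  have hmono : StrictMono σ := fun i j hij =>
    he'.lt_iff_gt.1 (by rw [hσ, hσ]; exact he hij)
  refine ⟨hmono, fun m => if h : ∃ j, σ j = m then a h.choose else 0, ?_, ?_, ?_⟩
  · intro j
    have h : ∃ i, σ i = σ j := ⟨j, rfl⟩
    beta_reduce
    rw [dif_pos h, hmono.injective h.choose_spec]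
  · intro m hm
    by_contra h
    exact hm (dif_neg h)
  · intro N f
    have hsub : (Finset.range (N + 1)).image σ ⊆ Finset.range (σ N + 1) := by
      intro k hk
      obtain ⟨j, hj, rfl⟩ := Finset.mem_image.1 hk
      exact Finset.mem_range.2 (Nat.lt_succ_of_le
        (hmono.monotone (Nat.lt_succ_iff.1 (Finset.mem_range.1 hj))))
    rw [← Finset.sum_subset hsub, Finset.sum_image fun _ _ _ _ h => hmono.injective h]
    · refine Finset.sum_congr rfl fun j _ => ?_
      have h : ∃ i, σ i = σ j := ⟨j, rfl⟩
      beta_reduce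
      rw [dif_pos h, hmono.injective h.choose_spec]
    · intro k hk hk'
      beta_reduce
      rw [dif_neg, zero_mul]
      rintro ⟨j, rfl⟩
      refine hk' (Finset.mem_image_of_mem _ (Finset.mem_range.2 ?_))
      have := Nat.lt_succ_iff.1 (Finset.mem_range.1 hk)
      exact Nat.lt_succ_of_le (hmono.le_iff_le.1 this)

theorem exists_half {e e' : ℕ → ℝ} (he : StrictAnti e) (hb : Tendsto e atTop atBot)
    (he' : StrictAnti e') (he0' : e' 0 ≤ 0) (hb' : Tendsto e' atTop atBot)
    {s : ℕ → ℕ} (hs : ∀ k, e' (s k) = e' k - 2)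
    {t3 : ℕ → ℕ → ℕ → ℕ} (ht : ∀ p q r, e' (t3 p q r) = e' p + e' q + e' r)
    {σ : ℕ → ℕ} (hσ : ∀ j, e' (σ j) = e j) (μ : ℝ) {τ : ℝ} {θ φ : ℝ → ℝ} (hθ : IsClock τ θ φ)
    {w0 : ℝ → ℂ} (hw0 : ContDiff ℝ ∞ w0) {a : ℕ → ℂ}
    (ha : ∀ N j : ℕ, ∃ C : ℝ, ∀ x : ℝ, 1 ≤ x →
      ‖iteratedDeriv j (fun y => w0 y - ∑ k ∈ Finset.range (N + 1), a k * ((y ^ e k : ℝ) : ℂ)) x‖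
        ≤ C * x ^ (e (N + 1) - (j : ℝ))) :
    ∃ (c : ℕ → ℝ → ℂ) (W : ℝ → ℝ → ℂ), (∀ k, EC (c k)) ∧
      (∀ j, (∀ m < j, a m = 0) → a j ≠ 0 →
        (∀ m < σ j, ∀ t, c m t = 0) ∧ ∀ t, c (σ j) t ≠ 0) ∧
      Sym (e' 0) W ∧ (∀ x ≤ 1, ∀ t, W x t = 0) ∧
      (∀ N, Sym (e' (N + 1))
        (W - ∑ k ∈ Finset.range (N + 1), fun x t => c k t * hpow (e' k) x)) ∧
      Rapid (residual θ μ W) ∧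
      ∀ (γ : ℝ) (j : ℕ), ∃ C, ∀ x, 1 ≤ x →
        ‖iteratedDeriv j (fun y => w0 y - W y 0) x‖ ≤ C * x ^ (γ - j) := by
  obtain ⟨hmono, c₀, hi1, hi2, hsum⟩ := sum_subsequence he he' hσ a
  obtain ⟨c, hc, hc0, hcd, hlead⟩ := exists_coefficients he' he0' s ht μ c₀
  obtain ⟨W, hW, hW0, hWs, hWr⟩ := exists_approx_half he' he0' hb' hs ht μ hθ hc hcd
  refine ⟨fun k t => c k (φ t), W, fun k => hθ.comp_ec (hc k), fun j hj hne => ?_, hW, hW0, hWs,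
    hWr, fun γ j => ?_⟩
  · have h1 := hlead (σ j) (fun m hm => ?_) (by rw [hi1]; exact hne)
    · exact ⟨fun m hm t => h1.1 m hm _, fun t => h1.2 _⟩
    · by_contra h
      obtain ⟨i, rfl⟩ := hi2 m h
      rw [hi1, hj i (hmono.lt_iff_lt.1 hm)] at h
      exact h rfl
  · obtain ⟨N, hN⟩ := (hb.eventually_le_atBot γ).exists
    obtain ⟨A, hA⟩ := ha N j
    obtain ⟨B, hB⟩ := (hWs (σ N)).2 0 j
    refine ⟨|A| + |B|, fun x hx => ?_⟩
    have hx0 : 0 < x := by linarith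
    set P : ℝ → ℂ := fun y => ∑ k ∈ Finset.range (N + 1), a k * ((y ^ e k : ℝ) : ℂ) with hP
    set D : ℝ → ℝ → ℂ := W - ∑ k ∈ Finset.range (σ N + 1), fun x t => c k (φ t) * hpow (e' k) x
      with hD
    have hDx : ContDiff ℝ ∞ fun y => D y 0 := (hWs (σ N)).1.slice_x 0
    have hloc : (fun y => w0 y - W y 0) =ᶠ[𝓝 x] fun y => (w0 y - P y) - D y 0 := by
      have hx1 : Real.exp (-1) < x := lt_of_lt_of_le (by simp) hx
      refine (eventually_gt_nhds hx1).mono fun y hy => ?_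
      have h1 := hsum N fun k => hpow (e' k) y
      have h2 : P y = ∑ j ∈ Finset.range (N + 1), a j * hpow (e' (σ j)) y :=
        Finset.sum_congr rfl fun k _ => by rw [hσ, hpow_eq hy.le]
      simp only [hD, Pi.sub_apply, Finset.sum_apply, hθ.zero, hc0]
      rw [h1, ← h2]
      ring
    have hPd : ContDiffAt ℝ ∞ P x := ContDiffAt.sum fun k _ => contDiffAt_const.mul
      (Complex.ofRealCLM.contDiff.contDiffAt.comp x (Real.contDiffAt_rpow_const_of_ne hx0.ne'))
    have hj : ((j : WithTop ℕ∞)) ≤ ∞ := by exact_mod_cast le_top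
    rw [hloc.iteratedDeriv_eq j]
    have h3 := iteratedDeriv_sub (n := j) (x := x) ((hw0.contDiffAt.sub hPd).of_le hj)
      (hDx.contDiffAt.of_le hj)
    have h4 : iteratedDeriv j (fun y => (w0 y - P y) - D y 0) x
        = iteratedDeriv j (fun y => w0 y - P y) x - iteratedDeriv j (fun y => D y 0) x := h3
    rw [h4]
    have hb1 := hB x 0
    rw [jb_of_one_le hx] at hb1
    have hpd : pd D 0 j x 0 = iteratedDeriv j (fun y => D y 0) x := by simp [pd]
    rw [hpd] at hb1
    have hr : ∀ δ, δ ≤ γ → x ^ (δ - j) ≤ x ^ (γ - j) := fun δ hδ =>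
      Real.rpow_le_rpow_of_exponent_le hx (by linarith)
    have hp := Real.rpow_nonneg hx0.le
    have e1 : e (N + 1) ≤ γ := (he.antitone (Nat.le_succ N)).trans hN
    have e2 : e' (σ N + 1) ≤ γ := (he'.antitone (Nat.le_succ _)).trans (by rw [hσ]; exact hN)
    calc _ ≤ _ := norm_sub_le _ _
      _ ≤ A * x ^ (e (N + 1) - j) + B * x ^ (e' (σ N + 1) - j) := add_le_add (hA x hx) hb1
      _ ≤ |A| * x ^ (γ - j) + |B| * x ^ (γ - j) :=
          add_le_add (mul_le_mul (le_abs_self A) (hr _ e1) (hp _) (abs_nonneg _))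
            (mul_le_mul (le_abs_self B) (hr _ e2) (hp _) (abs_nonneg _))
      _ = _ := by ring

theorem dx_neg_x (u : ℝ → ℝ → ℂ) : Dx (fun x t => u (-x) t) = fun x t => -Dx u (-x) t := by
  ext x t
  simpa using! deriv_comp_neg (fun y => u y t) x

theorem residual_neg_x (θ : ℝ → ℝ) (μ : ℝ) (u : ℝ → ℝ → ℂ) :
    residual θ μ (fun x t => u (-x) t) = fun x t => residual θ μ u (-x) t := by
  have h : Dx (Dx fun x t => u (-x) t) = fun x t => Dx (Dx u) (-x) t := by
    rw [dx_neg_x]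
    ext x t
    have h1 := congrFun (congrFun (dx_neg_x (Dx u)) x) t
    have h2 : Dx (fun x t => -Dx u (-x) t) x t = -Dx (fun x t => Dx u (-x) t) x t := by
      simp [Dx, deriv.fun_neg]
    rw [h2, h1, neg_neg]
  ext x t
  simp only [residual, h, Pi.add_apply, Pi.mul_apply, Pi.smul_apply, Pi.star_apply]
  rfl

theorem residual_add {θ : ℝ → ℝ} {μ : ℝ} {u v : ℝ → ℝ → ℂ} (hu : Sm u) (hv : Sm v)
    (h : ∀ x t, u x t = 0 ∨ v x t = 0) :
    residual θ μ (u + v) = residual θ μ u + residual θ μ v := by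
  ext x t
  simp only [residual, dt_add hu hv, dx_add hu hv, dx_add hu.dx hv.dx, Pi.add_apply, Pi.mul_apply,
    Pi.smul_apply, Pi.star_apply, smul_eq_mul]
  rcases h x t with h | h <;> simp [h] <;> ring

theorem Rapid.neg_x {u : ℝ → ℝ → ℂ} (hu : Rapid u) : Rapid (fun x t => u (-x) t) :=
  fun γ => (hu γ).neg_x

end NLS

namespace NLS

open Filter Topology
open scoped ContDiff

theorem ofReal_add_I_mul_eq_zero {a b : ℝ} : (a : ℂ) + Complex.I * b = 0 ↔ a = 0 ∧ b = 0 := by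
  simp [Complex.ext_iff]

theorem asym_half {e : ℕ → ℝ} {c : ℕ → ℝ → ℂ} {W₁ W₂ v : ℝ → ℝ → ℂ}
    (hW₁ : ∀ N, Sym (e (N + 1))
      (W₁ - ∑ k ∈ Finset.range (N + 1), fun x t => c k t * hpow (e k) x))
    (hW₂ : ∀ x ≤ 1, ∀ t, W₂ x t = 0) (hv : Rapid v) (N i j : ℕ) :
    ∃ C > (0 : ℝ), ∀ x : ℝ, 1 ≤ x → ∀ t : ℝ,
      ‖pd (fun y s => (W₁ y s + W₂ (-y) s + v y s)
        - psumP e (fun k t => (c k t).re) (fun k t => (c k t).im) N y s) i j x t‖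
        ≤ C * x ^ (e (N + 1) - (j : ℝ)) := by
  obtain ⟨C, hC⟩ := ((hW₁ N).add (hv (e (N + 1)))).2 i j
  refine ⟨|C| + 1, by positivity, fun x hx t => ?_⟩
  have hx1 : Real.exp (-1) < x := lt_of_lt_of_le (by simp) hx
  rw [pd_congr_nhds (v := (W₁ - ∑ k ∈ Finset.range (N + 1), fun x t => c k t * hpow (e k) x) + v)]
  · refine (hC x t).trans ?_
    rw [jb_of_one_le hx]
    exact mul_le_mul_of_nonneg_right ((le_abs_self C).trans (by linarith))
      (Real.rpow_nonneg (by linarith) _)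
  · refine (eventually_gt_nhds hx1).mono fun y hy t => ?_
    have h2 : W₂ (-y) t = 0 := hW₂ _ (by have := Real.exp_pos (-1); linarith) t
    have h3 : psumP e (fun k t => (c k t).re) (fun k t => (c k t).im) N y t
        = ∑ k ∈ Finset.range (N + 1), c k t * hpow (e k) y := by
      refine Finset.sum_congr rfl fun k _ => ?_
      rw [hpow_eq hy.le, mul_comm Complex.I, Complex.re_add_im]
    simp only [h3, h2, Pi.add_apply, Pi.sub_apply, Finset.sum_apply]
    ring

theorem contDiff_re_im {f : ℝ → ℂ} (h : ContDiff ℝ ∞ f) :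
    ContDiff ℝ ∞ (fun t => (f t).re) ∧ ContDiff ℝ ∞ (fun t => (f t).im) :=
  ⟨Complex.reCLM.contDiff.comp h, Complex.imCLM.contDiff.comp h⟩

theorem exists_approx {β : ℝ} (hβ : β ≤ 0) {e : ℕ → ℝ} (he : IsExp β e) (μ : ℝ)
    {τ : ℝ} {θ φ : ℝ → ℝ} (hθ : IsClock τ θ φ) {w₀ : ℝ → ℂ} (hw₀ : ContDiff ℝ ∞ w₀)
    {ap bp am bm : ℕ → ℝ}
    (hasymP : ∀ N j : ℕ, ∃ C > (0 : ℝ), ∀ x : ℝ, 1 ≤ x →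
      ‖iteratedDeriv j (fun y => w₀ y - psumP e (fun k _ => ap k) (fun k _ => bp k) N y 0) x‖
        ≤ C * x ^ (e (N + 1) - (j : ℝ)))
    (hasymM : ∀ N j : ℕ, ∃ C > (0 : ℝ), ∀ x : ℝ, x ≤ -1 →
      ‖iteratedDeriv j (fun y => w₀ y - psumM e (fun k _ => am k) (fun k _ => bm k) N y 0) x‖
        ≤ C * (-x) ^ (e (N + 1) - (j : ℝ))) :
    ∃ e' : ℕ → ℝ, IsExp β e' ∧ ∃ Ap Bp Am Bm : ℕ → ℝ → ℝ, ∃ W : ℝ → ℝ → ℂ,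
      (∀ k, ContDiff ℝ ∞ (Ap k) ∧ ContDiff ℝ ∞ (Bp k) ∧ ContDiff ℝ ∞ (Am k) ∧
        ContDiff ℝ ∞ (Bm k)) ∧
      (∀ j : ℕ, (∀ m < j, ap m = 0 ∧ bp m = 0) → (ap j ≠ 0 ∨ bp j ≠ 0) →
        ∃ j' : ℕ, e' j' = e j ∧ (∀ t, Ap j' t ≠ 0 ∨ Bp j' t ≠ 0) ∧
          (∀ m' < j', ∀ t, Ap m' t = 0 ∧ Bp m' t = 0)) ∧
      (∀ j : ℕ, (∀ m < j, am m = 0 ∧ bm m = 0) → (am j ≠ 0 ∨ bm j ≠ 0) →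
        ∃ j' : ℕ, e' j' = e j ∧ (∀ t, Am j' t ≠ 0 ∨ Bm j' t ≠ 0) ∧
          (∀ m' < j', ∀ t, Am m' t = 0 ∧ Bm m' t = 0)) ∧
      Sym 0 W ∧ Rapid (residual θ μ W) ∧ Rapid (fun x _ => w₀ x - W x 0) ∧
      ∀ v, Rapid v → ∀ T, AsymOn (fun x t => W x t + v x t) T e' Ap Bp Am Bm := by
  obtain ⟨e', he', s, t3, σ, hs, ht, hσ⟩ := exists_enumeration he hβ
  have he0' : e' 0 ≤ 0 := he'.1.trans_le hβ
  have haP : ∀ N j : ℕ, ∃ C : ℝ, ∀ x : ℝ, 1 ≤ x →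
      ‖iteratedDeriv j (fun y => w₀ y - ∑ k ∈ Finset.range (N + 1),
        ((ap k : ℂ) + Complex.I * bp k) * ((y ^ e k : ℝ) : ℂ)) x‖
        ≤ C * x ^ (e (N + 1) - (j : ℝ)) := fun N j =>
    let ⟨C, _, hC⟩ := hasymP N j
    ⟨C, hC⟩
  have haM : ∀ N j : ℕ, ∃ C : ℝ, ∀ x : ℝ, 1 ≤ x →
      ‖iteratedDeriv j (fun y => w₀ (-y) - ∑ k ∈ Finset.range (N + 1),
        ((am k : ℂ) + Complex.I * bm k) * ((y ^ e k : ℝ) : ℂ)) x‖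
        ≤ C * x ^ (e (N + 1) - (j : ℝ)) := fun N j => by
    obtain ⟨C, _, hC⟩ := hasymM N j
    refine ⟨C, fun x hx => ?_⟩
    have h1 := hC (-x) (by linarith)
    have h2 := iteratedDeriv_comp_neg j
      (fun y => w₀ y - psumM e (fun k _ => am k) (fun k _ => bm k) N y 0) x
    simp only [psumM, neg_neg] at h1 h2
    rw [h2, norm_smul]
    simpa using! h1
  have hw₀' : ContDiff ℝ ∞ fun y => w₀ (-y) := hw₀.comp contDiff_neg
  obtain ⟨cp, Wp, hcp, hlp, hWp, hWp0, hWps, hWpr, hWpi⟩ := exists_half he.2.1 he.2.2 he'.2.1 he0'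
    he'.2.2 hs ht hσ μ hθ hw₀ haP
  obtain ⟨cm, Wm, hcm, hlm, hWm, hWm0, hWms, hWmr, hWmi⟩ := exists_half he.2.1 he.2.2 he'.2.1 he0'
    he'.2.2 hs ht hσ μ hθ hw₀' haM
  have hlead : ∀ (a b : ℕ → ℝ) (c : ℕ → ℝ → ℂ),
      (∀ j, (∀ m < j, (a m : ℂ) + Complex.I * b m = 0) → (a j : ℂ) + Complex.I * b j ≠ 0 →
        (∀ m < σ j, ∀ t, c m t = 0) ∧ ∀ t, c (σ j) t ≠ 0) →
      ∀ j : ℕ, (∀ m < j, a m = 0 ∧ b m = 0) → (a j ≠ 0 ∨ b j ≠ 0) →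
        ∃ j' : ℕ, e' j' = e j ∧ (∀ t, (c j' t).re ≠ 0 ∨ (c j' t).im ≠ 0) ∧
          (∀ m' < j', ∀ t, (c m' t).re = 0 ∧ (c m' t).im = 0) := by
    intro a b c h j h0 h1
    obtain ⟨h2, h3⟩ := h j (fun m hm => ofReal_add_I_mul_eq_zero.2 (h0 m hm)) fun h => by
      have := ofReal_add_I_mul_eq_zero.1 h
      tauto
    refine ⟨σ j, hσ j, fun t => ?_, fun m hm t => by simp [h2 m hm t]⟩
    have := h3 t
    rw [Ne, Complex.ext_iff] at this
    simp only [Complex.zero_re, Complex.zero_im] at this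
    tauto
  have hWm' : Sym 0 fun x t => Wm (-x) t := (hWm.mono he0').neg_x
  have hWp' : Sym 0 Wp := hWp.mono he0'
  refine ⟨e', he', fun k t => (cp k t).re, fun k t => (cp k t).im, fun k t => (cm k t).re,
    fun k t => (cm k t).im, Wp + fun x t => Wm (-x) t, fun k =>
    ⟨(contDiff_re_im (hcp k).1).1, (contDiff_re_im (hcp k).1).2, (contDiff_re_im (hcm k).1).1,
      (contDiff_re_im (hcm k).1).2⟩, hlead _ _ _ hlp, hlead _ _ _ hlm, hWp'.add hWm', ?_, ?_, ?_⟩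
  · rw [residual_add hWp'.1 hWm'.1, residual_neg_x]
    · exact hWpr.add hWmr.neg_x
    · intro x t
      rcases le_total x 1 with h | h
      · exact Or.inl (hWp0 x h t)
      · exact Or.inr (hWm0 (-x) (by linarith) t)
  · have hsm : ContDiff ℝ ∞ fun x => w₀ x - (Wp + fun x t => Wm (-x) t) x 0 :=
      hw₀.sub ((hWp'.add hWm').1.slice_x 0)
    refine rapid_of_x hsm (fun γ j => ?_) fun γ j => ?_
    · obtain ⟨C, hC⟩ := hWpi γ j
      refine ⟨C, fun x hx => ?_⟩
      rw [EventuallyEq.iteratedDeriv_eq (g := fun y => w₀ y - Wp y 0)]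
      · exact hC x hx
      · refine (eventually_gt_nhds (show (-1 : ℝ) < x by linarith)).mono fun y hy => ?_
        simp [hWm0 (-y) (by linarith)]
    · obtain ⟨C, hC⟩ := hWmi γ j
      refine ⟨C, fun x hx => ?_⟩
      rw [EventuallyEq.iteratedDeriv_eq (g := fun y => w₀ (-y) - Wm y 0)]
      · exact hC x hx
      · refine (eventually_gt_nhds (show (-1 : ℝ) < x by linarith)).mono fun y hy => ?_
        simp [hWp0 (-y) (by linarith)]
  · intro v hv T
    constructor
    · intro N i j
      obtain ⟨C, hC, h⟩ := asym_half hWps hWm0 hv N i j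
      exact ⟨C, hC, fun x hx t _ => h x hx t⟩
    · intro N i j
      obtain ⟨C, hC, h⟩ := asym_half hWms hWp0 hv.neg_x N i j
      refine ⟨C, hC, fun x hx t _ => ?_⟩
      have h1 := h (-x) (by linarith) t
      set f : ℝ → ℝ → ℂ := fun y s => (Wm y s + Wp (-y) s + v (-y) s)
        - psumP e' (fun k t => (cm k t).re) (fun k t => (cm k t).im) N y s with hf
      have h2 := pd_neg_x f i j x t
      have h3 : (fun y s => (Wp + fun x t => Wm (-x) t) y s + v y s
          - psumM e' (fun k t => (cm k t).re) (fun k t => (cm k t).im) N y s)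
          = fun x t => f (-x) t := by
        ext y s
        simp only [hf, neg_neg, psumP, psumM, Pi.add_apply]
        ring
      rw [h3, h2, norm_mul]
      simpa using! h1

end NLS

namespace NLS

open Filter Topology
open scoped ContDiff

open MeasureTheory

theorem integrable_jb : Integrable (fun x : ℝ => jb x ^ (-2 : ℝ)) := by
  refine (integrable_inv_one_add_sq.const_mul 2).mono'
    (continuous_jb.rpow_const fun x => Or.inl (jb_pos x).ne').aestronglyMeasurable
    (Eventually.of_forall fun x => ?_)
  have h0 := jb_pos x
  rw [Real.norm_of_nonneg (jb_rpow_pos x _).le, Real.rpow_neg h0.le, ← div_eq_mul_inv,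
    inv_le_comm₀ (by positivity) (by positivity), inv_div, div_le_iff₀ two_pos]
  have h1 := one_le_jb x
  have h2 := abs_le_jb x
  have h3 : x ^ 2 ≤ jb x ^ 2 := by rw [← sq_abs]; gcongr
  norm_cast
  nlinarith

variable {u v : ℝ → ℝ → ℂ}

theorem Rapid.integrable (hu : Rapid u) (t : ℝ) : Integrable (fun x => u x t) := by
  obtain ⟨C, _, hC⟩ := hu.bound 0 0 (-2)
  rw [pd_zero_zero] at hC
  exact (integrable_jb.const_mul C).mono' (hu.sm.slice_x t).continuous.aestronglyMeasurable
    (Eventually.of_forall fun x => hC x t)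

theorem Rapid.hasDerivAt_integral (hu : Rapid u) {K : ℝ → ℂ} (hK : Continuous K)
    (hK1 : ∀ x, ‖K x‖ ≤ 1) (t : ℝ) :
    HasDerivAt (fun s => ∫ x, K x * u x s) (∫ x, K x * Dt u x t) t := by
  obtain ⟨C, _, hC⟩ := hu.bound 1 0 (-2)
  rw [← Dt_eq_pd] at hC
  have hd : ∀ x s, HasDerivAt (fun s => K x * u x s) (K x * Dt u x s) s := fun x s =>
    (hu.sm.hasDerivAt_t x s).const_mul (K x)
  have hm : ∀ s, AEStronglyMeasurable (fun x => K x * u x s) volume := fun s =>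
    (hK.mul (hu.sm.slice_x s).continuous).aestronglyMeasurable
  refine (hasDerivAt_integral_of_dominated_loc_of_deriv_le (F := fun s x => K x * u x s)
    (F' := fun s x => K x * Dt u x s) (bound := fun x => C * jb x ^ (-2 : ℝ)) univ_mem
    (Eventually.of_forall hm) ?_ ?_ ?_ (integrable_jb.const_mul C) ?_).2
  · exact (hu.integrable t).bdd_mul hK.aestronglyMeasurable (Eventually.of_forall hK1)
  · exact (hK.mul (hu.sm.dt.slice_x t).continuous).aestronglyMeasurable
  · refine Eventually.of_forall fun x s _ => ?_
    rw [norm_mul]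
    exact (mul_le_of_le_one_left (norm_nonneg _) (hK1 x)).trans (hC x s)
  · exact Eventually.of_forall fun x s _ => hd x s

open FourierTransform in
/-- The partial Fourier transform in the space variable. -/
def FT (u : ℝ → ℝ → ℂ) : ℝ → ℝ → ℂ := fun ξ t => 𝓕 (fun x => u x t) ξ

/-- Multiplication by `-2πix`. -/
def mX (u : ℝ → ℝ → ℂ) : ℝ → ℝ → ℂ := fun x t => -2 * Real.pi * Complex.I * x * u x t

theorem mX_eq (u : ℝ → ℝ → ℂ) :
    mX u = (-2 * Real.pi * Complex.I : ℂ) • ((fun (x _ : ℝ) => (x : ℂ)) * u) := by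
  ext x t
  simp [mX, mul_assoc]

theorem Rapid.mX (hu : Rapid u) : Rapid (mX u) := by
  rw [mX_eq]
  exact (Rapid.sym_mul Sym.id hu).smul _

theorem dt_mX (u : ℝ → ℝ → ℂ) : Dt (mX u) = mX (Dt u) := by
  ext x t
  simp only [Dt, mX, deriv_const_mul_field]

/-- The oscillating kernel of the Fourier transform. -/
def ker (ξ x : ℝ) : ℂ := Complex.exp (↑(-2 * Real.pi * x * ξ) * Complex.I)

theorem norm_ker (ξ x : ℝ) : ‖ker ξ x‖ = 1 := Complex.norm_exp_ofReal_mul_I _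

theorem continuous_ker : Continuous (Function.uncurry ker) := by
  unfold ker Function.uncurry
  fun_prop

theorem FT_eq (u : ℝ → ℝ → ℂ) (ξ t : ℝ) : FT u ξ t = ∫ x, ker ξ x * u x t :=
  Real.fourier_real_eq_integral_exp_smul _ _

theorem Rapid.norm_FT (hu : Rapid u) : ∃ C, ∀ ξ t, ‖FT u ξ t‖ ≤ C := by
  obtain ⟨C, _, hC⟩ := hu.bound 0 0 (-2)
  rw [pd_zero_zero] at hC
  refine ⟨∫ x, C * jb x ^ (-2 : ℝ), fun ξ t => ?_⟩
  rw [FT_eq]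
  refine norm_integral_le_of_norm_le (integrable_jb.const_mul C) (Eventually.of_forall fun x => ?_)
  rw [norm_mul, norm_ker, one_mul]
  exact hC x t

theorem Rapid.continuous_FT (hu : Rapid u) : Continuous (Function.uncurry (FT u)) := by
  obtain ⟨C, _, hC⟩ := hu.bound 0 0 (-2)
  rw [pd_zero_zero] at hC
  have h : Function.uncurry (FT u) = fun z : ℝ × ℝ => ∫ x, ker z.1 x * u x z.2 := by
    ext z
    exact FT_eq u z.1 z.2
  rw [h]
  refine continuous_of_dominated (bound := fun x => C * jb x ^ (-2 : ℝ)) (fun z => ?_) (fun z => ?_)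
    (integrable_jb.const_mul C) (Eventually.of_forall fun x => ?_)
  · exact ((continuous_ker.comp (by fun_prop : Continuous fun x : ℝ => (z.1, x))).mul
      (hu.sm.slice_x z.2).continuous).aestronglyMeasurable
  · refine Eventually.of_forall fun x => ?_
    rw [norm_mul, norm_ker, one_mul]
    exact hC x _
  · exact (continuous_ker.comp (by fun_prop : Continuous fun z : ℝ × ℝ => (z.1, x))).mul
      ((hu.sm.slice_t x).continuous.comp continuous_snd)

theorem Rapid.hasDerivAt_FT_x (hu : Rapid u) (ξ t : ℝ) :
    HasDerivAt (fun y => FT u y t) (FT (NLS.mX u) ξ t) ξ := by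
  have h1 : Integrable fun x : ℝ => x • u x t := by
    have := (Rapid.sym_mul Sym.id hu).integrable t
    simpa using! this
  exact Real.hasDerivAt_fourier (hu.integrable t) h1 ξ

theorem Rapid.hasDerivAt_FT_t (hu : Rapid u) (ξ t : ℝ) :
    HasDerivAt (fun s => FT u ξ s) (FT (Dt u) ξ t) t := by
  simp only [FT_eq]
  exact hu.hasDerivAt_integral (continuous_ker.comp (by fun_prop : Continuous fun x : ℝ => (ξ, x)))
    (fun x => (norm_ker ξ x).le) t

theorem Rapid.iterate_mX (hu : Rapid u) (j : ℕ) : Rapid (NLS.mX^[j] u) := by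
  induction j with
  | zero => exact hu
  | succ j ih => rw [Function.iterate_succ_apply']; exact ih.mX

theorem dt_iterate_mX (u : ℝ → ℝ → ℂ) (j : ℕ) : Dt (mX^[j] u) = mX^[j] (Dt u) := by
  induction j with
  | zero => rfl
  | succ j ih => rw [Function.iterate_succ_apply', Function.iterate_succ_apply', dt_mX, ih]

theorem Rapid.FT_family (hu : Rapid u) :
    Sm (FT u) ∧ ∀ i j, _root_.pd (FT u) i j = FT (NLS.mX^[j] (_root_.pd u i 0)) := by
  have hx : ∀ i j x t, HasDerivAt (fun y => FT (NLS.mX^[j] (_root_.pd u i 0)) y t)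
      (FT (NLS.mX^[j + 1] (_root_.pd u i 0)) x t) x := fun i j x t => by
    rw [Function.iterate_succ_apply']
    exact ((hu.pd i 0).iterate_mX j).hasDerivAt_FT_x x t
  have ht : ∀ i j x t, HasDerivAt (fun s => FT (NLS.mX^[j] (_root_.pd u i 0)) x s)
      (FT (NLS.mX^[j] (_root_.pd u (i + 1) 0)) x t) t := fun i j x t => by
    rw [pd_succ_left, ← dt_iterate_mX]
    exact ((hu.pd i 0).iterate_mX j).hasDerivAt_FT_t x t
  have h1 := sm_of_family (f := fun i j => FT (NLS.mX^[j] (_root_.pd u i 0)))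
    (fun i j => ((hu.pd i 0).iterate_mX j).continuous_FT) hx ht 0 0
  have h2 := pd_of_family (f := fun i j => FT (NLS.mX^[j] (_root_.pd u i 0))) hx ht
  simp only [Function.iterate_zero, id, pd_zero_zero] at h1 h2
  exact ⟨h1, h2⟩

theorem Rapid.FT_dx (hu : Rapid u) (ξ t : ℝ) :
    FT (Dx u) ξ t = 2 * Real.pi * Complex.I * ξ * FT u ξ t := by
  have h := congrFun (Real.fourier_deriv (hu.integrable t)
    ((hu.sm.slice_x t).differentiable (by simp)) (hu.dx.integrable t)) ξ
  exact h

theorem Rapid.FT_dx_iterate (hu : Rapid u) (a : ℕ) (ξ t : ℝ) :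
    FT (_root_.pd u 0 a) ξ t = (2 * Real.pi * Complex.I * ξ) ^ a * FT u ξ t := by
  induction a with
  | zero => simp [pd_zero_zero]
  | succ a ih => rw [pd_zero_succ, (hu.pd 0 a).FT_dx, ih, pow_succ]; ring

theorem rapid_of_bounds (hu : Sm u)
    (h : ∀ i j a : ℕ, ∃ C, ∀ x t, |x| ^ a * ‖pd u i j x t‖ ≤ C) : Rapid u := by
  intro γ
  refine ⟨hu, fun i j => ?_⟩
  obtain ⟨a, ha⟩ := exists_nat_ge (-(γ - j))
  obtain ⟨A, hA⟩ := h i j 0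
  obtain ⟨B, hB⟩ := h i j a
  refine ⟨A + B, fun x t => ?_⟩
  have h0 := jb_pos x
  have h1 : jb x ^ (-(a : ℝ)) ≤ jb x ^ (γ - j) :=
    Real.rpow_le_rpow_of_exponent_le (one_le_jb x) (by linarith)
  have hA0 : 0 ≤ A := (mul_nonneg (by positivity) (norm_nonneg _)).trans (hA 0 0)
  have hB0 : 0 ≤ B := (mul_nonneg (by positivity) (norm_nonneg _)).trans (hB 0 0)
  have h2 : jb x ^ a * ‖pd u i j x t‖ ≤ A + B := by
    rcases le_total |x| 1 with hx | hx
    · rw [jb_of_abs_le hx, one_pow, one_mul]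
      have := hA x t
      rw [pow_zero, one_mul] at this
      linarith
    · rw [jb, max_eq_right hx]
      linarith [hB x t]
  calc ‖pd u i j x t‖ ≤ (A + B) * jb x ^ (-(a : ℝ)) := by
        rw [Real.rpow_neg h0.le, Real.rpow_natCast, ← div_eq_mul_inv, le_div_iff₀ (by positivity),
          mul_comm]
        exact h2
    _ ≤ _ := by gcongr

theorem Rapid.FT (hu : Rapid u) : Rapid (FT u) := by
  refine rapid_of_bounds hu.FT_family.1 fun i j a => ?_
  have hv := (hu.pd i 0).iterate_mX j
  obtain ⟨C, hC⟩ := (hv.pd 0 a).norm_FT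
  refine ⟨C, fun ξ t => ?_⟩
  rw [hu.FT_family.2]
  refine le_trans ?_ (hC ξ t)
  rw [hv.FT_dx_iterate, norm_mul, norm_pow]
  gcongr
  simp only [norm_mul, Complex.norm_I, Complex.norm_real, Real.norm_eq_abs, abs_of_pos Real.pi_pos,
    mul_one, Complex.norm_ofNat]
  have := Real.pi_gt_three
  nlinarith [abs_nonneg ξ]

theorem Rapid.FT_FT (hu : Rapid u) (x t : ℝ) : NLS.FT (NLS.FT u) (-x) t = u x t := by
  have h := congrFun ((hu.sm.slice_x t).continuous.fourierInv_fourier_eq (hu.integrable t)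
    (hu.FT.integrable t)) x
  rw [Real.fourierInv_eq_fourier_neg] at h
  exact h

end NLS

namespace NLS

open Filter Topology
open scoped ContDiff

open MeasureTheory

variable {u v : ℝ → ℝ → ℂ} {τ : ℝ} {θ φ : ℝ → ℝ}

/-! ### The primitive in time -/

/-- The primitive in the clock time, vanishing at time zero. -/
def prim (θ : ℝ → ℝ) (u : ℝ → ℝ → ℂ) : ℝ → ℝ → ℂ := fun x t => ∫ s in (0 : ℝ)..t, (θ s : ℂ) * u x s

theorem IsClock.sm (hθ : IsClock τ θ φ) : Sm (fun _ t => (θ t : ℂ)) := hθ.sym.1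

theorem IsClock.continuous_mul (hθ : IsClock τ θ φ) (hu : Sm u) (x : ℝ) :
    Continuous fun s => (θ s : ℂ) * u x s :=
  (Complex.continuous_ofReal.comp hθ.smooth.continuous).mul (hu.slice_t x).continuous

theorem IsClock.integral_eq (hθ : IsClock τ θ φ) (t : ℝ) : ∫ s in (0 : ℝ)..t, θ s = φ t := by
  rw [intervalIntegral.integral_eq_sub_of_hasDerivAt (fun s _ => hθ.deriv s)
    (hθ.smooth.continuous.intervalIntegrable _ _), hθ.zero, sub_zero]

theorem hasDerivAt_prim (hθ : IsClock τ θ φ) (hu : Sm u) (x t : ℝ) :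
    HasDerivAt (fun s => prim θ u x s) ((θ t : ℂ) * u x t) t :=
  intervalIntegral.integral_hasDerivAt_right ((hθ.continuous_mul hu x).intervalIntegrable _ _)
    ((hθ.continuous_mul hu x).stronglyMeasurableAtFilter _ _) (hθ.continuous_mul hu x).continuousAt

theorem continuous_prim (hθ : IsClock τ θ φ) (hu : Sm u) :
    Continuous (Function.uncurry (prim θ u)) := by
  have h : Continuous (Function.uncurry fun (z : ℝ × ℝ) s => (θ s : ℂ) * u z.1 s) :=
    (Complex.continuous_ofReal.comp (hθ.smooth.continuous.comp continuous_snd)).mul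
      (hu.continuous.comp ((continuous_fst.comp continuous_fst).prodMk continuous_snd))
  exact intervalIntegral.continuous_parametric_intervalIntegral_of_continuous h continuous_snd

theorem norm_prim_le (hθ : IsClock τ θ φ) {x C : ℝ} (h : ∀ s, ‖u x s‖ ≤ C) (t : ℝ) :
    ‖prim θ u x t‖ ≤ τ * C := by
  have hC : 0 ≤ C := (norm_nonneg _).trans (h 0)
  have h1 : ‖prim θ u x t‖ ≤ |∫ s in (0 : ℝ)..t, θ s * C| := by
    refine intervalIntegral.norm_integral_le_abs_of_norm_le (Eventually.of_forall fun s => ?_)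
      ((hθ.smooth.continuous.mul continuous_const).intervalIntegrable _ _)
    rw [norm_mul, Complex.norm_real, Real.norm_of_nonneg (hθ.nonneg s)]
    exact mul_le_mul_of_nonneg_left (h s) (hθ.nonneg s)
  rw [intervalIntegral.integral_mul_const, hθ.integral_eq, abs_mul, abs_of_nonneg hC] at h1
  exact h1.trans (mul_le_mul_of_nonneg_right (hθ.abs_le t) hC)

theorem Rapid.hasDerivAt_prim_x (hu : Rapid u) (hθ : IsClock τ θ φ) (x t : ℝ) :
    HasDerivAt (fun y => prim θ u y t) (prim θ (Dx u) x t) x := by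
  obtain ⟨C, _, hC⟩ := hu.bound 0 1 0
  simp only [← Dx_eq_pd, Real.rpow_zero, mul_one] at hC
  have hd : ∀ y s, HasDerivAt (fun y => (θ s : ℂ) * u y s) ((θ s : ℂ) * Dx u y s) y := fun y s =>
    (hu.sm.hasDerivAt_x y s).const_mul _
  refine (intervalIntegral.hasDerivAt_integral_of_dominated_loc_of_deriv_le
    (F := fun y s => (θ s : ℂ) * u y s) (F' := fun y s => (θ s : ℂ) * Dx u y s)
    (bound := fun _ => C) univ_mem
    (Eventually.of_forall fun y => (hθ.continuous_mul hu.sm y).aestronglyMeasurable)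
    ((hθ.continuous_mul hu.sm x).intervalIntegrable _ _)
    (hθ.continuous_mul hu.sm.dx x).aestronglyMeasurable
    (Eventually.of_forall fun s _ y _ => ?_) (continuous_const.intervalIntegrable _ _)
    (Eventually.of_forall fun s _ y _ => hd y s)).2
  rw [norm_mul, Complex.norm_real, Real.norm_of_nonneg (hθ.nonneg s)]
  exact (mul_le_of_le_one_left (norm_nonneg _) (hθ.le_one s)).trans (hC y s)

theorem Rapid.prim (hu : Rapid u) (hθ : IsClock τ θ φ) : Rapid (prim θ u) := by
  have hθu : Rapid ((fun _ t => (θ t : ℂ)) * u) := Rapid.sym_mul hθ.sym hu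
  let f : ℕ → ℕ → ℝ → ℝ → ℂ := fun i j => match i with
    | 0 => NLS.prim θ (_root_.pd u 0 j)
    | i + 1 => _root_.pd ((fun _ t => (θ t : ℂ)) * u) i j
  have hc : ∀ i j, Continuous (Function.uncurry (f i j)) := fun i j => match i with
    | 0 => continuous_prim hθ (hu.pd 0 j).sm
    | i + 1 => (hθu.pd i j).sm.continuous
  have hx : ∀ i j x t, HasDerivAt (fun y => f i j y t) (f i (j + 1) x t) x := fun i j x t => by
    match i with
    | 0 =>
      have := (hu.pd 0 j).hasDerivAt_prim_x hθ x t
      rwa [← pd_zero_succ] at this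
    | i + 1 =>
      have := (hθu.pd i j).sm.hasDerivAt_x x t
      rwa [hθu.sm.dx_pd] at this
  have ht : ∀ i j x t, HasDerivAt (fun s => f i j x s) (f (i + 1) j x t) t := fun i j x t => by
    match i with
    | 0 =>
      have h1 := hasDerivAt_prim hθ (hu.pd 0 j).sm x t
      have h2 : _root_.pd ((fun _ t => (θ t : ℂ)) * u) 0 j x t
          = (θ t : ℂ) * _root_.pd u 0 j x t := by
        simp only [_root_.pd, Pi.mul_apply, iteratedDeriv_zero, iteratedDeriv_const_mul_field]
      change HasDerivAt _ (_root_.pd ((fun _ t => (θ t : ℂ)) * u) 0 j x t) t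
      rw [h2]
      exact h1
    | i + 1 =>
      have := (hθu.pd i j).sm.hasDerivAt_t x t
      rwa [← pd_succ_left] at this
  have h1 := sm_of_family hc hx ht 0 0
  have h2 := pd_of_family hx ht
  have h3 : f 0 0 = NLS.prim θ u := by simp only [f, pd_zero_zero]
  rw [h3] at h1 h2
  refine fun γ => ⟨h1, fun i j => ?_⟩
  match i with
  | 0 =>
    obtain ⟨C, _, hC⟩ := hu.bound 0 j (γ - j)
    refine ⟨τ * C, fun x t => ?_⟩
    rw [h2, mul_assoc]
    exact norm_prim_le hθ (hC x) t
  | i + 1 =>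
    obtain ⟨C, _, hC⟩ := hθu.bound i j (γ - j)
    refine ⟨C, fun x t => ?_⟩
    rw [h2]
    exact hC x t

/-! ### The free propagator on the Fourier side -/

/-- The multiplier `exp (i c ξ² φ(t))`. -/
def osc (c : ℝ) (φ : ℝ → ℝ) : ℝ → ℝ → ℂ := fun ξ t =>
  Complex.exp (((c * ξ ^ 2 * φ t : ℝ) : ℂ) * Complex.I)

theorem norm_osc (c : ℝ) (φ : ℝ → ℝ) (ξ t : ℝ) : ‖osc c φ ξ t‖ = 1 :=
  Complex.norm_exp_ofReal_mul_I _

theorem osc_mul_osc_neg (c : ℝ) (φ : ℝ → ℝ) (ξ t : ℝ) : osc c φ ξ t * osc (-c) φ ξ t = 1 := by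
  rw [osc, osc, ← Complex.exp_add, Complex.exp_eq_one_iff]
  exact ⟨0, by push_cast; ring⟩

theorem sm_osc (hφ : ContDiff ℝ ∞ φ) (c : ℝ) : Sm (osc c φ) := by
  have h1 : ContDiff ℝ ∞ fun z : ℝ × ℝ => φ z.2 := hφ.comp contDiff_snd
  have h2 : ContDiff ℝ ∞ fun z : ℝ × ℝ => c * z.1 ^ 2 * φ z.2 :=
    (contDiff_const.mul (contDiff_fst.pow 2)).mul h1
  exact ((Complex.ofRealCLM.contDiff.comp h2).mul contDiff_const).cexp

theorem dx_osc (c : ℝ) (φ : ℝ → ℝ) :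
    Dx (osc c φ) = osc c φ * fun ξ t : ℝ => 2 * c * Complex.I * (ξ * φ t) := by
  ext ξ t
  have h1 : HasDerivAt (fun y : ℝ => c * y ^ 2 * φ t) (c * (2 * ξ) * φ t) ξ := by
    simpa using! ((hasDerivAt_pow 2 ξ).const_mul c).mul_const (φ t)
  have h2 := (h1.ofReal_comp.mul_const Complex.I).cexp
  refine h2.deriv.trans ?_
  simp only [osc, Pi.mul_apply]
  push_cast
  ring

theorem dt_osc (hφ : ∀ t, HasDerivAt φ (θ t) t) (c : ℝ) :
    Dt (osc c φ) = osc c φ * fun ξ t : ℝ => c * Complex.I * (ξ ^ 2 * θ t) := by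
  ext ξ t
  have h1 : HasDerivAt (fun t : ℝ => c * ξ ^ 2 * φ t) (c * ξ ^ 2 * θ t) t :=
    (hφ t).const_mul _
  have h2 := (h1.ofReal_comp.mul_const Complex.I).cexp
  refine h2.deriv.trans ?_
  simp only [osc, Pi.mul_apply]
  push_cast
  ring

theorem IsClock.sym' (hθ : IsClock τ θ φ) : Sym 0 (fun _ t => (φ t : ℂ)) :=
  (hθ.comp_ec Complex.ofRealCLM.contDiff).sym

theorem Rapid.osc_mul (hu : Rapid u) (hθ : IsClock τ θ φ) (c : ℝ) : Rapid (osc c φ * u) := by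
  have hE := sm_osc hθ.smooth' c
  have key : ∀ i j, ∃ v, Rapid v ∧ _root_.pd (osc c φ * u) i j = osc c φ * v := by
    intro i
    induction i with
    | zero =>
      intro j
      induction j with
      | zero => exact ⟨u, hu, pd_zero_zero _⟩
      | succ j ih =>
        obtain ⟨v, hv, h⟩ := ih
        have h1 : Rapid ((2 * c * Complex.I : ℂ) • ((fun x _ : ℝ => (x : ℂ)) *
          ((fun _ t => (φ t : ℂ)) * v) : ℝ → ℝ → ℂ)) :=
          (Rapid.sym_mul Sym.id (Rapid.sym_mul hθ.sym' hv)).smul _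
        refine ⟨_, h1.add hv.dx, ?_⟩
        rw [pd_zero_succ, h, dx_mul hE hv.sm, dx_osc]
        ext x t
        simp only [Pi.add_apply, Pi.mul_apply, Pi.smul_apply, smul_eq_mul]
        ring
    | succ i ih =>
      intro j
      obtain ⟨v, hv, h⟩ := ih j
      have h1 : Rapid ((c * Complex.I : ℂ) • ((fun x _ : ℝ => (x : ℂ)) * ((fun x _ : ℝ => (x : ℂ)) *
        ((fun _ t => (θ t : ℂ)) * v)) : ℝ → ℝ → ℂ)) :=
        (Rapid.sym_mul Sym.id (Rapid.sym_mul Sym.id (Rapid.sym_mul hθ.sym hv))).smul _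
      refine ⟨_, h1.add hv.dt, ?_⟩
      rw [pd_succ_left, h, dt_mul hE hv.sm, dt_osc hθ.deriv]
      ext x t
      simp only [Pi.add_apply, Pi.mul_apply, Pi.smul_apply, smul_eq_mul]
      ring
  refine fun γ => ⟨hE.mul hu.sm, fun i j => ?_⟩
  obtain ⟨v, hv, h⟩ := key i j
  obtain ⟨C, _, hC⟩ := hv.bound 0 0 (γ - j)
  refine ⟨C, fun x t => ?_⟩
  rw [h, Pi.mul_apply, Pi.mul_apply, norm_mul, norm_osc, one_mul]
  simpa only [pd_zero_zero] using hC x t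

theorem exists_linear_solution (hθ : IsClock τ θ φ) {V G : ℝ → ℝ → ℂ} (hV : Rapid V)
    (hG : Rapid G) : ∃ u, Rapid u ∧ (∀ x, u x 0 = V x 0) ∧
      Dt u = Complex.I • ((fun _ t => (θ t : ℂ)) * (Dx (Dx u) + G)) := by
  obtain ⟨c, hc⟩ : ∃ c : ℝ, c = -(4 * Real.pi ^ 2) := ⟨_, rfl⟩
  have hV0 : Rapid (fun ξ (_ : ℝ) => FT V ξ 0) := fun γ => by
    refine Sym.of_x (hV.FT.sm.slice_x 0) fun j => ?_
    obtain ⟨C, _, hC⟩ := hV.FT.bound 0 j (γ - j)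
    exact ⟨C, fun x => by simpa [pd] using hC x 0⟩
  have hE := sm_osc hθ.smooth' c
  have hQ : Rapid (osc (-c) φ * FT G) := hG.FT.osc_mul hθ _
  have hR := hV0.add ((hQ.prim hθ).smul Complex.I)
  obtain ⟨P, hP⟩ : ∃ P, P = osc c φ * ((fun ξ (_ : ℝ) => FT V ξ 0)
    + Complex.I • prim θ (osc (-c) φ * FT G)) := ⟨_, rfl⟩
  have hPr : Rapid P := hP ▸ hR.osc_mul hθ c
  have hPt : ∀ ξ t, Dt P ξ t = Complex.I * θ t * (c * ξ ^ 2 * P ξ t + FT G ξ t) := by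
    intro ξ t
    have h1 : Dt ((fun ξ (_ : ℝ) => FT V ξ 0) + Complex.I • prim θ (osc (-c) φ * FT G)) ξ t
        = Complex.I * (θ t * (osc (-c) φ ξ t * FT G ξ t)) := by
      have h2 := ((hasDerivAt_prim hθ hQ.sm ξ t).const_mul Complex.I).const_add (FT V ξ 0)
      exact h2.deriv
    rw [hP, dt_mul hE hR.sm, dt_osc hθ.deriv]
    simp only [Pi.add_apply, Pi.mul_apply] at h1 ⊢
    rw [h1]
    linear_combination (Complex.I * θ t * FT G ξ t) * osc_mul_osc_neg c φ ξ t
  have hF := hPr.FT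
  refine ⟨fun x t => FT P (-x) t, fun γ => (hF γ).neg_x, fun x => ?_, ?_⟩
  · have h1 : FT P (-x) 0 = FT (FT V) (-x) 0 := by
      rw [FT_eq, FT_eq]
      refine integral_congr_ae (Eventually.of_forall fun ξ => ?_)
      simp [hP, osc, hθ.zero, prim]
    beta_reduce
    rw [h1, hV.FT_FT]
  · have h2 : Dx (Dx fun x t => FT P (-x) t) = fun x t => FT (mX (mX P)) (-x) t := by
      have hd : ∀ v, Rapid v → Dx (FT v) = FT (mX v) := fun v hv => by
        ext x t
        exact (hv.hasDerivAt_FT_x x t).deriv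
      rw [dx_neg_x]
      ext x t
      have h3 := congrFun (congrFun (dx_neg_x (Dx (FT P))) x) t
      have h4 : Dx (fun x t => -Dx (FT P) (-x) t) x t = -Dx (fun x t => Dx (FT P) (-x) t) x t := by
        simp [Dx, deriv.fun_neg]
      rw [h4, h3, neg_neg, hd P hPr, hd _ hPr.mX]
    ext x t
    have h5 : Dt (fun x t => FT P (-x) t) x t = FT (Dt P) (-x) t :=
      (hPr.hasDerivAt_FT_t (-x) t).deriv
    have h6 : FT (Dt P) (-x) t = Complex.I * θ t * (FT (mX (mX P)) (-x) t + FT (FT G) (-x) t) := by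
      have i1 : Integrable fun ξ => ker (-x) ξ * mX (mX P) ξ t :=
        (hPr.mX.mX.integrable t).bdd_mul (c := 1) (continuous_ker.comp
          (by fun_prop : Continuous fun y : ℝ => (-x, y))).aestronglyMeasurable
          (Eventually.of_forall fun ξ => (norm_ker _ _).le)
      have i2 : Integrable fun ξ => ker (-x) ξ * FT G ξ t :=
        (hG.FT.integrable t).bdd_mul (c := 1) (continuous_ker.comp
          (by fun_prop : Continuous fun y : ℝ => (-x, y))).aestronglyMeasurable
          (Eventually.of_forall fun ξ => (norm_ker _ _).le)
      rw [FT_eq, FT_eq, FT_eq, ← integral_add i1 i2, ← integral_const_mul]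
      refine integral_congr_ae (Eventually.of_forall fun ξ => ?_)
      simp only [hPt, mX, hc]
      push_cast
      linear_combination (-4 * Real.pi ^ 2 * ξ ^ 2 * P ξ t * ker (-x) ξ * Complex.I * θ t)
        * Complex.I_sq
    rw [h5, h6, hG.FT_FT, h2]
    simp only [Pi.smul_apply, Pi.mul_apply, Pi.add_apply, smul_eq_mul]
    ring

end NLS

namespace NLS

open Filter Topology
open scoped ContDiff

/-! ### Sobolev norms of rapidly decreasing functions -/

open MeasureTheory

variable {u v : ℝ → ℝ → ℂ} {τ : ℝ} {θ φ : ℝ → ℝ}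

/-- The `L²` norm in the space variable. -/
def L2 (u : ℝ → ℝ → ℂ) (t : ℝ) : ℝ := lpNorm (fun x => u x t) 2 volume

/-- The (non-Hilbertian) `H¹` norm in the space variable. -/
def H1 (u : ℝ → ℝ → ℂ) (t : ℝ) : ℝ := L2 u t + L2 (Dx u) t

theorem H1_eq (u : ℝ → ℝ → ℂ) (t : ℝ) : H1 u t = L2 u t + L2 (Dx u) t := rfl

theorem L2_nonneg (u : ℝ → ℝ → ℂ) (t : ℝ) : 0 ≤ L2 u t := lpNorm_nonneg

theorem H1_nonneg (u : ℝ → ℝ → ℂ) (t : ℝ) : 0 ≤ H1 u t := add_nonneg (L2_nonneg _ _) (L2_nonneg _ _)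

theorem Rapid.memLp (hu : Rapid u) (t : ℝ) : MemLp (fun x => u x t) 2 := by
  rw [memLp_two_iff_integrable_sq_norm (hu.sm.slice_x t).continuous.aestronglyMeasurable]
  have := ((hu.mul hu.star).integrable t).norm
  simpa [pow_two] using! this

theorem Rapid.L2_sq (hu : Rapid u) (t : ℝ) : L2 u t ^ 2 = ∫ x, ‖u x t‖ ^ 2 := by
  rw [L2, lpNorm_eq_integral_norm_rpow_toReal (by simp) (by simp)
    (hu.sm.slice_x t).continuous.aestronglyMeasurable, ← Real.rpow_natCast, ← Real.rpow_mul
    (integral_nonneg fun x => by positivity)]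
  simp

theorem Rapid.integral_norm_mul_le (hu : Rapid u) (hv : Rapid v) (t : ℝ) :
    ∫ x, ‖u x t‖ * ‖v x t‖ ≤ L2 u t * L2 v t := by
  have h := integral_mul_norm_le_Lp_mul_Lq (μ := volume) (f := fun x => u x t)
    (g := fun x => v x t) Real.HolderConjugate.two_two
    (by simpa using hu.memLp t) (by simpa using hv.memLp t)
  have key : ∀ {w : ℝ → ℝ → ℂ}, Rapid w →
      (∫ x, ‖w x t‖ ^ (2 : ℝ)) ^ (1 / (2 : ℝ)) = L2 w t := fun {w} hw => by
    rw [L2, lpNorm_eq_integral_norm_rpow_toReal (by simp) (by simp)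
      (hw.sm.slice_x t).continuous.aestronglyMeasurable]
    simp
  rwa [key hu, key hv] at h

theorem Rapid.L2_add_le (hu : Rapid u) (t : ℝ) : L2 (u + v) t ≤ L2 u t + L2 v t :=
  lpNorm_add_le (hu.memLp t) (by norm_num)

theorem Rapid.L2_le (hv : Rapid v) {c t : ℝ} (h : ∀ x, ‖u x t‖ ≤ c * ‖v x t‖) (hc : 0 ≤ c) :
    L2 u t ≤ c * L2 v t := by
  have h1 : MemLp (fun x => c * ‖v x t‖) 2 := (hv.memLp t).norm.const_mul c
  refine (lpNorm_mono_real h1 h).trans_eq ?_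
  have := lpNorm_const_smul (p := 2) c (fun x => ‖v x t‖) volume
  rw [lpNorm_norm (hv.memLp t).aestronglyMeasurable, coe_nnnorm, Real.norm_of_nonneg hc] at this
  exact this

theorem L2_smul (c : ℂ) (u : ℝ → ℝ → ℂ) (t : ℝ) : L2 (c • u) t = ‖c‖ * L2 u t :=
  lpNorm_const_smul c (fun x => u x t) volume

theorem L2_star (u : ℝ → ℝ → ℂ) (t : ℝ) : L2 (star u) t = L2 u t :=
  lpNorm_conj (fun x => u x t) 2 volume

theorem dx_smul (c : ℂ) (u : ℝ → ℝ → ℂ) : Dx (c • u) = c • Dx u := by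
  ext x t
  simp [Dx, deriv_const_mul_field]

theorem H1_smul (c : ℂ) (u : ℝ → ℝ → ℂ) (t : ℝ) : H1 (c • u) t = ‖c‖ * H1 u t := by
  rw [H1, H1, dx_smul, L2_smul, L2_smul, mul_add]

theorem Rapid.H1_star (hu : Rapid u) (t : ℝ) : H1 (Star.star u) t = H1 u t := by
  rw [H1, H1, dx_star hu.sm, L2_star, L2_star]

theorem Rapid.H1_add_le (hu : Rapid u) (hv : Rapid v) (t : ℝ) : H1 (u + v) t ≤ H1 u t + H1 v t := by
  rw [H1, H1, H1, dx_add hu.sm hv.sm]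
  linarith [hu.L2_add_le (v := v) t, hu.dx.L2_add_le (v := Dx v) t]

theorem Rapid.sum {ι : Type*} {s : Finset ι} {w : ι → ℝ → ℝ → ℂ} (h : ∀ k ∈ s, Rapid (w k)) :
    Rapid (∑ k ∈ s, w k) := fun γ => Sym.sum fun k hk => h k hk γ

theorem H1_sum_le {ι : Type*} {s : Finset ι} {w : ι → ℝ → ℝ → ℂ} (h : ∀ k ∈ s, Rapid (w k))
    (t : ℝ) : H1 (∑ k ∈ s, w k) t ≤ ∑ k ∈ s, H1 (w k) t := by
  classical
  induction s using Finset.induction_on with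
  | empty =>
    have h0 : L2 0 t = 0 := lpNorm_zero 2 volume
    have h1 : Dx 0 = 0 := by ext x s; simp [Dx]
    simp [H1, h0, h1]
  | insert k s hk ih =>
    rw [Finset.sum_insert hk, Finset.sum_insert hk]
    have hs : ∀ j ∈ s, Rapid (w j) := fun j hj => h j (Finset.mem_insert_of_mem hj)
    linarith [(h k (Finset.mem_insert_self k s)).H1_add_le (Rapid.sum hs) t, ih hs]

theorem Rapid.tendsto_atBot (hu : Rapid u) (t : ℝ) : Tendsto (fun x => u x t) atBot (𝓝 0) := by
  obtain ⟨C, hC0, hC⟩ := hu.bound 0 0 (-1)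
  rw [pd_zero_zero] at hC
  have h2 : Tendsto (fun x : ℝ => C * |x|⁻¹) atBot (𝓝 0) := by
    simpa using (tendsto_inv_atTop_zero.comp tendsto_abs_atBot_atTop).const_mul C
  refine squeeze_zero_norm' ?_ h2
  filter_upwards [eventually_le_atBot (-1)] with x hx
  refine (hC x t).trans ?_
  rw [Real.rpow_neg_one]
  have : 0 < |x| := abs_pos.2 (by linarith)
  gcongr
  exact abs_le_jb x

theorem Rapid.integral_dx (hu : Rapid u) (t : ℝ) : ∫ x, Dx u x t = 0 :=
  integral_eq_zero_of_hasDerivAt_of_integrable (fun x => hu.sm.hasDerivAt_x x t)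
    (hu.dx.integrable t) (hu.integrable t)

theorem Rapid.norm_le_H1 (hu : Rapid u) (x t : ℝ) : ‖u x t‖ ≤ H1 u t := by
  have hq := hu.mul hu.star
  have h1 := integral_Iic_of_hasDerivAt_of_tendsto' (a := x) (fun y _ => hq.sm.hasDerivAt_x y t)
    (hq.dx.integrable t).integrableOn (hq.tendsto_atBot t)
  have h2 : ‖u x t‖ ^ 2 ≤ 2 * (L2 u t * L2 (Dx u) t) := by
    have h3 : ‖u x t‖ ^ 2 = ‖(u * Star.star u) x t‖ := by simp [pow_two]
    rw [h3, ← sub_zero ((u * Star.star u) x t), ← h1]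
    calc _ ≤ ∫ y in Set.Iic x, ‖Dx (u * Star.star u) y t‖ := norm_integral_le_integral_norm _
      _ ≤ ∫ y, ‖Dx (u * Star.star u) y t‖ := setIntegral_le_integral (hq.dx.integrable t).norm
          (Eventually.of_forall fun y => norm_nonneg _)
      _ ≤ ∫ y, 2 * (‖u y t‖ * ‖Dx u y t‖) := by
          refine integral_mono (hq.dx.integrable t).norm ?_ fun y => ?_
          · have := ((hu.mul hu.dx).integrable t).norm.const_mul 2
            simpa using! this
          · rw [dx_mul hu.sm hu.sm.star, dx_star hu.sm]
            refine (norm_add_le _ _).trans_eq ?_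
            simp
            ring
      _ ≤ _ := by
          rw [integral_const_mul]
          gcongr
          exact hu.integral_norm_mul_le hu.dx t
  have h4 := L2_nonneg u t
  have h5 := L2_nonneg (Dx u) t
  rw [H1]
  refine abs_le_of_sq_le_sq' ?_ (by positivity) |>.2
  nlinarith [sq_nonneg (L2 u t), sq_nonneg (L2 (Dx u) t)]

theorem Rapid.H1_mul_sym_le (hu : Rapid u) (hv : Sym 0 v) {A B t : ℝ}
    (hA : ∀ x, ‖v x t‖ ≤ A) (hB : ∀ x, ‖Dx v x t‖ ≤ B) : H1 (u * v) t ≤ (A + B) * H1 u t := by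
  have hA0 : 0 ≤ A := (norm_nonneg _).trans (hA 0)
  have hB0 : 0 ≤ B := (norm_nonneg _).trans (hB 0)
  have h1 : L2 (u * v) t ≤ A * L2 u t := hu.L2_le (fun x => by
    simp only [Pi.mul_apply, norm_mul]; rw [mul_comm]; gcongr; exact hA x) hA0
  have h2 : L2 (Dx u * v) t ≤ A * L2 (Dx u) t := hu.dx.L2_le (fun x => by
    simp only [Pi.mul_apply, norm_mul]; rw [mul_comm]; gcongr; exact hA x) hA0
  have h3 : L2 (u * Dx v) t ≤ B * L2 u t := hu.L2_le (fun x => by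
    simp only [Pi.mul_apply, norm_mul]; rw [mul_comm]; gcongr; exact hB x) hB0
  rw [H1, H1, dx_mul hu.sm hv.1]
  have h4 := (hu.dx.mul_sym hv).L2_add_le (v := u * Dx v) t
  nlinarith [mul_nonneg hB0 (L2_nonneg (Dx u) t)]

theorem Rapid.H1_mul_le (hu : Rapid u) (hv : Rapid v) (t : ℝ) :
    H1 (u * v) t ≤ 2 * (H1 u t * H1 v t) := by
  have h1 : L2 (u * v) t ≤ H1 v t * L2 u t := hu.L2_le (fun x => by
    simp only [Pi.mul_apply, norm_mul]; rw [mul_comm]; gcongr; exact hv.norm_le_H1 x t)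
    (H1_nonneg v t)
  have h2 : L2 (Dx u * v) t ≤ H1 v t * L2 (Dx u) t := hu.dx.L2_le (fun x => by
    simp only [Pi.mul_apply, norm_mul]; rw [mul_comm]; gcongr; exact hv.norm_le_H1 x t)
    (H1_nonneg v t)
  have h3 : L2 (u * Dx v) t ≤ H1 u t * L2 (Dx v) t := hv.dx.L2_le (fun x => by
    simp only [Pi.mul_apply, norm_mul]; gcongr; exact hu.norm_le_H1 x t) (H1_nonneg u t)
  rw [H1, dx_mul hu.sm hv.sm]
  have h4 := (hu.dx.mul hv).L2_add_le (v := u * Dx v) t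
  have h5 : H1 u t = L2 u t + L2 (Dx u) t := rfl
  have h6 : H1 v t = L2 v t + L2 (Dx v) t := rfl
  have h7 := mul_nonneg (H1_nonneg u t) (L2_nonneg v t)
  calc _ ≤ H1 v t * L2 u t + (H1 v t * L2 (Dx u) t + H1 u t * L2 (Dx v) t) := by linarith
    _ = H1 v t * H1 u t + H1 u t * L2 (Dx v) t := by rw [h5]; ring
    _ ≤ H1 v t * H1 u t + H1 u t * H1 v t := by rw [h6]; linarith
    _ = _ := by ring

theorem Rapid.exists_L2_le (hu : Rapid u) : ∃ C, ∀ t, L2 u t ≤ C := by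
  obtain ⟨C, hC0, hC⟩ := hu.bound 0 0 (-1)
  rw [pd_zero_zero] at hC
  refine ⟨Real.sqrt (∫ x, C ^ 2 * jb x ^ (-2 : ℝ)), fun t => Real.le_sqrt_of_sq_le ?_⟩
  rw [hu.L2_sq]
  refine integral_mono ((memLp_two_iff_integrable_sq_norm
    (hu.sm.slice_x t).continuous.aestronglyMeasurable).1 (hu.memLp t))
    (integrable_jb.const_mul _) fun x => ?_
  have h2 : jb x ^ (-2 : ℝ) = (jb x ^ (-1 : ℝ)) ^ 2 := by
    rw [← Real.rpow_natCast, ← Real.rpow_mul (jb_pos x).le]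
    norm_num
  rw [h2, ← mul_pow]
  exact pow_le_pow_left₀ (norm_nonneg _) (hC x t) 2

theorem Rapid.exists_H1_le (hu : Rapid u) : ∃ C, ∀ t, H1 u t ≤ C := by
  obtain ⟨C, hC⟩ := hu.exists_L2_le
  obtain ⟨C', hC'⟩ := hu.dx.exists_L2_le
  exact ⟨C + C', fun t => add_le_add (hC t) (hC' t)⟩

theorem Rapid.L2_energy (hθ : IsClock τ θ φ) {f H : ℝ → ℝ → ℂ} (hf : Rapid f) (hH : Rapid H)
    (heq : Dt f = Complex.I • ((fun _ t => (θ t : ℂ)) * (Dx (Dx f) + H))) {K : ℝ}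
    (hK : ∀ t, L2 H t ≤ K) (t : ℝ) : L2 f t ≤ L2 f 0 + τ * K := by
  have hK0 : 0 ≤ K := (L2_nonneg H 0).trans (hK 0)
  have hq := hf.mul hf.star
  have hS : ∀ s, L2 f s ^ 2 = (∫ x, (f * Star.star f) x s).re := fun s => by
    have : ∀ x, (f * Star.star f) x s = ((‖f x s‖ ^ 2 : ℝ) : ℂ) := fun x => by
      simp [Complex.mul_conj, Complex.normSq_eq_norm_sq]
    simp_rw [this]
    rw [integral_complex_ofReal, Complex.ofReal_re, hf.L2_sq]
  have hD : ∀ s, HasDerivAt (fun s => ∫ x, (f * Star.star f) x s)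
      (∫ x, Dt (f * Star.star f) x s) s := fun s => by
    have := hq.hasDerivAt_integral (K := fun _ => 1) continuous_const (by simp) s
    simpa using this
  have hbound : ∀ s, ‖∫ x, Dt (f * Star.star f) x s‖ ≤ 2 * (θ s * (K * L2 f s)) := fun s => by
    have hA := hf.star.mul hf.dx
    have hB := hf.mul hf.dx.star
    have hAB := (hA.sub hB)
    have hR1 := hf.star.mul hH
    have hR2 := hf.mul hH.star
    have e1 : ∀ x, Dt (f * Star.star f) x s = Complex.I * θ s *
        (Dx (Star.star f * Dx f - f * Star.star (Dx f)) x s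
          + ((Star.star f * H) x s - (f * Star.star H) x s)) := fun x => by
      rw [dt_mul hf.sm hf.sm.star, dt_star hf.sm, heq, dx_sub hA.sm hB.sm,
        dx_mul hf.sm.star hf.dx.sm, dx_mul hf.sm hf.dx.sm.star, dx_star hf.sm, dx_star hf.dx.sm]
      simp
      ring
    have hR : Integrable fun x => (Star.star f * H) x s - (f * Star.star H) x s :=
      (hR1.sub hR2).integrable s
    simp_rw [e1]
    rw [integral_const_mul, integral_add (hAB.dx.integrable s) hR, hAB.integral_dx, zero_add, norm_mul, norm_mul,
      Complex.norm_I, one_mul, Complex.norm_real, Real.norm_of_nonneg (hθ.nonneg s)]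
    have hle : ‖∫ x, ((Star.star f * H) x s - (f * Star.star H) x s)‖ ≤
        ∫ x, 2 * (‖f x s‖ * ‖H x s‖) := by
      refine norm_integral_le_of_norm_le ?_ (Eventually.of_forall fun x => ?_)
      · have := ((hf.mul hH).integrable s).norm.const_mul 2
        simpa using! this
      · refine (norm_sub_le _ _).trans_eq ?_
        simp
        ring
    rw [integral_const_mul] at hle
    have h5 := hf.integral_norm_mul_le hH s
    have h6 : ‖∫ x, ((Star.star f * H) x s - (f * Star.star H) x s)‖ ≤ 2 * (K * L2 f s) := by
      nlinarith [mul_le_mul_of_nonneg_left (hK s) (L2_nonneg f s)]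
    nlinarith [mul_le_mul_of_nonneg_left h6 (hθ.nonneg s)]
  have key : ∀ ε > 0, L2 f t ≤ L2 f 0 + ε + τ * K := fun ε hε => by
    have hpos : ∀ s, 0 < L2 f s ^ 2 + ε ^ 2 := fun s => by positivity
    have hg : ∀ s, HasDerivAt (fun s => Real.sqrt (L2 f s ^ 2 + ε ^ 2))
        ((∫ x, Dt (f * Star.star f) x s).re / (2 * Real.sqrt (L2 f s ^ 2 + ε ^ 2))) s :=
      fun s => by
        have h1 : HasDerivAt (fun s => L2 f s ^ 2 + ε ^ 2)
            (∫ x, Dt (f * Star.star f) x s).re s := by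
          simp_rw [hS]
          exact (Complex.reCLM.hasFDerivAt.comp_hasDerivAt s (hD s)).add_const _
        exact h1.sqrt (hpos s).ne'
    have hder : ∀ s, |(∫ x, Dt (f * Star.star f) x s).re / (2 * Real.sqrt (L2 f s ^ 2 + ε ^ 2))|
        ≤ K * θ s := fun s => by
      have h2 : 0 < Real.sqrt (L2 f s ^ 2 + ε ^ 2) := Real.sqrt_pos.2 (hpos s)
      rw [abs_div, abs_of_pos (by positivity : 0 < 2 * Real.sqrt (L2 f s ^ 2 + ε ^ 2)),
        div_le_iff₀ (by positivity)]
      refine ((Complex.abs_re_le_norm _).trans (hbound s)).trans ?_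
      have h3 : L2 f s ≤ Real.sqrt (L2 f s ^ 2 + ε ^ 2) :=
        Real.le_sqrt_of_sq_le (by nlinarith [sq_nonneg ε])
      have := mul_le_mul_of_nonneg_left h3 (mul_nonneg hK0 (hθ.nonneg s))
      nlinarith
    have h0 : Real.sqrt (L2 f 0 ^ 2 + ε ^ 2) ≤ L2 f 0 + ε :=
      Real.sqrt_le_iff.2 ⟨by linarith [L2_nonneg f 0], by nlinarith [L2_nonneg f 0]⟩
    have h1 : L2 f t ≤ Real.sqrt (L2 f t ^ 2 + ε ^ 2) :=
      Real.le_sqrt_of_sq_le (by nlinarith [sq_nonneg ε])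
    have hφ := abs_le.1 (hθ.abs_le t)
    rcases le_total 0 t with ht | ht
    · have hm : Antitone (fun s => Real.sqrt (L2 f s ^ 2 + ε ^ 2) - K * φ s) :=
        antitone_of_hasDerivAt_nonpos (fun s => (hg s).sub ((hθ.deriv s).const_mul K))
          fun s => by simpa using (abs_le.1 (hder s)).2
      have := hm ht
      simp only [hθ.zero] at this
      nlinarith
    · have hm : Monotone (fun s => Real.sqrt (L2 f s ^ 2 + ε ^ 2) + K * φ s) :=
        monotone_of_hasDerivAt_nonneg (fun s => (hg s).add ((hθ.deriv s).const_mul K))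
          fun s => by
            have := (abs_le.1 (hder s)).1
            simp only [Pi.zero_apply]
            linarith
      have := hm ht
      simp only [hθ.zero] at this
      nlinarith
  exact le_of_forall_pos_le_add fun ε hε => by linarith [key ε hε]

theorem schrodinger_dx (hθ : IsClock τ θ φ) {f H : ℝ → ℝ → ℂ} (hf : Sm f) (hH : Sm H)
    (heq : Dt f = Complex.I • ((fun _ t => (θ t : ℂ)) * (Dx (Dx f) + H))) :
    Dt (Dx f) = Complex.I • ((fun _ t => (θ t : ℂ)) * (Dx (Dx (Dx f)) + Dx H)) := by
  rw [← hf.dx_dt, heq, dx_smul, dx_mul hθ.sm (hf.dx.dx.add hH), dx_add hf.dx.dx hH]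
  have : Dx (fun _ t => (θ t : ℂ)) = 0 := by ext x t; simp [Dx]
  rw [this, zero_mul, zero_add]

theorem Rapid.H1_energy (hθ : IsClock τ θ φ) {f H : ℝ → ℝ → ℂ} (hf : Rapid f) (hH : Rapid H)
    (heq : Dt f = Complex.I • ((fun _ t => (θ t : ℂ)) * (Dx (Dx f) + H))) {K : ℝ}
    (hK : ∀ t, H1 H t ≤ K) (t : ℝ) : H1 f t ≤ H1 f 0 + 2 * τ * K := by
  have h1 := hf.L2_energy hθ hH heq (K := K) (fun t => by
    linarith [hK t, L2_nonneg (Dx H) t, H1_eq H t]) t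
  have h2 := hf.dx.L2_energy hθ hH.dx (K := K) (schrodinger_dx hθ hf.sm hH.sm heq)
    (fun t => by
    linarith [hK t, L2_nonneg H t, H1_eq H t]) t
  rw [H1, H1]
  linarith

end NLS

namespace NLS

open Filter Topology
open scoped ContDiff

/-! ### Weighted families of norms -/

/-- A rapidly increasing sequence of weights. -/
structure IsWeight (m : ℕ → ℝ) : Prop where
  one_le : ∀ n, 1 ≤ m n
  mono : Monotone m
  sq_mul_le : ∀ n : ℕ, 4 * ((n : ℝ) + 1) ^ 2 * m n ≤ m (n + 1)
  two_pow_mul_le : ∀ n : ℕ, 2 ^ (n + 1) * m n ^ 2 ≤ m (n + 1)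
  zero : m 0 = 1

theorem exists_weight (D : ℕ → ℝ) (hD : ∀ n, 0 ≤ D n) :
    ∃ m, IsWeight m ∧ ∀ n, D n ≤ (1 + D 0) * m n := by
  let m : ℕ → ℝ := fun n => Nat.rec 1
    (fun n r => D (n + 1) + (4 * ((n : ℝ) + 1) ^ 2 + 2 ^ (n + 1)) * r ^ 2) n
  have hs : ∀ n, m (n + 1) = D (n + 1) + (4 * ((n : ℝ) + 1) ^ 2 + 2 ^ (n + 1)) * m n ^ 2 :=
    fun n => rfl
  have h1 : ∀ n, 1 ≤ m n := fun n => by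
    induction n with
    | zero => exact le_rfl
    | succ n ih =>
      rw [hs]
      have h2 : (1 : ℝ) ≤ m n ^ 2 := one_le_pow₀ ih
      have h3 : (1 : ℝ) ≤ 2 ^ (n + 1) := one_le_pow₀ (by norm_num)
      nlinarith [hD (n + 1), sq_nonneg ((n : ℝ) + 1), mul_nonneg (sq_nonneg ((n : ℝ) + 1))
        (sq_nonneg (m n))]
  have h2 : ∀ n, m n ≤ m n ^ 2 := fun n => by nlinarith [h1 n]
  have h4 : ∀ n : ℕ, (0 : ℝ) ≤ 4 * ((n : ℝ) + 1) ^ 2 * m n ^ 2 := fun n => by positivity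
  have h5 : ∀ n : ℕ, (1 : ℝ) ≤ 2 ^ (n + 1) := fun n => one_le_pow₀ (by norm_num)
  refine ⟨m, ⟨h1, monotone_nat_of_le_succ fun n => ?_, fun n => ?_, fun n => ?_, rfl⟩, fun n => ?_⟩
  · rw [hs]
    nlinarith [hD (n + 1), h4 n, h5 n, h2 n, sq_nonneg (m n)]
  · rw [hs]
    have h6 : (0 : ℝ) ≤ 2 ^ (n + 1) * m n ^ 2 := by positivity
    have h7 : 4 * ((n : ℝ) + 1) ^ 2 * m n ≤ 4 * ((n : ℝ) + 1) ^ 2 * m n ^ 2 := by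
      gcongr; exact h2 n
    linarith [hD (n + 1)]
  · rw [hs]
    linarith [hD (n + 1), h4 n]
  · rcases n with _ | n
    · have : m 0 = 1 := rfl
      rw [this]
      linarith
    · have h6 : D (n + 1) ≤ m (n + 1) := by
        rw [hs]
        have : (0 : ℝ) ≤ (4 * ((n : ℝ) + 1) ^ 2 + 2 ^ (n + 1)) * m n ^ 2 := by positivity
        linarith
      nlinarith [hD 0, h1 (n + 1)]

variable {m : ℕ → ℝ}

theorem IsWeight.pos (hm : IsWeight m) (n : ℕ) : 0 < m n := one_pos.trans_le (hm.one_le n)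

theorem IsWeight.conv (hm : IsWeight m) {n b : ℕ} (hb : b ≤ n) :
    ∑ i ∈ Finset.range (b + 1), (b.choose i : ℝ) * m i * m (n - i) ≤ 3 * m n := by
  rcases n with _ | n
  · obtain rfl : b = 0 := by omega
    simp [hm.zero]
  have hterm : ∀ i ∈ Finset.range (b + 1), (b.choose i : ℝ) * m i * m (n + 1 - i) ≤
      b.choose i * m n ^ 2 + ((if i = 0 then m (n + 1) else 0)
        + (if i = n + 1 then m (n + 1) else 0)) := fun i hi => by
    have hi : i ≤ b := by simpa [Nat.lt_succ_iff] using hi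
    have h0 : (0 : ℝ) ≤ b.choose i * m n ^ 2 := by positivity
    rcases eq_or_ne i 0 with rfl | hi0
    · simp [hm.zero]
      positivity
    rcases eq_or_ne i (n + 1) with rfl | hi1
    · obtain rfl : b = n + 1 := le_antisymm hb hi
      simp [hm.zero]
      positivity
    · rw [if_neg hi0, if_neg hi1, add_zero, add_zero, mul_assoc]
      have h1 : m i ≤ m n := hm.mono (by omega)
      have h2 : m (n + 1 - i) ≤ m n := hm.mono (by omega)
      have := hm.pos i
      have := hm.pos n
      have := hm.pos (n + 1 - i)
      rw [pow_two]
      gcongr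
  refine (Finset.sum_le_sum hterm).trans ?_
  rw [Finset.sum_add_distrib, Finset.sum_add_distrib, ← Finset.sum_mul]
  have h1 : ∑ i ∈ Finset.range (b + 1), (b.choose i : ℝ) = 2 ^ b := by
    exact_mod_cast Nat.sum_range_choose b
  have h2 : (2 : ℝ) ^ b ≤ 2 ^ (n + 1) := pow_le_pow_right₀ (by norm_num) hb
  have h3 : ∀ k, ∑ i ∈ Finset.range (b + 1), (if i = k then m (n + 1) else 0) ≤ m (n + 1) :=
    fun k => by
      rw [Finset.sum_ite_eq']
      split_ifs
      · exact le_rfl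
      · exact (hm.pos _).le
  rw [h1]
  nlinarith [h3 0, h3 (n + 1), hm.two_pow_mul_le n, mul_le_mul_of_nonneg_right h2 (sq_nonneg (m n))]

/-- The monomial `x ^ a`. -/
def xp (a : ℕ) : ℝ → ℝ → ℂ := fun x _ => (x : ℂ) ^ a

theorem xp_zero : xp 0 = 1 := by ext x t; simp [xp]

theorem sym_xp (a : ℕ) : Sym a (xp a) := by
  induction a with
  | zero =>
    have : xp 0 = fun _ _ => (1 : ℂ) := by ext x t; simp [xp]
    rw [this]
    simpa using Sym.const 1
  | succ a ih =>
    have : xp (a + 1) = xp a * fun (x _ : ℝ) => (x : ℂ) := by ext x t; simp [xp, pow_succ]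
    rw [this]
    push_cast
    exact ih.mul Sym.id

theorem star_xp (a : ℕ) : star (xp a) = xp a := by ext x t; simp [xp]

theorem dx_xp (a : ℕ) : Dx (xp a) = (a : ℂ) • xp (a - 1) := by
  ext x t
  have h := ((hasDerivAt_id x).ofReal_comp.pow a).deriv
  simp only [Dx, xp]
  refine h.trans ?_
  simp [xp]

theorem dt_xp (a : ℕ) : Dt (xp a) = 0 := by
  ext x t
  simp [Dt, xp]

variable {u v : ℝ → ℝ → ℂ} {R R' : ℝ}

theorem dx_dx_xp_mul (hu : Sm u) (a : ℕ) : Dx (Dx (xp a * u)) = xp a * Dx (Dx u)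
    + (2 * a : ℂ) • (xp (a - 1) * Dx u) + (a * (a - 1) : ℂ) • (xp (a - 2) * u) := by
  have h1 : Dx (xp a * u) = (a : ℂ) • (xp (a - 1) * u) + xp a * Dx u := by
    rw [dx_mul (sym_xp a).1 hu, dx_xp, smul_mul_assoc]
  have h2 : Dx (xp (a - 1) * u) = ((a : ℂ) - 1) • (xp (a - 2) * u) + xp (a - 1) * Dx u ∨ a = 0 := by
    rcases a with _ | a
    · exact Or.inr rfl
    · left
      rw [dx_mul (sym_xp _).1 hu, dx_xp, smul_mul_assoc]
      simp
  rw [h1, dx_add (((sym_xp _).1.mul hu).smul _) ((sym_xp _).1.mul hu.dx), dx_smul,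
    dx_mul (sym_xp a).1 hu.dx, dx_xp]
  rcases h2 with h2 | rfl
  · rw [h2]
    ext x t
    simp
    ring
  · simp

/-- Weighted bounds on all the `H¹` norms of `x ^ a ∂_x ^ b u`. -/
def Bd (m : ℕ → ℝ) (R : ℝ) (u : ℝ → ℝ → ℂ) : Prop :=
  ∀ a b t, H1 (xp a * pd u 0 b) t ≤ R * m (2 * a + b)

/-- Weighted bounds on the multiplication by the derivatives of `u`. -/
def MB (m : ℕ → ℝ) (R : ℝ) (u : ℝ → ℝ → ℂ) : Prop :=
  ∀ b t f, Rapid f → H1 (f * pd u 0 b) t ≤ R * m b * H1 f t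

theorem Bd.mono (hm : IsWeight m) (h : Bd m R u) (hR : R ≤ R') : Bd m R' u := fun a b t =>
  (h a b t).trans (mul_le_mul_of_nonneg_right hR (hm.pos _).le)

theorem MB.mono (hm : IsWeight m) (h : MB m R u) (hR : R ≤ R') : MB m R' u := fun b t f hf =>
  (h b t f hf).trans (mul_le_mul_of_nonneg_right (mul_le_mul_of_nonneg_right hR (hm.pos _).le)
    (H1_nonneg _ _))

theorem Rapid.xp_mul (hu : Rapid u) (a b : ℕ) : Rapid (xp a * _root_.pd u 0 b) :=
  Rapid.sym_mul (sym_xp a) (hu.pd 0 b)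

theorem Bd.add (hu : Rapid u) (hv : Rapid v) (h : Bd m R u) (h' : Bd m R' v) :
    Bd m (R + R') (u + v) := fun a b t => by
  rw [pd_add hu.sm hv.sm, mul_add, add_mul]
  exact ((hu.xp_mul a b).H1_add_le (hv.xp_mul a b) t).trans (add_le_add (h a b t) (h' a b t))

theorem pd_smul (u : ℝ → ℝ → ℂ) (c : ℂ) (i j : ℕ) : pd (c • u) i j = c • pd u i j := by
  induction i with
  | zero =>
    induction j with
    | zero => rw [pd_zero_zero, pd_zero_zero]
    | succ j ih => rw [pd_zero_succ, ih, dx_smul, pd_zero_succ]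
  | succ i ih =>
    rw [pd_succ_left, pd_succ_left, ih]
    ext x t
    simp [Dt, deriv_const_mul_field]

theorem Bd.smul (h : Bd m R u) {c : ℂ} (hc : ‖c‖ ≤ 1) : Bd m R (c • u) :=
  fun a b t => by
    rw [pd_smul, mul_smul_comm, H1_smul]
    exact (mul_le_of_le_one_left (H1_nonneg _ _) hc).trans (h a b t)

theorem Bd.zero (hm : IsWeight m) (hR : 0 ≤ R) : Bd m R 0 := fun a b t => by
  have h : xp a * pd 0 0 b = (0 : ℂ) • xp a := by ext x s; simp [pd_zero]
  rw [h, H1_smul, norm_zero, zero_mul]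
  exact mul_nonneg hR (hm.pos _).le

theorem Bd.star (hu : Rapid u) (h : Bd m R u) : Bd m R (star u) := fun a b t => by
  rw [pd_star hu.sm, ← star_xp, mul_comm, ← star_mul, (hu.xp_mul a b).H1_star]
  exact h a b t

theorem Sym.pd_zero (hu : Sym 0 u) (b : ℕ) : Sym 0 (_root_.pd u 0 b) := by
  induction b with
  | zero => rwa [pd_zero_zero]
  | succ b ih => rw [pd_zero_succ]; exact ih.dx.mono (by norm_num)

theorem MB.add (hu : Sym 0 u) (hv : Sym 0 v) (h : MB m R u) (h' : MB m R' v) :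
    MB m (R + R') (u + v) := fun b t f hf => by
  have hu' : Rapid (f * pd u 0 b) := hf.mul_sym (hu.pd_zero b)
  have hv' : Rapid (f * pd v 0 b) := hf.mul_sym (hv.pd_zero b)
  rw [pd_add hu.1 hv.1, mul_add, add_mul, add_mul]
  exact (hu'.H1_add_le hv' t).trans (add_le_add (h b t f hf) (h' b t f hf))

theorem MB.star (hu : Sym 0 u) (h : MB m R u) : MB m R (star u) := fun b t f hf => by
  have hu' : Rapid (Star.star f * pd u 0 b) := hf.star.mul_sym (hu.pd_zero b)
  have h1 : f * pd (Star.star u) 0 b = Star.star (Star.star f * pd u 0 b) := by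
    rw [pd_star hu.1, star_mul, star_star, mul_comm]
  rw [h1, hu'.H1_star]
  simpa only [hf.H1_star] using h b t _ hf.star

theorem Bd.mb (hv : Rapid v) (h : Bd m R v) : MB m (2 * R) v :=
  fun b t f hf => by
    have h1 := h 0 b t
    rw [xp_zero, one_mul, mul_zero, zero_add] at h1
    refine (hf.H1_mul_le (hv.pd 0 b) t).trans ?_
    nlinarith [mul_le_mul_of_nonneg_left h1 (H1_nonneg f t)]

theorem Bd.mul (hm : IsWeight m) (hu : Rapid u) (hv : Sym 0 v) (h : Bd m R u) (h' : MB m R' v)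
    (hR : 0 ≤ R) (hR' : 0 ≤ R') : Bd m (3 * R * R') (u * v) := fun a b t => by
  have hr : ∀ q, Rapid (xp a * pd u 0 (b - q) * pd v 0 q) := fun q =>
    (hu.xp_mul a (b - q)).mul_sym (hv.pd_zero q)
  have h1 : xp a * pd (u * v) 0 b =
      ∑ q ∈ Finset.range (b + 1), (b.choose q : ℂ) • (xp a * pd u 0 (b - q) * pd v 0 q) := by
    rw [mul_comm u v, pd_zero_mul hv.1 hu.sm, Finset.mul_sum]
    refine Finset.sum_congr rfl fun q _ => ?_
    rw [mul_smul_comm]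
    congr 1
    ring
  rw [h1]
  refine (H1_sum_le (fun q _ => (hr q).smul _) t).trans ?_
  calc _ ≤ ∑ q ∈ Finset.range (b + 1),
        R * R' * ((b.choose q : ℝ) * m q * m (2 * a + b - q)) := by
        refine Finset.sum_le_sum fun q hq => ?_
        have hq : q ≤ b := by simpa [Nat.lt_succ_iff] using hq
        rw [H1_smul, Complex.norm_natCast, Nat.add_sub_assoc hq]
        have h2 := h' q t _ (hu.xp_mul a (b - q))
        have h3 := mul_le_mul_of_nonneg_left (h a (b - q) t) (mul_nonneg hR' (hm.pos q).le)
        calc _ ≤ (b.choose q : ℝ) * (R' * m q * (R * m (2 * a + (b - q)))) := by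
              gcongr
              exact h2.trans h3
          _ = _ := by ring
    _ ≤ R * R' * (3 * m (2 * a + b)) := by
        rw [← Finset.mul_sum]
        exact mul_le_mul_of_nonneg_left (hm.conv (by omega)) (mul_nonneg hR hR')
    _ = _ := by ring

theorem Bd.linear {τ : ℝ} {θ φ : ℝ → ℝ} (hm : IsWeight m) (hθ : IsClock τ θ φ) (hτ : τ ≤ 1 / 2)
    {V G : ℝ → ℝ → ℂ} (hu : Rapid u) (hG : Rapid G) (h0 : ∀ x, u x 0 = V x 0)
    (heq : Dt u = Complex.I • ((fun _ t => (θ t : ℂ)) * (Dx (Dx u) + G)))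
    (hR : 0 ≤ R) (hR' : 0 ≤ R') (hBV : Bd m R V) (hBG : Bd m R' G) :
    Bd m (2 * (R + 2 * τ * R')) u := by
  have hD : ∀ b, Dt (pd u 0 b) =
      Complex.I • ((fun _ t => (θ t : ℂ)) * (Dx (Dx (pd u 0 b)) + pd G 0 b)) := fun b => by
    induction b with
    | zero => rwa [pd_zero_zero, pd_zero_zero]
    | succ b ih =>
      rw [pd_zero_succ, pd_zero_succ]
      exact schrodinger_dx hθ (hu.sm.pd 0 b) (hG.sm.pd 0 b) ih
  have hM : 0 ≤ 2 * (R + 2 * τ * R') := by have := hθ.pos; positivity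
  have h00 : ∀ b x, pd u 0 b x 0 = pd V 0 b x 0 := fun b x => by
    simp only [pd, iteratedDeriv_zero]
    congr 1
    ext y
    exact h0 y
  intro a
  induction a using Nat.strong_induction_on with
  | _ a ih =>
  intro b t
  have hH1 := (hG.xp_mul a b)
  have hH2 := (hu.xp_mul (a - 1) (b + 1)).smul (2 * a : ℂ)
  have hH3 := (hu.xp_mul (a - 2) b).smul (a * (a - 1) : ℂ)
  have heq' : Dt (xp a * pd u 0 b) = Complex.I • ((fun _ t => (θ t : ℂ)) *
      (Dx (Dx (xp a * pd u 0 b)) + (xp a * pd G 0 b - (2 * a : ℂ) • (xp (a - 1) * pd u 0 (b + 1))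
        - (a * (a - 1) : ℂ) • (xp (a - 2) * pd u 0 b)))) := by
    rw [dt_mul (sym_xp a).1 (hu.sm.pd 0 b), dt_xp, hD, dx_dx_xp_mul (hu.sm.pd 0 b), pd_zero_succ]
    ext x s
    simp
    ring
  have h_start : H1 (xp a * pd u 0 b) 0 ≤ R * m (2 * a + b) := by
    have h1 : H1 (xp a * pd u 0 b) 0 = H1 (xp a * pd V 0 b) 0 := by
      have h2 : (fun x => (xp a * pd u 0 b) x 0) = fun x => (xp a * pd V 0 b) x 0 := by
        ext x
        simp [h00]
      have h3 : (fun x => Dx (xp a * pd u 0 b) x 0) = fun x => Dx (xp a * pd V 0 b) x 0 := by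
        ext x
        simp only [Dx]
        rw [h2]
      rw [H1, H1, L2, L2, L2, L2, h2, h3]
    rw [h1]
    exact hBV a b 0
  have hK : ∀ s, H1 (xp a * pd G 0 b - (2 * a : ℂ) • (xp (a - 1) * pd u 0 (b + 1))
        - (a * (a - 1) : ℂ) • (xp (a - 2) * pd u 0 b)) s ≤
      (R' + (R + 2 * τ * R')) * m (2 * a + b) := fun s => by
    rcases Nat.eq_zero_or_pos a with rfl | ha
    · simp only [Nat.cast_zero, mul_zero, zero_mul, zero_smul, sub_zero]
      refine (hBG 0 b s).trans ?_
      rw [mul_zero]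
      nlinarith [hm.pos (0 + b)]
    · obtain ⟨n, hn⟩ : ∃ n, 2 * a + b = n + 1 := ⟨2 * a + b - 1, by omega⟩
      have e1 := ih (a - 1) (by omega) (b + 1) s
      have e2 := ih (a - 2) (by omega) b s
      have m1 : m (2 * (a - 1) + (b + 1)) ≤ m n := hm.mono (by omega)
      have m2 : m (2 * (a - 2) + b) ≤ m n := hm.mono (by omega)
      have f1 := hBG a b s
      have f2 := hm.sq_mul_le n
      rw [hn] at f1 ⊢
      have ha1 : (1 : ℝ) ≤ a := by exact_mod_cast ha
      have han : (a : ℝ) ≤ n := by exact_mod_cast (by omega : a ≤ n)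
      have n1 : ‖(2 * a : ℂ)‖ = 2 * a := by simp
      have n2 : ‖(a * (a - 1) : ℂ)‖ = a * (a - 1) := by
        have : (a * (a - 1) : ℂ) = ((a * (a - 1) : ℝ) : ℂ) := by push_cast; ring
        rw [this, Complex.norm_real, Real.norm_of_nonneg (mul_nonneg (by linarith) (by linarith))]
      have s1 : ∀ {p q : ℝ → ℝ → ℂ}, Rapid p → Rapid q → H1 (p - q) s ≤ H1 p s + H1 q s :=
        fun {p q} hp hq => by
          have := hp.H1_add_le (hq.smul (-1)) s
          rw [H1_smul] at this
          simpa [sub_eq_add_neg] using this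
      have g1 := s1 (hH1.sub hH2) hH3
      have g2 := s1 hH1 hH2
      rw [H1_smul, n2] at g1
      rw [H1_smul, n1] at g2
      set M := 2 * (R + 2 * τ * R') with hMdef
      have e1' : H1 (xp (a - 1) * pd u 0 (b + 1)) s ≤ M * m n :=
        e1.trans (mul_le_mul_of_nonneg_left m1 hM)
      have e2' : H1 (xp (a - 2) * pd u 0 b) s ≤ M * m n :=
        e2.trans (mul_le_mul_of_nonneg_left m2 hM)
      have k1 : 2 * (a : ℝ) * H1 (xp (a - 1) * pd u 0 (b + 1)) s ≤ 2 * a * (M * m n) := by gcongr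
      have k2 : (a : ℝ) * (a - 1) * H1 (xp (a - 2) * pd u 0 b) s ≤ a * (a - 1) * (M * m n) :=
        mul_le_mul_of_nonneg_left e2' (mul_nonneg (by linarith) (by linarith))
      have k3 : 2 * (a : ℝ) + a * (a - 1) ≤ 2 * ((n : ℝ) + 1) ^ 2 := by nlinarith
      have k4 := mul_le_mul_of_nonneg_right k3 (mul_nonneg hM (hm.pos n).le)
      have k5 := mul_le_mul_of_nonneg_left f2 hM
      have k6 : R + 2 * τ * R' = M / 2 := by rw [hMdef]; ring
      rw [k6]
      linarith
  refine ((hu.xp_mul a b).H1_energy hθ ((hH1.sub hH2).sub hH3) heq' hK t).trans ?_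
  have hm0 := (hm.pos (2 * a + b)).le
  have := mul_nonneg hR hm0
  have := mul_nonneg hR' hm0
  have := mul_nonneg hθ.pos.le this
  nlinarith [hθ.pos, mul_le_mul_of_nonneg_right hτ (add_nonneg ‹0 ≤ R * m (2 * a + b)›
    (mul_nonneg zero_le_two this))]

end NLS

namespace NLS

open Filter Topology
open scoped ContDiff

/-! ### Picard iteration -/

variable {m : ℕ → ℝ} {u v w w' W V F : ℝ → ℝ → ℂ} {Q S : ℝ}

/-- The cubic nonlinearity. -/
def cub (u : ℝ → ℝ → ℂ) : ℝ → ℝ → ℂ := u * u * star u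

theorem cub_sub (w w' : ℝ → ℝ → ℂ) :
    cub w - cub w' = (w - w') * (w + w') * star w + star (w - w') * w' * w' := by
  simp only [cub, star_sub]
  ring

theorem rapid_cub_sub (hw : Sym 0 w) (hw' : Sym 0 w') (hd : Rapid (w - w')) :
    Rapid (cub w - cub w') := by
  rw [cub_sub]
  exact ((hd.mul_sym (hw.add hw')).mul_sym hw.star).add ((hd.star.mul_sym hw').mul_sym hw')

theorem Bd.cub_sub (hm : IsWeight m) (hw : Sym 0 w) (hw' : Sym 0 w') (hd : Rapid (w - w'))
    (hQ : 0 ≤ Q) (hS : 0 ≤ S) (h : MB m Q w) (h' : MB m Q w') (hB : Bd m S (w - w')) :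
    Bd m (27 * Q ^ 2 * S) (cub w - cub w') := by
  rw [NLS.cub_sub]
  have h1 := hd.mul_sym (hw.add hw')
  have h2 := hd.star.mul_sym hw'
  have b1 := hB.mul hm hd (hw.add hw') (h.add hw hw' h') hS (by linarith)
  have b2 := b1.mul hm h1 hw.star (h.star hw) (by positivity) hQ
  have b3 := (hB.star hd).mul hm hd.star hw' h' hS hQ
  have b4 := b3.mul hm h2 hw' h' (by positivity) hQ
  refine (b2.add (h1.mul_sym hw.star) (h2.mul_sym hw') b4).mono hm (le_of_eq ?_)
  ring

theorem exists_bounds (hW : Sym 0 W) (hV : Rapid V) (hF : Rapid F) :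
    ∃ m A, IsWeight m ∧ 0 ≤ A ∧ MB m A W ∧ Bd m A V ∧ Bd m A F := by
  have key : ∀ u, Rapid u → ∀ a b, ∃ C, 0 ≤ C ∧ ∀ t, H1 (xp a * pd u 0 b) t ≤ C :=
    fun u hu a b => by
      obtain ⟨C, hC⟩ := (hu.xp_mul a b).exists_H1_le
      exact ⟨C, (H1_nonneg _ 0).trans (hC 0), hC⟩
  have keyW : ∀ b, ∃ C, 0 ≤ C ∧ ∀ t f, Rapid f → H1 (f * pd W 0 b) t ≤ C * H1 f t := fun b => by
    have h1 : ∀ b, ∃ C, ∀ x t, ‖pd W 0 b x t‖ ≤ C := fun b => by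
      obtain ⟨C, hC⟩ := (hW.pd_zero b).2 0 0
      exact ⟨C, fun x t => by simpa [pd_zero_zero] using hC x t⟩
    obtain ⟨C, hC⟩ := h1 b
    obtain ⟨C', hC'⟩ := h1 (b + 1)
    rw [pd_zero_succ] at hC'
    refine ⟨C + C', add_nonneg ((norm_nonneg _).trans (hC 0 0)) ((norm_nonneg _).trans (hC' 0 0)),
      fun t f hf => hf.H1_mul_sym_le (hW.pd_zero b) (fun x => hC x t) fun x => hC' x t⟩
  choose cV hV0 hcV using key V hV
  choose cF hF0 hcF using key F hF
  choose cW hW0 hcW using keyW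
  obtain ⟨D, hD⟩ : ∃ D : ℕ → ℝ, ∀ n, D n = ∑ a ∈ Finset.range (n + 1), ∑ b ∈ Finset.range (n + 1),
    (cV a b + cF a b + cW b) := ⟨_, fun _ => rfl⟩
  have hle : ∀ a b n, a ≤ n → b ≤ n → cV a b + cF a b + cW b ≤ D n := fun a b n ha hb => by
    have h0 : ∀ a b, 0 ≤ cV a b + cF a b + cW b := fun a b =>
      add_nonneg (add_nonneg (hV0 a b) (hF0 a b)) (hW0 b)
    rw [hD]
    refine le_trans ?_ (Finset.single_le_sum (f := fun a => ∑ b ∈ Finset.range (n + 1),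
      (cV a b + cF a b + cW b)) (fun a _ => Finset.sum_nonneg fun b _ => h0 a b)
      (Finset.mem_range.2 (Nat.lt_succ_of_le ha)))
    exact Finset.single_le_sum (f := fun b => cV a b + cF a b + cW b) (fun b _ => h0 a b)
      (Finset.mem_range.2 (Nat.lt_succ_of_le hb))
  have hD0 : ∀ n, 0 ≤ D n := fun n => by
    linarith [hle 0 0 n n.zero_le n.zero_le, hV0 0 0, hF0 0 0, hW0 0]
  obtain ⟨m, hm, hDm⟩ := exists_weight D hD0
  refine ⟨m, 1 + D 0, hm, by linarith [hD0 0], fun b t f hf => ?_, fun a b t => ?_,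
    fun a b t => ?_⟩
  · refine (hcW b t f hf).trans (mul_le_mul_of_nonneg_right ?_ (H1_nonneg f t))
    linarith [hle 0 b b b.zero_le le_rfl, hV0 0 b, hF0 0 b, hDm b]
  · linarith [hle a b (2 * a + b) (by omega) (by omega), hF0 a b, hW0 b, hDm (2 * a + b),
      hcV a b t]
  · linarith [hle a b (2 * a + b) (by omega) (by omega), hV0 a b, hW0 b, hDm (2 * a + b),
      hcF a b t]

/-- The nonlinearity of the equation satisfied by the perturbation `v` of `W`. -/
def nl (μ : ℝ) (W v : ℝ → ℝ → ℂ) : ℝ → ℝ → ℂ := (μ : ℂ) • (cub (W + v) - cub W)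

theorem rapid_nl (μ : ℝ) (hW : Sym 0 W) (hv : Rapid v) : Rapid (nl μ W v) :=
  (rapid_cub_sub (hW.add (hv 0)) hW (by rwa [add_sub_cancel_left])).smul _

/-- The Picard iterates of the perturbation equation, with their contraction estimates. -/
structure IsPicard (θ : ℝ → ℝ) (μ : ℝ) (W V F : ℝ → ℝ → ℂ) (m : ℕ → ℝ) (R : ℝ)
    (v : ℕ → ℝ → ℝ → ℂ) : Prop where
  rapid : ∀ n, Rapid (v n)
  zero : v 0 = 0
  start : ∀ n x, v (n + 1) x 0 = V x 0
  eq : ∀ n, Dt (v (n + 1)) =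
    Complex.I • ((fun _ t => (θ t : ℂ)) * (Dx (Dx (v (n + 1))) + (nl μ W (v n) + F)))
  bd : ∀ n, Bd m (R * (1 / 2) ^ n) (v (n + 1) - v n)

theorem exists_picard {μ : ℝ} (hμ : ‖(μ : ℂ)‖ ≤ 1) (hW : Sym 0 W) (hV : Rapid V) (hF : Rapid F) :
    ∃ τ θ φ, IsClock τ θ φ ∧ τ ≤ 1 / 2 ∧ ∃ m R v, 0 ≤ R ∧ IsPicard θ μ W V F m R v := by
  obtain ⟨m, A, hm, hA, hBW, hBV, hBF⟩ := exists_bounds hW hV hF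
  obtain ⟨R, hR⟩ : ∃ R, R = 2 * A + 2 := ⟨_, rfl⟩
  obtain ⟨Q, hQ⟩ : ∃ Q, Q = A + 2 * R := ⟨_, rfl⟩
  have hR0 : 0 ≤ R := by linarith
  have hQ0 : 0 ≤ Q := by linarith
  obtain ⟨R', hR'⟩ : ∃ R', R' = 27 * Q ^ 2 * R + A := ⟨_, rfl⟩
  have hR'0 : 0 ≤ R' := by rw [hR']; positivity
  obtain ⟨B, hB⟩ : ∃ B, B = 2 * R' + 216 * Q ^ 2 + 2 := ⟨_, rfl⟩
  have hB0 : 0 < B := by rw [hB]; positivity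
  obtain ⟨τ, hτ⟩ : ∃ τ, τ = 1 / B := ⟨_, rfl⟩
  have hτ0 : 0 < τ := by rw [hτ]; positivity
  have hτB : τ * B = 1 := by rw [hτ]; field_simp
  have hτ1 : τ ≤ 1 / 2 := by nlinarith [mul_nonneg hτ0.le hR'0, mul_nonneg hτ0.le (sq_nonneg Q)]
  have hτ2 : 2 * τ * R' ≤ 1 := by nlinarith [mul_nonneg hτ0.le (sq_nonneg Q)]
  have hτ3 : 216 * τ * Q ^ 2 ≤ 1 := by nlinarith [mul_nonneg hτ0.le hR'0]
  obtain ⟨θ, φ, hθ⟩ := exists_clock hτ0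
  have hMB : ∀ v, Rapid v → Bd m R v → MB m Q (W + v) := fun v hv hb => by
    rw [hQ]
    exact hBW.add hW (hv 0) (hb.mb hv)
  have hstep : ∀ v, ∃ v', Rapid v → Bd m R v → (Rapid v' ∧ Bd m R v' ∧ (∀ x, v' x 0 = V x 0) ∧
      Dt v' = Complex.I • ((fun _ t => (θ t : ℂ)) * (Dx (Dx v') + (nl μ W v + F)))) := fun v => by
    by_cases hv : Rapid v
    · obtain ⟨v', h1, h2, h3⟩ := exists_linear_solution hθ hV ((rapid_nl μ hW hv).add hF)
      refine ⟨v', fun _ hb => ⟨h1, ?_, h2, h3⟩⟩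
      have hd : Rapid (W + v - W) := by rwa [add_sub_cancel_left]
      have b1 := Bd.cub_sub hm (hW.add (hv 0)) hW hd hQ0 hR0 (hMB v hv hb)
        (hBW.mono hm (by linarith)) (by rwa [add_sub_cancel_left])
      have b2 := (b1.smul hμ).add (rapid_nl μ hW hv) hF hBF
      rw [← hR'] at b2
      refine (Bd.linear hm hθ hτ1 h1 ((rapid_nl μ hW hv).add hF) h2 h3 hA hR'0 hBV b2).mono hm ?_
      rw [hR]
      linarith
    · exact ⟨0, fun h => absurd h hv⟩
  choose Φ hΦ using hstep
  obtain ⟨v, hv⟩ : ∃ v : ℕ → ℝ → ℝ → ℂ, ∀ n, v n = Φ^[n] 0 := ⟨_, fun _ => rfl⟩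
  have hv0 : v 0 = 0 := hv 0
  have hvs : ∀ n, v (n + 1) = Φ (v n) := fun n => by
    rw [hv, hv, Function.iterate_succ_apply']
  have hgood : ∀ n, Rapid (v n) ∧ Bd m R (v n) := fun n => by
    induction n with
    | zero => rw [hv0]; exact ⟨Rapid.zero, Bd.zero hm hR0⟩
    | succ n ih =>
      rw [hvs]
      obtain ⟨h1, h2, _⟩ := hΦ (v n) ih.1 ih.2
      exact ⟨h1, h2⟩
  have h_start : ∀ n x, v (n + 1) x 0 = V x 0 := fun n => by
    rw [hvs]; exact (hΦ (v n) (hgood n).1 (hgood n).2).2.2.1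
  have heq : ∀ n, Dt (v (n + 1)) = Complex.I • ((fun _ t => (θ t : ℂ)) *
      (Dx (Dx (v (n + 1))) + (nl μ W (v n) + F))) := fun n => by
    rw [hvs]; exact (hΦ (v n) (hgood n).1 (hgood n).2).2.2.2
  refine ⟨τ, θ, φ, hθ, hτ1, m, R, v, hR0, ⟨fun n => (hgood n).1, hv0, h_start, heq, fun n => ?_⟩⟩
  induction n with
  | zero => rw [hv0, sub_zero, pow_zero, mul_one]; exact (hgood 1).2
  | succ n ih =>
    have hr := hgood n
    have hr1 := hgood (n + 1)
    have hr2 := hgood (n + 2)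
    have e1 : W + v (n + 1) - (W + v n) = v (n + 1) - v n := by abel
    have hd : Rapid (W + v (n + 1) - (W + v n)) := by rw [e1]; exact hr1.1.sub hr.1
    have hS : 0 ≤ R * (1 / 2) ^ n := by positivity
    have b1 := Bd.cub_sub hm (hW.add (hr1.1 0)) (hW.add (hr.1 0)) hd hQ0 hS (hMB _ hr1.1 hr1.2)
      (hMB _ hr.1 hr.2) (by rwa [e1])
    have b2 := b1.smul hμ
    have hrap := (rapid_cub_sub (hW.add (hr1.1 0)) (hW.add (hr.1 0)) hd).smul (μ : ℂ)
    have b3 := Bd.linear hm hθ hτ1 (hr2.1.sub hr1.1) hrap (V := 0)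
      (fun x => by simp [h_start n x, h_start (n + 1) x]) (by
        rw [dt_sub hr2.1.sm hr1.1.sm, heq n, heq (n + 1), dx_sub hr2.1.sm hr1.1.sm,
          dx_sub hr2.1.sm.dx hr1.1.sm.dx, nl, nl]
        ext x t
        simp
        ring) le_rfl (by positivity) (Bd.zero hm le_rfl) b2
    refine b3.mono hm ?_
    have := mul_le_mul_of_nonneg_right hτ3 hS
    rw [pow_succ (1 / 2 : ℝ) n]
    linarith

end NLS

namespace NLS

open Filter Topology
open scoped ContDiff

/-! ### The limit of the Picard iteration -/

section Families
variable {k : ℕ} {ρ : ℕ → ℝ} {γ : ℝ} {d u v : ℕ → ℝ → ℝ → ℂ} {W : ℝ → ℝ → ℂ}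

theorem Sy.mul_one (hu : Sy k ρ γ u) (hv : Sy k (fun _ => 1) 0 v) :
    Sy k ρ γ (fun n => u n * v n) := by
  simpa using hu.mul hv

theorem Sy.sym_mul (hW : Sym 0 W) (hu : Sy k ρ γ u) : Sy k ρ γ (fun n => W * u n) := by
  simpa only [mul_comm] using hu.mul_one (hW.sy k ℕ)

theorem Sy.of_tail (h0 : Sym γ (d 0)) (h : Sy k (fun n => (1 / 2) ^ n) γ (fun n => d (n + 1))) :
    Sy k (fun n => (1 / 2) ^ n) γ d := by
  refine ⟨fun n => ?_, fun i j hi => ?_⟩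
  · cases n with
    | zero => exact h0.1
    | succ n => exact h.1 n
  · obtain ⟨C, hC⟩ := h0.2 i j
    obtain ⟨C', hC'⟩ := h.2 i j hi
    refine ⟨|C| + 2 * |C'|, fun n x t => ?_⟩
    have hp := jb_rpow_pos x (γ - j)
    have hC0 := mul_le_mul_of_nonneg_right (le_abs_self C) hp.le
    cases n with
    | zero =>
      have := mul_nonneg (abs_nonneg C') hp.le
      beta_reduce
      rw [pow_zero, _root_.mul_one]
      linarith [hC x t]
    | succ n =>
      have hq : (0 : ℝ) < (1 / 2) ^ n * jb x ^ (γ - j) := mul_pos (by positivity) hp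
      have h1 := mul_le_mul_of_nonneg_right (le_abs_self C') hq.le
      have h2 := mul_nonneg (abs_nonneg C) hq.le
      have h3 := hC' n x t
      beta_reduce at h3 ⊢
      rw [pow_succ]
      nlinarith

theorem Sy.partial_sum (h : Sy k (fun n => (1 / 2) ^ n) γ d) :
    Sy k (fun _ => 1) γ (fun n => ∑ l ∈ Finset.range n, d l) := by
  refine ⟨fun n => Sm.sum fun l _ => h.1 l, fun i j hi => ?_⟩
  obtain ⟨C, hC⟩ := h.2 i j hi
  refine ⟨|C| * 2, fun n x t => ?_⟩
  rw [pd_sum fun l _ => h.1 l, Finset.sum_apply, Finset.sum_apply]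
  refine (norm_sum_le _ _).trans ((Finset.sum_le_sum (g := fun l : ℕ =>
    |C| * jb x ^ (γ - j) * (1 / 2 : ℝ) ^ l) fun l _ => ?_).trans ?_)
  · have := mul_le_mul_of_nonneg_right (le_abs_self C)
      (mul_pos (by positivity : (0 : ℝ) < (1 / 2) ^ l) (jb_rpow_pos x (γ - j))).le
    have := hC l x t
    linarith
  · rw [← Finset.mul_sum]
    have := mul_le_mul_of_nonneg_left (sum_geometric_two_le n)
      (mul_nonneg (abs_nonneg C) (jb_rpow_pos x (γ - j)).le)
    linarith

end Families

variable {m : ℕ → ℝ} {W V F : ℝ → ℝ → ℂ} {R τ μ : ℝ} {θ φ : ℝ → ℝ} {d v : ℕ → ℝ → ℝ → ℂ}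

theorem jb_pow_le (x : ℝ) (a : ℕ) : jb x ^ a ≤ 1 + |x| ^ a := by
  rcases max_choice 1 |x| with h | h
  · rw [jb, h, one_pow]
    linarith [pow_nonneg (abs_nonneg x) a]
  · rw [jb, h]
    linarith

theorem Bd.sy_zero (hd : ∀ n, Rapid (d n)) (hb : ∀ n, Bd m (R * (1 / 2) ^ n) (d n)) (γ : ℝ) :
    Sy 0 (fun n => (1 / 2) ^ n) γ d := by
  refine ⟨fun n => (hd n).sm, fun i j hi => ?_⟩
  obtain rfl : i = 0 := by omega
  obtain ⟨a, ha⟩ := exists_nat_ge (j - γ)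
  refine ⟨R * (m j + m (2 * a + j)), fun n x t => ?_⟩
  have h1 : ∀ a, |x| ^ a * ‖pd (d n) 0 j x t‖ ≤ R * (1 / 2) ^ n * m (2 * a + j) := fun a => by
    refine le_trans (le_of_eq ?_) ((((hd n).xp_mul a j).norm_le_H1 x t).trans (hb n a j t))
    simp [xp]
  have h2 := h1 0
  rw [pow_zero, one_mul, Nat.mul_zero, zero_add] at h2
  have h3 := mul_le_mul_of_nonneg_right (jb_pow_le x a) (norm_nonneg (pd (d n) 0 j x t))
  have h4 : jb x ^ a * ‖pd (d n) 0 j x t‖ ≤ R * (m j + m (2 * a + j)) * (1 / 2) ^ n := by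
    linarith [h1 a]
  have hja : (0 : ℝ) < jb x ^ a := pow_pos (jb_pos x) a
  have h5 : 1 ≤ jb x ^ a * jb x ^ (γ - j) := by
    rw [← Real.rpow_natCast, ← Real.rpow_add (jb_pos x)]
    exact Real.one_le_rpow (one_le_jb x) (by linarith)
  have h6 := mul_le_mul_of_nonneg_right h4 (jb_rpow_pos x (γ - j)).le
  have h7 := mul_le_mul_of_nonneg_right h5 (norm_nonneg (pd (d n) 0 j x t))
  linarith

theorem IsPicard.dt_sub (hv : IsPicard θ μ W V F m R v) (n : ℕ) :
    Dt (v (n + 2) - v (n + 1)) = (fun _ t => Complex.I * θ t) *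
      (Dx (Dx (v (n + 2) - v (n + 1))) + (fun _ _ => (μ : ℂ)) * (cub (W + v (n + 1)) - cub (W + v n))) := by
  have h1 := (hv.rapid (n + 1)).sm
  have h2 := (hv.rapid (n + 2)).sm
  rw [NLS.dt_sub h2 h1, hv.eq n, hv.eq (n + 1), dx_sub h2 h1, dx_sub h2.dx h1.dx, nl, nl]
  ext x t
  simp
  ring

theorem IsPicard.sy (hθ : IsClock τ θ φ) (hW : Sym 0 W) (hv : IsPicard θ μ W V F m R v)
    (k : ℕ) (γ : ℝ) : Sy k (fun n => (1 / 2) ^ n) γ (fun n => v (n + 1) - v n) := by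
  have hr : ∀ n, Rapid (v (n + 1) - v n) := fun n => (hv.rapid _).sub (hv.rapid _)
  have h0 : ∀ γ, Sy 0 (fun n => (1 / 2) ^ n) γ (fun n => v (n + 1) - v n) := Bd.sy_zero hr hv.bd
  induction k generalizing γ with
  | zero => exact h0 γ
  | succ k ih =>
    refine (h0 γ).succ_index (Sy.of_tail ((hr 0).dt γ) ?_)
    have hw : Sy k (fun _ => 1) 0 (fun n => W + v n) := by
      refine (hW.sy k ℕ).add ?_
      have := (ih 0).partial_sum
      simpa only [Finset.sum_range_sub, hv.zero, sub_zero] using this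
    have hw' : Sy k (fun _ => 1) 0 (fun n => W + v (n + 1)) := hw.comp (· + 1)
    have hs : Sy k (fun n => (1 / 2) ^ n) γ (fun n => v (n + 1 + 1) - v (n + 1)) :=
      ((ih γ).comp (· + 1)).mono_weight 1 (fun n => by positivity) fun n => by
        rw [pow_succ]
        linarith [pow_pos (one_half_pos (α := ℝ)) n]
    have hc : Sy k (fun n => (1 / 2) ^ n) γ (fun n => cub (W + v (n + 1)) - cub (W + v n)) := by
      have e1 : ∀ n, W + v (n + 1) - (W + v n) = v (n + 1) - v n := fun n => by abel
      simp only [NLS.cub_sub, e1]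
      exact (((ih γ).mul_one (hw'.add hw)).mul_one hw'.star).add
        (((ih γ).star.mul_one hw).mul_one hw)
    have hIθ : Sym 0 (fun _ t => Complex.I * θ t) := hθ.sym.smul Complex.I
    have := Sy.sym_mul hIθ
      ((hs.dx.dx.mono_order (by linarith)).add (Sy.sym_mul (Sym.const (μ : ℂ)) hc))
    simpa only [hv.dt_sub] using this

theorem IsPicard.exists_limit (hθ : IsClock τ θ φ) (hW : Sym 0 W)
    (hv : IsPicard θ μ W V F m R v) : ∃ v', Rapid v' ∧ (∀ x, v' x 0 = V x 0) ∧
      Dt v' = Complex.I • ((fun _ t => (θ t : ℂ)) * (Dx (Dx v') + (nl μ W v' + F))) := by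
  have hs := hv.sy hθ hW
  have hb : ∀ i j (γ : ℝ), ∃ C, 0 ≤ C ∧ ∀ n x t,
      ‖pd (v (n + 1) - v n) i j x t‖ ≤ C * (1 / 2) ^ n * jb x ^ (γ - j) := fun i j γ => by
    obtain ⟨C, hC⟩ := (hs i γ).2 i j le_rfl
    refine ⟨C, ?_, hC⟩
    have := (norm_nonneg _).trans (hC 0 0 0)
    beta_reduce at this
    rw [pow_zero, _root_.mul_one] at this
    exact nonneg_of_mul_nonneg_left this (jb_rpow_pos 0 _)
  have hsum : ∀ c, Summable fun n : ℕ => c * (1 / 2 : ℝ) ^ n := fun c =>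
    summable_geometric_two.mul_left c
  have hb1 : ∀ i j, ∃ g : ℕ → ℝ, Summable g ∧ ∀ n x t, ‖pd (v (n + 1) - v n) i j x t‖ ≤ g n :=
    fun i j => by
      obtain ⟨C, -, hC⟩ := hb i j j
      exact ⟨_, hsum C, fun n x t => by simpa using hC n x t⟩
  obtain ⟨hsm, hpd⟩ := tsum_family (fun n => (hs 0 0).1 n) hb1
  obtain ⟨v', hv'⟩ : ∃ v' : ℝ → ℝ → ℂ, v' = fun x t => ∑' n, (v (n + 1) - v n) x t := ⟨_, rfl⟩
  rw [← hv'] at hsm hpd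
  have hrap : Rapid v' := fun γ => ⟨hsm, fun i j => by
    obtain ⟨C, hC0, hC⟩ := hb i j γ
    refine ⟨C * 2, fun x t => ?_⟩
    rw [hpd]
    have h1 : HasSum (fun n : ℕ => C * (1 / 2) ^ n * jb x ^ (γ - j)) (C * 2 * jb x ^ (γ - j)) :=
      (hasSum_geometric_two.mul_left C).mul_right _
    exact tsum_of_norm_bounded h1 fun n => hC n x t⟩
  have hlim : ∀ i j x t, Tendsto (fun n => pd (v n) i j x t) atTop (𝓝 (pd v' i j x t)) :=
    fun i j x t => by
      obtain ⟨g, hg, hgb⟩ := hb1 i j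
      have h1 : Summable fun n => pd (v (n + 1) - v n) i j x t :=
        Summable.of_norm_bounded hg fun n => hgb n x t
      have h2 := h1.hasSum.tendsto_sum_nat
      have h3 : pd (0 : ℝ → ℝ → ℂ) i j x t = 0 := pd_zero i j x t
      simpa [pd_sub (hv.rapid _).sm (hv.rapid _).sm, Finset.sum_range_sub
        (fun n => pd (v n) i j x t), hv.zero, h3, hpd] using h2
  have hlim0 : ∀ x t, Tendsto (fun n => v n x t) atTop (𝓝 (v' x t)) := fun x t => by
    simpa only [pd_zero_zero] using hlim 0 0 x t
  refine ⟨v', hrap, fun x => ?_, ?_⟩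
  · refine tendsto_nhds_unique ((tendsto_add_atTop_iff_nat 1).2 (hlim0 x 0)) ?_
    simp only [hv.start]
    exact tendsto_const_nhds
  · ext x t
    have h1 := (tendsto_add_atTop_iff_nat 1).2 (hlim 1 0 x t)
    have h2 := (tendsto_add_atTop_iff_nat 1).2 (hlim 0 2 x t)
    simp only [pd_succ_left, pd_zero_succ, pd_zero_zero] at h1 h2
    have h3 : Tendsto (fun n => nl μ W (v n) x t) atTop (𝓝 (nl μ W v' x t)) := by
      have h4 : Tendsto (fun n => W x t + v n x t) atTop (𝓝 (W x t + v' x t)) :=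
        (hlim0 x t).const_add _
      exact (((h4.mul h4).mul h4.star).sub_const (cub W x t)).const_smul (μ : ℂ)
    refine tendsto_nhds_unique h1 ?_
    simp only [hv.eq]
    exact ((h2.add (h3.add_const (F x t))).const_mul (θ t : ℂ)).const_smul Complex.I

end NLS

namespace NLS

open Filter Topology
open scoped ContDiff

/-! ### Bounds on a time strip -/

variable {u v w w' : ℝ → ℝ → ℂ} {T β : ℝ}

/-- Symbol bounds of order zero on the strip `ℝ × [0,T]`. -/
def Strip (T : ℝ) (u : ℝ → ℝ → ℂ) : Prop :=
  Sm u ∧ ∀ i j : ℕ, ∃ C : ℝ, ∀ x, ∀ t ∈ Set.Icc 0 T, ‖pd u i j x t‖ ≤ C * jb x ^ (-(j : ℝ))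

theorem Strip.sub (hu : Strip T u) (hv : Strip T v) : Strip T (u - v) := by
  refine ⟨hu.1.sub hv.1, fun i j => ?_⟩
  obtain ⟨C, hC⟩ := hu.2 i j
  obtain ⟨C', hC'⟩ := hv.2 i j
  refine ⟨C + C', fun x t ht => ?_⟩
  rw [pd_sub hu.1 hv.1, Pi.sub_apply, Pi.sub_apply, add_mul]
  exact (norm_sub_le _ _).trans (add_le_add (hC x t ht) (hC' x t ht))

theorem hpow_bound {γ : ℝ} (hγ : γ ≤ 0) (j : ℕ) :
    ∃ C, 0 ≤ C ∧ ∀ x, ‖iteratedDeriv j (hpow γ) x‖ ≤ C * jb x ^ (-(j : ℝ)) := by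
  have h1 : EC (fun _ => 1) := ⟨contDiff_const, 0, fun _ _ => rfl, fun _ _ => rfl⟩
  obtain ⟨C, hC⟩ := ((hpow_sym h1 γ).mono hγ).2 0 j
  have hC' : ∀ x, ‖iteratedDeriv j (hpow γ) x‖ ≤ C * jb x ^ (-(j : ℝ)) := fun x => by
    simpa [pd] using hC x 0
  exact ⟨C, nonneg_of_mul_nonneg_left ((norm_nonneg _).trans (hC' 0)) (jb_rpow_pos 0 _), hC'⟩

theorem exists_bound_of_sub_psumP {e : ℕ → ℝ} {a b : ℕ → ℝ → ℝ} (hu : Sm u) (h0 : e 0 ≤ 0)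
    (h1 : e 1 ≤ 0) (ha : ContDiff ℝ ∞ (a 0)) (hb : ContDiff ℝ ∞ (b 0)) (i j : ℕ)
    (h : ∃ C > (0 : ℝ), ∀ x : ℝ, 1 ≤ x → ∀ t ∈ Set.Icc (0 : ℝ) T,
      ‖pd (fun y s => u y s - psumP e a b 0 y s) i j x t‖ ≤ C * x ^ (e (0 + 1) - (j : ℝ))) :
    ∃ C, ∀ x : ℝ, 1 ≤ x → ∀ t ∈ Set.Icc (0 : ℝ) T, ‖pd u i j x t‖ ≤ C * jb x ^ (-(j : ℝ)) := by
  obtain ⟨C, hC0, hC⟩ := h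
  obtain ⟨C', hC'0, hC'⟩ := hpow_bound h0 j
  obtain ⟨f, hf⟩ : ∃ f : ℝ → ℂ, f = fun t => (a 0 t : ℂ) + Complex.I * (b 0 t : ℂ) := ⟨_, rfl⟩
  have hfs : ContDiff ℝ ∞ f := by
    rw [hf]
    exact (Complex.ofRealCLM.contDiff.comp ha).add
      (contDiff_const.mul (Complex.ofRealCLM.contDiff.comp hb))
  obtain ⟨B, hB⟩ := (isCompact_Icc (a := (0 : ℝ)) (b := T)).exists_bound_of_continuousOn
    (hfs.continuous_iteratedDeriv i (by exact_mod_cast le_top)).continuousOn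
  have hs : Sm (fun x t => f t * hpow (e 0) x) := (Sm.of_t hfs).mul (Sm.of_x (contDiff_hpow _))
  refine ⟨C + B * C', fun x hx t ht => ?_⟩
  have e1 : pd (fun y s => u y s - psumP e a b 0 y s) i j x t
      = pd u i j x t - iteratedDeriv i f t * iteratedDeriv j (hpow (e 0)) x := by
    rw [← pd_tensor, ← Pi.sub_apply, ← Pi.sub_apply, ← pd_sub hu hs]
    refine pd_congr_nhds ?_ i j t
    have h2 : Real.exp (-1) < x := (Real.exp_lt_one_iff.2 (by norm_num)).trans_le hx
    filter_upwards [lt_mem_nhds h2] with y hy s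
    simp [psumP, hpow_eq hy.le, hf]
  have h2 := hC x hx t ht
  rw [e1] at h2
  have h3 : x ^ (e (0 + 1) - (j : ℝ)) ≤ jb x ^ (-(j : ℝ)) := by
    rw [jb_of_one_le hx]
    exact Real.rpow_le_rpow_of_exponent_le hx (by simpa using h1)
  have h4 := mul_le_mul (hB t ht) (hC' x) (norm_nonneg _) ((norm_nonneg _).trans (hB t ht))
  rw [← norm_mul] at h4
  have h5 := norm_sub_norm_le (pd u i j x t) (iteratedDeriv i f t * iteratedDeriv j (hpow (e 0)) x)
  have h6 := mul_le_mul_of_nonneg_left h3 hC0.le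
  linarith

theorem strip_of_sBetaOn (hβ : β ≤ 0) (h : SBetaOn β w T) : Strip T w := by
  obtain ⟨hs, e, ⟨he0, he1, -⟩, ap, bp, am, bm, hc, hP, hM⟩ := h
  have hw := Smooth2.sm hs
  have h1 : e 1 ≤ 0 := ((he1 one_pos).le.trans he0.le).trans hβ
  refine ⟨hw, fun i j => ?_⟩
  obtain ⟨C1, hC1⟩ := exists_bound_of_sub_psumP hw (he0.le.trans hβ) h1
    (contDiff_infty.2 (hc 0).1) (contDiff_infty.2 (hc 0).2.1) i j (hP 0 i j)
  obtain ⟨C2, hC2⟩ := exists_bound_of_sub_psumP hw.neg_x (he0.le.trans hβ) h1 (a := am) (b := bm)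
    (T := T) (contDiff_infty.2 (hc 0).2.2.1) (contDiff_infty.2 (hc 0).2.2.2) i j (by
      obtain ⟨C, hC0, hC⟩ := hM 0 i j
      refine ⟨C, hC0, fun x hx t ht => ?_⟩
      have h2 := hC (-x) (by linarith) t ht
      rw [neg_neg] at h2
      refine le_trans (le_of_eq ?_) h2
      have h3 := pd_neg_x (fun y s => w y s - psumM e am bm 0 y s) i j x t
      have h4 : (fun x t => (fun y s => w y s - psumM e am bm 0 y s) (-x) t)
          = fun y s => w (-y) s - psumP e am bm 0 y s := by
        ext y s
        simp [psumP, psumM]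
      rw [h4] at h3
      rw [h3, norm_mul]
      simp)
  obtain ⟨C3, hC3⟩ := (isCompact_Icc.prod isCompact_Icc :
    IsCompact (Set.Icc (-1 : ℝ) 1 ×ˢ Set.Icc 0 T)).exists_bound_of_continuousOn
    (hw.pd i j).continuous.continuousOn
  refine ⟨|C1| + |C2| + |C3|, fun x t ht => ?_⟩
  have hp := jb_rpow_pos x (-(j : ℝ))
  have m1 := mul_le_mul_of_nonneg_right (le_abs_self C1) hp.le
  have m2 := mul_le_mul_of_nonneg_right (le_abs_self C2) hp.le
  have m3 := mul_le_mul_of_nonneg_right (le_abs_self C3) hp.le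
  have n1 := mul_nonneg (abs_nonneg C1) hp.le
  have n2 := mul_nonneg (abs_nonneg C2) hp.le
  have n3 := mul_nonneg (abs_nonneg C3) hp.le
  rcases le_total 1 x with hx | hx
  · linarith [hC1 x hx t ht]
  rcases le_total x (-1) with hx' | hx'
  · have h2 := hC2 (-x) (by linarith) t ht
    rw [pd_neg_x, neg_neg, norm_mul, jb_neg] at h2
    simp only [norm_pow, norm_neg, norm_one, one_pow, one_mul] at h2
    linarith
  · have h2 : ‖pd w i j x t‖ ≤ C3 := hC3 (x, t) ⟨⟨hx', hx⟩, ht⟩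
    have h3 : jb x ^ (-(j : ℝ)) = 1 := by rw [jb_of_abs_le (abs_le.2 ⟨hx', hx⟩), Real.one_rpow]
    rw [h3] at m3 n1 n2 ⊢
    linarith

end NLS

namespace NLS

open Filter Topology MeasureTheory
open scoped ContDiff

/-! ### Integrals over a time strip -/

section Integrals
variable {q Φ : ℝ → ℝ → ℂ} {T C K : ℝ}

theorem integrable_of_strip {t : ℝ} (hq : Continuous fun x => q x t)
    (hb : ∀ x, ‖q x t‖ ≤ C * jb x ^ (-2 : ℝ)) : Integrable (fun x => q x t) :=
  (integrable_jb.const_mul C).mono' hq.aestronglyMeasurable (Eventually.of_forall hb)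

theorem tendsto_zero_of_jb {f : ℝ → ℂ} (h : ∀ x, ‖f x‖ ≤ C * jb x ^ (-2 : ℝ)) {l : Filter ℝ}
    (hl : Tendsto (fun x => |x|) l atTop) : Tendsto f l (𝓝 0) := by
  have h1 : Tendsto jb l atTop := tendsto_atTop_mono abs_le_jb hl
  have h2 := ((tendsto_rpow_neg_atTop (show (0 : ℝ) < 2 by norm_num)).comp h1).const_mul C
  rw [mul_zero] at h2
  exact squeeze_zero_norm h h2

/-- A nonnegative density with a conservation law up to a lower-order term vanishes for positive
times if it vanishes initially. -/
theorem eq_zero_of_flux (hT : 0 ≤ T) (hq : Sm q) (hΦ : Sm Φ)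
    (h0 : ∀ x t, 0 ≤ (q x t).re) (hb : ∀ x, ∀ t ∈ Set.Icc 0 T, ‖q x t‖ ≤ C * jb x ^ (-2 : ℝ))
    (hb' : ∀ x, ∀ t ∈ Set.Icc 0 T, ‖Dt q x t‖ ≤ C * jb x ^ (-2 : ℝ))
    (hbΦ : ∀ x, ∀ t ∈ Set.Icc 0 T, ‖Φ x t‖ ≤ C * jb x ^ (-2 : ℝ))
    (hR : ∀ x, ∀ t ∈ Set.Icc 0 T, ‖Dt q x t - Dx Φ x t‖ ≤ K * (q x t).re)
    (hi : ∀ x, q x 0 = 0) : ∀ x, ∀ t ∈ Set.Icc 0 T, (q x t).re = 0 := by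
  obtain ⟨E, hE⟩ : ∃ E : ℝ → ℝ, ∀ t, E t = ∫ x, (q x t).re := ⟨_, fun _ => rfl⟩
  have hre : ∀ x t, HasDerivAt (fun s => (q x s).re) (Dt q x t).re t := fun x t =>
    (Complex.reCLM.hasFDerivAt.comp_hasDerivAt t (hq.hasDerivAt_t x t))
  have hcx : ∀ t, Continuous fun x => (q x t).re := fun t =>
    Complex.continuous_re.comp (hq.slice_x t).continuous
  have hct : ∀ x, Continuous fun t => (q x t).re := fun x =>
    Complex.continuous_re.comp (hq.slice_t x).continuous
  have hint : ∀ t ∈ Set.Icc 0 T, Integrable fun x => (q x t).re := fun t ht =>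
    (integrable_of_strip (hq.slice_x t).continuous fun x => hb x t ht).re
  have hcont : ContinuousOn E (Set.Icc 0 T) := by
    rw [funext hE]
    refine continuousOn_of_dominated (bound := fun x => C * jb x ^ (-2 : ℝ))
      (fun t _ => (hcx t).aestronglyMeasurable) (fun t ht => Eventually.of_forall fun x => ?_)
      (integrable_jb.const_mul C) (Eventually.of_forall fun x => (hct x).continuousOn)
    exact (Complex.abs_re_le_norm _).trans (hb x t ht)
  have hder : ∀ t ∈ Set.Ioo 0 T, HasDerivAt E (∫ x, (Dt q x t).re) t := fun t ht => by
    rw [funext hE]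
    refine (hasDerivAt_integral_of_dominated_loc_of_deriv_le (F := fun s x => (q x s).re)
      (F' := fun s x => (Dt q x s).re) (bound := fun x => C * jb x ^ (-2 : ℝ))
      (Ioo_mem_nhds ht.1 ht.2) (Eventually.of_forall fun s => (hcx s).aestronglyMeasurable)
      (hint t (Set.Ioo_subset_Icc_self ht)) ?_ ?_ (integrable_jb.const_mul C) ?_).2
    · exact (Complex.continuous_re.comp (hq.dt.slice_x t).continuous).aestronglyMeasurable
    · exact Eventually.of_forall fun x s hs =>
        (Complex.abs_re_le_norm _).trans (hb' x s (Set.Ioo_subset_Icc_self hs))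
    · exact Eventually.of_forall fun x s _ => hre x s
  have hle : ∀ t ∈ Set.Icc 0 T, ∫ x, (Dt q x t).re ≤ K * E t := fun t ht => by
    have i1 := integrable_of_strip (hq.dt.slice_x t).continuous fun x => hb' x t ht
    have i2 : Integrable fun x => Dt q x t - Dx Φ x t :=
      ((hint t ht).const_mul K).mono'
        ((hq.dt.slice_x t).continuous.sub (hΦ.dx.slice_x t).continuous).aestronglyMeasurable
        (Eventually.of_forall fun x => hR x t ht)
    have i3 : Integrable fun x => Dx Φ x t :=
      (i1.sub i2).congr (Eventually.of_forall fun x => by simp)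
    have h1 : ∫ x, Dx Φ x t = 0 := by
      rw [integral_of_hasDerivAt_of_tendsto (fun x => hΦ.hasDerivAt_x x t) i3
        (tendsto_zero_of_jb (fun x => hbΦ x t ht) tendsto_abs_atBot_atTop)
        (tendsto_zero_of_jb (fun x => hbΦ x t ht) tendsto_abs_atTop_atTop), sub_zero]
    have h2 : ∫ x, (Dt q x t).re = (∫ x, (Dt q x t - Dx Φ x t)).re := by
      rw [integral_sub i1 i3, h1, sub_zero]
      exact integral_re i1
    rw [h2, hE, ← integral_const_mul]
    refine (Complex.re_le_norm _).trans (norm_integral_le_of_norm_le ((hint t ht).const_mul K)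
      (Eventually.of_forall fun x => hR x t ht))
  have hanti : AntitoneOn (fun t => Real.exp (-(K * t)) * E t) (Set.Icc 0 T) := by
    have hexp : ∀ t, HasDerivAt (fun t => Real.exp (-(K * t))) (Real.exp (-(K * t)) * -(K * 1)) t :=
      fun t => ((hasDerivAt_id t).const_mul K).neg.exp
    have hd : ∀ t ∈ Set.Ioo 0 T, HasDerivAt (fun t => Real.exp (-(K * t)) * E t)
        (Real.exp (-(K * t)) * -(K * 1) * E t + Real.exp (-(K * t)) * ∫ x, (Dt q x t).re) t :=
      fun t ht => (hexp t).mul (hder t ht)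
    refine antitoneOn_of_deriv_nonpos (convex_Icc 0 T)
      (ContinuousOn.mul (by fun_prop) hcont) (fun t ht => ?_) fun t ht => ?_
    · rw [interior_Icc] at ht
      exact (hd t ht).differentiableAt.differentiableWithinAt
    · rw [interior_Icc] at ht
      rw [(hd t ht).deriv]
      have := mul_le_mul_of_nonneg_left (hle t (Set.Ioo_subset_Icc_self ht))
        (Real.exp_pos (-(K * t))).le
      linarith
  have hE0 : E 0 = 0 := by rw [hE]; simp [hi]
  intro x t ht
  have h1 := hanti ⟨le_rfl, hT⟩ ht ht.1
  simp only [hE0, mul_zero] at h1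
  have h2 : E t ≤ 0 := by
    by_contra h
    exact absurd (mul_pos (Real.exp_pos (-(K * t))) (not_le.1 h)) (not_lt.2 h1)
  have h3 : E t = 0 := le_antisymm h2 (by rw [hE]; exact integral_nonneg fun x => h0 x t)
  rw [hE, integral_eq_zero_iff_of_nonneg (fun x => h0 x t) (hint t ht)] at h3
  exact congrFun ((hcx t).ae_eq_iff_eq volume continuous_const |>.1 h3) x

end Integrals

/-! ### Uniqueness -/

variable {d w w' : ℝ → ℝ → ℂ} {T μ β : ℝ}

/-- The weight `1 / (1 + x²)`. -/
def rho : ℝ → ℝ → ℂ := fun x _ => (((1 + x ^ 2)⁻¹ : ℝ) : ℂ)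

theorem hasDerivAt_rho (x : ℝ) :
    HasDerivAt (fun x : ℝ => (1 + x ^ 2)⁻¹) (-(2 * x) / (1 + x ^ 2) ^ 2) x := by
  have h : HasDerivAt (fun x : ℝ => 1 + x ^ 2) (2 * x) x := by
    simpa using (hasDerivAt_pow 2 x).const_add (1 : ℝ)
  exact h.inv (by positivity)

theorem sm_rho : Sm rho := by
  refine Sm.of_x (Complex.ofRealCLM.contDiff.comp ?_)
  exact ContDiff.inv (by fun_prop) fun x => by positivity

theorem dt_rho : Dt rho = 0 := by
  ext x t
  simp [Dt, rho]

theorem norm_dx_rho_le (x t : ℝ) : ‖Dx rho x t‖ ≤ (1 + x ^ 2)⁻¹ := by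
  have h : Dx rho x t = ((-(2 * x) / (1 + x ^ 2) ^ 2 : ℝ) : ℂ) :=
    (hasDerivAt_rho x).ofReal_comp.deriv
  have h0 : 0 < 1 + x ^ 2 := by positivity
  rw [h, Complex.norm_real, Real.norm_eq_abs, abs_div, abs_of_pos (pow_pos h0 2), div_le_iff₀
    (pow_pos h0 2), inv_mul_eq_div, le_div_iff₀ h0, abs_neg, abs_mul, abs_two]
  have h1 : 2 * |x| ≤ 1 + x ^ 2 := by nlinarith [sq_nonneg (|x| - 1), sq_abs x]
  nlinarith

/-- The density of the weighted energy. -/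
def energy (d : ℝ → ℝ → ℂ) : ℝ → ℝ → ℂ := rho * (d * star d) + Dx d * star (Dx d)

/-- The flux of the weighted energy. -/
def flux (d : ℝ → ℝ → ℂ) : ℝ → ℝ → ℂ :=
  Complex.I • (rho * (Dx d * star d - star (Dx d) * d)
    + (Dx (Dx d) * star (Dx d) - star (Dx (Dx d)) * Dx d))

theorem sm_energy (hd : Sm d) : Sm (energy d) :=
  (sm_rho.mul (hd.mul hd.star)).add (hd.dx.mul hd.dx.star)

theorem sm_flux (hd : Sm d) : Sm (flux d) :=
  ((sm_rho.mul ((hd.dx.mul hd.star).sub (hd.dx.star.mul hd))).add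
    ((hd.dx.dx.mul hd.dx.star).sub (hd.dx.dx.star.mul hd.dx))).smul Complex.I

theorem energy_eq (d : ℝ → ℝ → ℂ) (x t : ℝ) :
    energy d x t = (((1 + x ^ 2)⁻¹ * ‖d x t‖ ^ 2 + ‖Dx d x t‖ ^ 2 : ℝ) : ℂ) := by
  simp [energy, rho, Complex.mul_conj, Complex.normSq_eq_norm_sq]

theorem dt_energy (hd : Sm d) : Dt (energy d) =
    rho * (Dt d * star d + d * star (Dt d)) + (Dx (Dt d) * star (Dx d) + Dx d * star (Dx (Dt d))) := by
  rw [energy, dt_add (sm_rho.mul (hd.mul hd.star)) (hd.dx.mul hd.dx.star),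
    dt_mul sm_rho (hd.mul hd.star), dt_mul hd hd.star, dt_star hd, dt_mul hd.dx hd.dx.star,
    dt_star hd.dx, hd.dx_dt, dt_rho, zero_mul, zero_add]

theorem dx_flux (hd : Sm d) : Dx (flux d) = Complex.I • (Dx rho * (Dx d * star d - star (Dx d) * d)
    + rho * (Dx (Dx d) * star d - star (Dx (Dx d)) * d)
    + (Dx (Dx (Dx d)) * star (Dx d) - star (Dx (Dx (Dx d))) * Dx d)) := by
  have s1 := hd.dx
  have s2 := s1.dx
  rw [flux, dx_smul, dx_add (sm_rho.mul ((s1.mul hd.star).sub (s1.star.mul hd)))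
    ((s2.mul s1.star).sub (s2.star.mul s1)), dx_mul sm_rho ((s1.mul hd.star).sub (s1.star.mul hd)),
    dx_sub (s1.mul hd.star) (s1.star.mul hd), dx_sub (s2.mul s1.star) (s2.star.mul s1),
    dx_mul s1 hd.star, dx_mul s1.star hd, dx_mul s2 s1.star, dx_mul s2.star s1,
    dx_star hd, dx_star s1, dx_star s2]
  congr 1
  ring

theorem dt_energy_sub_dx_flux (hd : Sm d) {n n' : ℂ} {x t : ℝ}
    (h : Dt d x t = Complex.I * (Dx (Dx d) x t + μ * n))
    (h' : Dx (Dt d) x t = Complex.I * (Dx (Dx (Dx d)) x t + μ * n')) :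
    Dt (energy d) x t - Dx (flux d) x t = Complex.I * (μ * (rho x t * (n * star (d x t) - star n * d x t)
      + (n' * star (Dx d x t) - star n' * Dx d x t))
      - Dx rho x t * (Dx d x t * star (d x t) - star (Dx d x t) * d x t)) := by
  rw [dt_energy hd, dx_flux hd]
  simp only [Pi.add_apply, Pi.mul_apply, Pi.sub_apply, Pi.smul_apply, Pi.star_apply, h, h',
    smul_eq_mul, Complex.star_def, map_mul, map_add, Complex.conj_I, Complex.conj_ofReal]
  ring

theorem norm_dt_energy_sub_dx_flux_le (hd : Sm d) {n n' : ℂ} {x t L p : ℝ} (hμ : ‖(μ : ℂ)‖ ≤ 1)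
    (hL : 0 ≤ L) (hpx : p ^ 2 ≤ 2 * (1 + x ^ 2)⁻¹)
    (h : Dt d x t = Complex.I * (Dx (Dx d) x t + μ * n))
    (h' : Dx (Dt d) x t = Complex.I * (Dx (Dx (Dx d)) x t + μ * n'))
    (hn : ‖n‖ ≤ L * ‖d x t‖) (hn' : ‖n'‖ ≤ L * ‖Dx d x t‖ + L * p * ‖d x t‖) :
    ‖Dt (energy d) x t - Dx (flux d) x t‖ ≤ (1 + 4 * L) * (energy d x t).re := by
  have two : ∀ y z : ℂ, ‖y * star z - star y * z‖ ≤ 2 * (‖y‖ * ‖z‖) := fun y z => by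
    refine (norm_sub_le _ _).trans (le_of_eq ?_)
    rw [norm_mul, norm_mul, norm_star, norm_star]
    ring
  obtain ⟨a, ha⟩ : ∃ a, a = ‖d x t‖ := ⟨_, rfl⟩
  obtain ⟨b, hb⟩ : ∃ b, b = ‖Dx d x t‖ := ⟨_, rfl⟩
  obtain ⟨r, hr⟩ : ∃ r, r = (1 + x ^ 2)⁻¹ := ⟨_, rfl⟩
  have hr0 : 0 < r := by rw [hr]; positivity
  have hr1 : r ≤ 1 := by rw [hr]; exact inv_le_one_of_one_le₀ (by nlinarith [sq_nonneg x])
  have ha0 : 0 ≤ a := by rw [ha]; exact norm_nonneg _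
  have hb0 : 0 ≤ b := by rw [hb]; exact norm_nonneg _
  have hrho : ‖rho x t‖ = r := by
    rw [rho, Complex.norm_real, Real.norm_of_nonneg (by positivity), hr]
  have hdr : ‖Dx rho x t‖ ≤ r := by rw [hr]; exact norm_dx_rho_le x t
  rw [dt_energy_sub_dx_flux hd h h', energy_eq, Complex.ofReal_re, ← hr, ← ha, ← hb, norm_mul,
    Complex.norm_I, one_mul]
  rw [← ha] at hn hn'
  rw [← hb] at hn'
  rw [← hr] at hpx
  have t1 : ‖rho x t * (n * star (d x t) - star n * d x t)‖ ≤ r * (2 * (L * a * a)) := by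
    rw [norm_mul, hrho]
    refine mul_le_mul_of_nonneg_left ((two _ _).trans ?_) hr0.le
    rw [← ha]
    nlinarith
  have t2 : ‖n' * star (Dx d x t) - star n' * Dx d x t‖ ≤ 2 * ((L * b + L * p * a) * b) := by
    refine (two _ _).trans ?_
    rw [← hb]
    nlinarith
  have t3 : ‖Dx rho x t * (Dx d x t * star (d x t) - star (Dx d x t) * d x t)‖ ≤ r * (2 * (b * a)) := by
    rw [norm_mul]
    refine mul_le_mul hdr ((two _ _).trans ?_) (norm_nonneg _) hr0.le
    rw [← ha, ← hb]
  have t4 : ‖(μ : ℂ) * (rho x t * (n * star (d x t) - star n * d x t)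
      + (n' * star (Dx d x t) - star n' * Dx d x t))‖
      ≤ r * (2 * (L * a * a)) + 2 * ((L * b + L * p * a) * b) := by
    rw [norm_mul]
    refine (mul_le_of_le_one_left (norm_nonneg _) hμ).trans ((norm_add_le _ _).trans ?_)
    exact add_le_add t1 t2
  refine (norm_sub_le _ _).trans ((add_le_add t4 t3).trans ?_)
  have m1 : 2 * (p * a * b) ≤ p ^ 2 * a ^ 2 + b ^ 2 := by nlinarith [sq_nonneg (p * a - b)]
  have m2 : p ^ 2 * a ^ 2 ≤ 2 * r * a ^ 2 := mul_le_mul_of_nonneg_right hpx (sq_nonneg a)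
  have m3 : L * (2 * (p * a * b)) ≤ L * (2 * r * a ^ 2 + b ^ 2) :=
    mul_le_mul_of_nonneg_left (by linarith) hL
  have m4 : r * (2 * (b * a)) ≤ r * a ^ 2 + b ^ 2 := by
    nlinarith [mul_nonneg hr0.le (sq_nonneg (a - b)), sq_nonneg b]
  have m5 : 0 ≤ L * b ^ 2 := by positivity
  linarith

end NLS

namespace NLS

open Filter Topology MeasureTheory
open scoped ContDiff

variable {d u w w' : ℝ → ℝ → ℂ} {T μ β : ℝ}

theorem jb_rpow_neg_two (x : ℝ) : jb x ^ (-2 : ℝ) = (jb x)⁻¹ ^ 2 := by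
  rw [Real.rpow_neg (jb_pos x).le, Real.rpow_two, inv_pow]

theorem inv_one_add_sq_le (x : ℝ) : (1 + x ^ 2)⁻¹ ≤ (jb x)⁻¹ ^ 2 := by
  rw [inv_pow]
  refine inv_anti₀ (pow_pos (jb_pos x) 2) ?_
  rcases max_choice 1 |x| with h | h
  · rw [jb, h]; nlinarith [sq_nonneg x]
  · rw [jb, h, sq_abs]; linarith

theorem inv_jb_sq_le (x : ℝ) : (jb x)⁻¹ ^ 2 ≤ 2 * (1 + x ^ 2)⁻¹ := by
  have h0 : 0 < 1 + x ^ 2 := by positivity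
  rw [inv_pow, ← div_eq_mul_inv, le_div_iff₀ h0, inv_mul_le_iff₀ (pow_pos (jb_pos x) 2)]
  nlinarith [one_le_jb x, abs_le_jb x, sq_abs x, abs_nonneg x]

theorem Strip.exists_bound (hu : Strip T u) : ∃ B, 0 ≤ B ∧ ∀ x, ∀ t ∈ Set.Icc 0 T,
    ‖u x t‖ ≤ B ∧ ‖Dx u x t‖ ≤ B * (jb x)⁻¹ ∧ ‖Dx (Dx u) x t‖ ≤ B * (jb x)⁻¹ ∧
      ‖Dt u x t‖ ≤ B ∧ ‖Dx (Dt u) x t‖ ≤ B * (jb x)⁻¹ := by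
  have key : ∀ i j : ℕ, ∃ C, 0 ≤ C ∧ ∀ x, ∀ t ∈ Set.Icc 0 T,
      ‖pd u i j x t‖ ≤ C * (jb x)⁻¹ ^ j := fun i j => by
    obtain ⟨C, hC⟩ := hu.2 i j
    refine ⟨|C|, abs_nonneg C, fun x t ht => (hC x t ht).trans ?_⟩
    rw [Real.rpow_neg (jb_pos x).le, Real.rpow_natCast, inv_pow]
    exact mul_le_mul_of_nonneg_right (le_abs_self C) (inv_pos.2 (pow_pos (jb_pos x) j)).le
  obtain ⟨C0, p0, h0⟩ := key 0 0
  obtain ⟨C1, p1, h1⟩ := key 0 1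
  obtain ⟨C2, p2, h2⟩ := key 0 2
  obtain ⟨C3, p3, h3⟩ := key 1 0
  obtain ⟨C4, p4, h4⟩ := key 1 1
  have e4 : Dx (Dt u) = pd u 1 1 := by rw [hu.1.dx_dt, pd_succ_left, pd_zero_succ, pd_zero_zero]
  simp only [pd_succ_left, pd_zero_succ, pd_zero_zero, pow_zero, mul_one, pow_one] at h0 h1 h2 h3
  refine ⟨C0 + C1 + C2 + C3 + C4, by positivity, fun x t ht => ?_⟩
  have hp0 : 0 < (jb x)⁻¹ := inv_pos.2 (jb_pos x)
  have hp1 : (jb x)⁻¹ ≤ 1 := inv_le_one_of_one_le₀ (one_le_jb x)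
  have h4' := h4 x t ht
  rw [pow_one] at h4'
  have m0 := mul_nonneg p0 hp0.le
  have m1 := mul_nonneg p1 hp0.le
  have m2 := mul_nonneg p2 hp0.le
  have m3 := mul_nonneg p3 hp0.le
  have m4 := mul_nonneg p4 hp0.le
  have m5 : C2 * (jb x)⁻¹ ^ 2 ≤ C2 * (jb x)⁻¹ :=
    mul_le_mul_of_nonneg_left (by nlinarith) p2
  rw [e4]
  refine ⟨?_, ?_, ?_, ?_, ?_⟩
  · linarith [h0 x t ht]
  · linarith [h1 x t ht]
  · linarith [h2 x t ht]
  · linarith [h3 x t ht]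
  · linarith

theorem Strip.energy_bound (hd : Strip T d) : ∃ C, ∀ x, ∀ t ∈ Set.Icc 0 T,
    ‖energy d x t‖ ≤ C * jb x ^ (-2 : ℝ) ∧ ‖Dt (energy d) x t‖ ≤ C * jb x ^ (-2 : ℝ) ∧
      ‖flux d x t‖ ≤ C * jb x ^ (-2 : ℝ) := by
  obtain ⟨D, hD0, hD⟩ := hd.exists_bound
  have prod : ∀ {r y z A B : ℝ}, 0 ≤ y → 0 ≤ z → 0 ≤ A → y ≤ A → z ≤ B → A * B ≤ r → y * z ≤ r :=
    fun hy hz hA h1 h2 h3 => (mul_le_mul h1 h2 hz hA).trans h3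
  refine ⟨4 * D ^ 2, fun x t ht => ?_⟩
  obtain ⟨h1, h2, h3, h4, h5⟩ := hD x t ht
  rw [jb_rpow_neg_two]
  have hr := inv_one_add_sq_le x
  have hr0 : 0 < (1 + x ^ 2)⁻¹ := by positivity
  have hp0 : 0 < (jb x)⁻¹ := inv_pos.2 (jb_pos x)
  have hp1 : (jb x)⁻¹ ≤ 1 := inv_le_one_of_one_le₀ (one_le_jb x)
  generalize (jb x)⁻¹ = p at *
  have hrho : ‖rho x t‖ ≤ p ^ 2 := by
    rw [rho, Complex.norm_real, Real.norm_of_nonneg hr0.le]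
    exact hr
  have hDp : 0 ≤ D * p := by positivity
  have hDD : D * p * D ≤ D ^ 2 := by nlinarith [sq_nonneg D]
  have n1 := norm_nonneg (d x t)
  have n2 := norm_nonneg (Dx d x t)
  have n3 := norm_nonneg (Dx (Dx d) x t)
  have n4 := norm_nonneg (Dt d x t)
  have n5 := norm_nonneg (Dx (Dt d) x t)
  have hp2 := sq_nonneg p
  have rmul : ∀ z : ℂ, ‖z‖ ≤ 2 * D ^ 2 → ‖rho x t * z‖ ≤ 2 * D ^ 2 * p ^ 2 := fun z hz => by
    rw [norm_mul, mul_comm]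
    exact mul_le_mul hz hrho (norm_nonneg _) (by positivity)
  refine ⟨?_, ?_, ?_⟩
  · have a1 : ‖rho x t * (d x t * star (d x t))‖ ≤ 2 * D ^ 2 * p ^ 2 := rmul _ (by
      rw [norm_mul, norm_star]; nlinarith)
    have a2 : ‖Dx d x t * star (Dx d x t)‖ ≤ D ^ 2 * p ^ 2 := by
      rw [norm_mul, norm_star]
      exact prod n2 n2 hDp h2 h2 (by linarith)
    refine (norm_add_le _ _).trans ((add_le_add a1 a2).trans ?_)
    nlinarith [mul_nonneg (sq_nonneg D) hp2]
  · rw [dt_energy hd.1]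
    have a1 : ‖rho x t * (Dt d x t * star (d x t) + d x t * star (Dt d x t))‖ ≤ 2 * D ^ 2 * p ^ 2 :=
      rmul _ ((norm_add_le _ _).trans (by rw [norm_mul, norm_mul, norm_star, norm_star]; nlinarith))
    have a2 : ‖Dx (Dt d) x t * star (Dx d x t)‖ ≤ D ^ 2 * p ^ 2 := by
      rw [norm_mul, norm_star]
      exact prod n5 n2 hDp h5 h2 (by linarith)
    have a3 : ‖Dx d x t * star (Dx (Dt d) x t)‖ ≤ D ^ 2 * p ^ 2 := by
      rw [norm_mul, norm_star]
      exact prod n2 n5 hDp h2 h5 (by linarith)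
    refine (norm_add_le _ _).trans ((add_le_add a1 ((norm_add_le _ _).trans
      (add_le_add a2 a3))).trans ?_)
    linarith
  · have a1 : ‖rho x t * (Dx d x t * star (d x t) - star (Dx d x t) * d x t)‖ ≤ 2 * D ^ 2 * p ^ 2 :=
      rmul _ ((norm_sub_le _ _).trans (by
        rw [norm_mul, norm_mul, norm_star, norm_star]
        linarith [prod n2 n1 hDp h2 h1 hDD]))
    have a2 : ‖Dx (Dx d) x t * star (Dx d x t)‖ ≤ D ^ 2 * p ^ 2 := by
      rw [norm_mul, norm_star]
      exact prod n3 n2 hDp h3 h2 (by linarith)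
    have a3 : ‖star (Dx (Dx d) x t) * Dx d x t‖ ≤ D ^ 2 * p ^ 2 := by
      rw [norm_mul, norm_star]
      exact prod n3 n2 hDp h3 h2 (by linarith)
    have e1 : flux d x t = Complex.I * (rho x t * (Dx d x t * star (d x t) - star (Dx d x t) * d x t)
      + (Dx (Dx d) x t * star (Dx d x t) - star (Dx (Dx d) x t) * Dx d x t)) := rfl
    rw [e1, norm_mul, Complex.norm_I, one_mul]
    refine (norm_add_le _ _).trans ((add_le_add a1 ((norm_sub_le _ _).trans
      (add_le_add a2 a3))).trans ?_)
    linarith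

theorem NLSEq.dt_eq (h : NLSEq μ w T) (x : ℝ) {t : ℝ} (ht : t ∈ Set.Icc 0 T) :
    Dt w x t = Complex.I * (Dx (Dx w) x t + μ * cub w x t) := by
  have h1 := h x t ht
  rw [pd_succ_left, pd_zero_succ, pd_zero_succ, pd_zero_zero] at h1
  have h2 : cub w x t = w x t ^ 2 * (starRingEnd ℂ) (w x t) := by
    rw [sq]; rfl
  rw [h2]
  linear_combination (-Complex.I) * h1 + Dt w x t * Complex.I_mul_I

theorem nls_unique (hμ : ‖(μ : ℂ)‖ ≤ 1) (hT : 0 ≤ T) (hw : Strip T w) (hw' : Strip T w')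
    (h : NLSEq μ w T) (h' : NLSEq μ w' T) (h0 : ∀ x, w' x 0 = w x 0) (x : ℝ) {t : ℝ}
    (ht : t ∈ Set.Icc 0 T) : w' x t = w x t := by
  have hd := hw'.sub hw
  obtain ⟨d, hd_eq⟩ : ∃ d, d = w' - w := ⟨_, rfl⟩
  rw [← hd_eq] at hd
  obtain ⟨B1, hB10, hB1⟩ := hw.exists_bound
  obtain ⟨B2, hB20, hB2⟩ := hw'.exists_bound
  obtain ⟨C, hC⟩ := hd.energy_bound
  obtain ⟨B, hB⟩ : ∃ B, B = B1 + B2 := ⟨_, rfl⟩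
  have hN : Sm (cub w' - cub w) :=
    ((hw'.1.mul hw'.1).mul hw'.1.star).sub ((hw.1.mul hw.1).mul hw.1.star)
  have heq : ∀ x, ∀ t ∈ Set.Icc 0 T,
      Dt d x t = Complex.I * (Dx (Dx d) x t + μ * (cub w' - cub w) x t) := fun x t ht => by
    rw [hd_eq, dt_sub hw'.1 hw.1, dx_sub hw'.1 hw.1, dx_sub hw'.1.dx hw.1.dx]
    simp only [Pi.sub_apply, NLSEq.dt_eq h x ht, NLSEq.dt_eq h' x ht]
    ring
  have heq' : ∀ x, ∀ t ∈ Set.Icc 0 T, Dx (Dt d) x t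
      = Complex.I * (Dx (Dx (Dx d)) x t + μ * Dx (cub w' - cub w) x t) := fun x t ht => by
    have h1 : (fun y => Dt d y t)
        = fun y => Complex.I * (Dx (Dx d) y t + μ * (cub w' - cub w) y t) :=
      funext fun y => heq y t ht
    have h2 := ((hd.1.dx.dx.hasDerivAt_x x t).add
      ((hN.hasDerivAt_x x t).const_mul (μ : ℂ))).const_mul Complex.I
    rw [← h2.deriv, Dx, h1]
    rfl
  have hq : (energy d x t).re = 0 := by
    refine eq_zero_of_flux hT (sm_energy hd.1) (sm_flux hd.1) (C := C) (K := 1 + 4 * (6 * B ^ 2))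
      (fun x t => ?_) (fun x t ht => (hC x t ht).1) (fun x t ht => (hC x t ht).2.1)
      (fun x t ht => (hC x t ht).2.2) (fun x t ht => ?_) (fun x => ?_) x t ht
    · rw [energy_eq, Complex.ofReal_re]
      positivity
    · obtain ⟨a1, a2, -⟩ := hB1 x t ht
      obtain ⟨b1, b2, -⟩ := hB2 x t ht
      have hp0 : 0 < (jb x)⁻¹ := inv_pos.2 (jb_pos x)
      refine norm_dt_energy_sub_dx_flux_le hd.1 hμ (by positivity) (inv_jb_sq_le x) (heq x t ht)
        (heq' x t ht) ?_ ?_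
      · have e1 : (cub w' - cub w) x t = d x t * ((w' x t + w x t) * star (w' x t))
            + star (d x t) * (w x t * w x t) := by
          rw [NLS.cub_sub, ← hd_eq]
          simp
          ring
        rw [e1]
        refine (norm_add_le _ _).trans ?_
        rw [norm_mul, norm_mul, norm_mul, norm_mul, norm_star, norm_star]
        have c1 := norm_add_le (w' x t) (w x t)
        have c2 : ‖w' x t + w x t‖ * ‖w' x t‖ ≤ B * B :=
          mul_le_mul (by linarith) (by linarith) (norm_nonneg _) (by linarith)
        have c3 : ‖w x t‖ * ‖w x t‖ ≤ B * B :=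
          mul_le_mul (by linarith) (by linarith) (norm_nonneg _) (by linarith)
        have c4 := mul_le_mul_of_nonneg_left (add_le_add c2 c3) (norm_nonneg (d x t))
        nlinarith [mul_nonneg (norm_nonneg (d x t)) (mul_self_nonneg B)]
      · have e1 : Dx (cub w' - cub w) x t = Dx d x t * ((w' x t + w x t) * star (w' x t))
            + star (Dx d x t) * (w x t * w x t)
            + d x t * ((Dx w' x t + Dx w x t) * star (w' x t))
            + d x t * ((w' x t + w x t) * star (Dx w' x t))
            + 2 * star (d x t) * (Dx w x t * w x t) := by
          have s1 := hw.1
          have s2 := hw'.1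
          rw [NLS.cub_sub, ← hd_eq, dx_add ((hd.1.mul (s2.add s1)).mul s2.star)
            ((hd.1.star.mul s1).mul s1), dx_mul (hd.1.mul (s2.add s1)) s2.star,
            dx_mul hd.1 (s2.add s1), dx_add s2 s1, dx_star s2, dx_mul (hd.1.star.mul s1) s1,
            dx_mul hd.1.star s1, dx_star hd.1]
          simp
          ring
        have c1 := norm_add_le (w' x t) (w x t)
        have c1' := norm_add_le (Dx w' x t) (Dx w x t)
        have hBp : B * (jb x)⁻¹ = B1 * (jb x)⁻¹ + B2 * (jb x)⁻¹ := by rw [hB, add_mul]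
        have q1 := mul_nonneg hB10 hp0.le
        have q2 := mul_nonneg hB20 hp0.le
        have c2 : ‖(w' x t + w x t) * star (w' x t)‖ ≤ B * B := by
          rw [norm_mul, norm_star]
          exact mul_le_mul (by linarith) (by linarith) (norm_nonneg _) (by linarith)
        have c3 : ‖w x t * w x t‖ ≤ B * B := by
          rw [norm_mul]
          exact mul_le_mul (by linarith) (by linarith) (norm_nonneg _) (by linarith)
        have c4 : ‖(Dx w' x t + Dx w x t) * star (w' x t)‖ ≤ B * (jb x)⁻¹ * B := by
          rw [norm_mul, norm_star]
          exact mul_le_mul (by linarith) (by linarith) (norm_nonneg _) (by linarith)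
        have c5 : ‖(w' x t + w x t) * star (Dx w' x t)‖ ≤ B * (B * (jb x)⁻¹) := by
          rw [norm_mul, norm_star]
          exact mul_le_mul (by linarith) (by linarith) (norm_nonneg _) (by linarith)
        have c6 : ‖Dx w x t * w x t‖ ≤ B * (jb x)⁻¹ * B := by
          rw [norm_mul]
          exact mul_le_mul (by linarith) (by linarith) (norm_nonneg _) (by linarith)
        rw [e1]
        refine (norm_add_le _ _).trans ((add_le_add ((norm_add_le _ _).trans (add_le_add
          ((norm_add_le _ _).trans (add_le_add (norm_add_le _ _) le_rfl)) le_rfl)) le_rfl).trans ?_)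
        rw [norm_mul, norm_mul (star (Dx d x t)), norm_mul (d x t), norm_mul (d x t), norm_mul (2 * _),
          norm_mul (2 : ℂ), norm_star, norm_star, Complex.norm_ofNat]
        have na := norm_nonneg (d x t)
        have nb := norm_nonneg (Dx d x t)
        have g2 := mul_le_mul_of_nonneg_left c2 nb
        have g3 := mul_le_mul_of_nonneg_left c3 nb
        have g4 := mul_le_mul_of_nonneg_left c4 na
        have g5 := mul_le_mul_of_nonneg_left c5 na
        have g6 := mul_le_mul_of_nonneg_left c6 na
        have g7 := mul_nonneg nb (mul_self_nonneg B)
        have g8 := mul_nonneg (mul_nonneg na hp0.le) (mul_self_nonneg B)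
        linarith
    · have h1 : (fun y => d y 0) = fun _ => 0 := funext fun y => by simp [hd_eq, h0]
      have h2 : Dx d x 0 = 0 := by rw [Dx, h1, deriv_const]
      rw [energy_eq, h2, congrFun h1 x]
      simp
  rw [energy_eq, Complex.ofReal_re] at hq
  have h1 : 0 < (1 + x ^ 2)⁻¹ := by positivity
  have h2 : ‖d x t‖ ^ 2 = 0 := by
    by_contra hne
    have h3 : 0 < ‖d x t‖ ^ 2 := lt_of_le_of_ne (sq_nonneg _) (Ne.symm hne)
    have h4 := mul_pos h1 h3
    linarith [sq_nonneg ‖Dx d x t‖]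
  rw [sq_eq_zero_iff, norm_eq_zero, hd_eq] at h2
  exact sub_eq_zero.1 h2

end NLS

namespace NLS

open Filter Topology
open scoped ContDiff

variable {W v : ℝ → ℝ → ℂ} {θ θ' : ℝ → ℝ} {T μ : ℝ}

theorem nlsEq_add (hW : Sm W) (hv : Sm v) (hθ : ∀ t ∈ Set.Icc 0 T, θ t = 1)
    (hθ' : ∀ t ∈ Set.Icc 0 T, θ' t = 1)
    (h : Dt v = Complex.I • ((fun _ t => (θ' t : ℂ)) *
      (Dx (Dx v) + (nl μ W v + residual θ μ W)))) : NLSEq μ (W + v) T := fun x t ht => by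
  have h1 : Dt v x t = Complex.I * (Dx (Dx v) x t
      + (μ * (cub (W + v) x t - cub W x t)
        + (Complex.I * Dt W x t + (Dx (Dx W) x t + μ * cub W x t)))) := by
    rw [h]
    simp [nl, residual, cub, hθ t ht, hθ' t ht]
  have h2 : (W + v) x t ^ 2 * (starRingEnd ℂ) ((W + v) x t) = cub (W + v) x t := by
    rw [sq]; rfl
  rw [h2, pd_succ_left, pd_zero_succ, pd_zero_succ, pd_zero_zero, dt_add hW hv, dx_add hW hv,
    dx_add hW.dx hv.dx]
  simp only [Pi.add_apply]
  linear_combination Complex.I * h1 + (Dx (Dx v) x t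
      + (μ * (cub (W + v) x t - cub W x t)
        + (Complex.I * Dt W x t + (Dx (Dx W) x t + μ * cub W x t)))) * Complex.I_mul_I

end NLS

/-- local existence and uniqueness for NLS in `S^β(ℝ × [0,T] → ℂ)`, `β ≤ 0`,
together with the behaviour of the leading asymptotic coefficients of the solution. -/
theorem statement2 (μ : ℝ) (hμ : μ = 1 ∨ μ = -1) (β : ℝ) (hβ : β ≤ 0)
    (w₀ : ℝ → ℂ) (hw₀smooth : ∀ n : ℕ, ContDiff ℝ n w₀)
    (e : ℕ → ℝ) (he : IsExp β e)
    (ap bp am bm : ℕ → ℝ)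
    -- `w₀ ∈ S^β(ℝ → ℂ)`, with expansion coefficients `a_k^± + i b_k^±` and exponents `e k`:
    (hasymP : ∀ N j : ℕ, ∃ C > (0 : ℝ), ∀ x : ℝ, 1 ≤ x →
      ‖iteratedDeriv j (fun y => w₀ y - psumP e (fun k _ => ap k) (fun k _ => bp k) N y 0) x‖
        ≤ C * x ^ (e (N + 1) - (j : ℝ)))
    (hasymM : ∀ N j : ℕ, ∃ C > (0 : ℝ), ∀ x : ℝ, x ≤ -1 →
      ‖iteratedDeriv j (fun y => w₀ y - psumM e (fun k _ => am k) (fun k _ => bm k) N y 0) x‖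
        ≤ C * (-x) ^ (e (N + 1) - (j : ℝ))) :
    ∃ T > (0 : ℝ), ∃ w : ℝ → ℝ → ℂ,
      SBetaOn β w T ∧ NLSEq μ w T ∧ (∀ x : ℝ, w x 0 = w₀ x) ∧
      -- uniqueness in `S^β(ℝ × [0,T] → ℂ)`:
      (∀ w' : ℝ → ℝ → ℂ, SBetaOn β w' T → NLSEq μ w' T → (∀ x : ℝ, w' x 0 = w₀ x) →
        ∀ x : ℝ, ∀ t ∈ Set.Icc (0 : ℝ) T, w' x t = w x t) ∧
      -- the asymptotic expansion of `w` and the behaviour of the leading coefficients: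
      (∃ e' : ℕ → ℝ, IsExp β e' ∧ ∃ Ap Bp Am Bm : ℕ → ℝ → ℝ,
        (∀ k : ℕ, (∀ n : ℕ, ContDiff ℝ n (Ap k)) ∧ (∀ n : ℕ, ContDiff ℝ n (Bp k)) ∧
          (∀ n : ℕ, ContDiff ℝ n (Am k)) ∧ (∀ n : ℕ, ContDiff ℝ n (Bm k))) ∧
        AsymOn w T e' Ap Bp Am Bm ∧
        (∀ j : ℕ, (∀ m < j, ap m = 0 ∧ bp m = 0) → (ap j ≠ 0 ∨ bp j ≠ 0) →
          ∃ j' : ℕ, e' j' = e j ∧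
            ContinuousOn (Ap j') (Set.Icc 0 T) ∧ ContinuousOn (Bp j') (Set.Icc 0 T) ∧
            (∀ t ∈ Set.Icc (0 : ℝ) T, Ap j' t ≠ 0 ∨ Bp j' t ≠ 0) ∧
            (∀ m' < j', ∀ t ∈ Set.Icc (0 : ℝ) T, Ap m' t = 0 ∧ Bp m' t = 0)) ∧
        (∀ j : ℕ, (∀ m < j, am m = 0 ∧ bm m = 0) → (am j ≠ 0 ∨ bm j ≠ 0) →
          ∃ j' : ℕ, e' j' = e j ∧
            ContinuousOn (Am j') (Set.Icc 0 T) ∧ ContinuousOn (Bm j') (Set.Icc 0 T) ∧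
            (∀ t ∈ Set.Icc (0 : ℝ) T, Am j' t ≠ 0 ∨ Bm j' t ≠ 0) ∧
            (∀ m' < j', ∀ t ∈ Set.Icc (0 : ℝ) T, Am m' t = 0 ∧ Bm m' t = 0))) := by
  obtain ⟨θ₁, φ₁, hθ₁⟩ := NLS.exists_clock (two_pos : (0 : ℝ) < 2)
  obtain ⟨e', he', Ap, Bp, Am, Bm, W, hc, hP, hM, hW, hF, hV, hA⟩ :=
    NLS.exists_approx hβ he μ hθ₁ (contDiff_infty.2 hw₀smooth) hasymP hasymM
  have hμ1 : ‖(μ : ℂ)‖ ≤ 1 := by rcases hμ with rfl | rfl <;> simp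
  obtain ⟨τ, θ, φ, hθ, hτ, m, R, v, -, hv⟩ := NLS.exists_picard hμ1 hW hV hF
  obtain ⟨v', hv', hv0, hdt⟩ := hv.exists_limit hθ hW
  have hcn : ∀ k : ℕ, (∀ n : ℕ, ContDiff ℝ n (Ap k)) ∧ (∀ n : ℕ, ContDiff ℝ n (Bp k)) ∧
      (∀ n : ℕ, ContDiff ℝ n (Am k)) ∧ (∀ n : ℕ, ContDiff ℝ n (Bm k)) := fun k =>
    let ⟨h1, h2, h3, h4⟩ := hc k
    ⟨contDiff_infty.1 h1, contDiff_infty.1 h2, contDiff_infty.1 h3, contDiff_infty.1 h4⟩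
  have hS : SBetaOn β (W + v') (τ / 2) :=
    ⟨(hW.1.add hv'.sm).smooth2, e', he', Ap, Bp, Am, Bm, hcn, hA v' hv' _⟩
  have hE : NLSEq μ (W + v') (τ / 2) := NLS.nlsEq_add hW.1 hv'.sm
    (fun t ht => hθ₁.eq_one t (abs_le.2 ⟨by linarith [ht.1], by linarith [ht.2]⟩))
    (fun t ht => hθ.eq_one t (abs_le.2 ⟨by linarith [ht.1, hθ.pos], ht.2⟩)) hdt
  have h0 : ∀ x, (W + v') x 0 = w₀ x := fun x => by simp [hv0]
  refine ⟨τ / 2, half_pos hθ.pos, W + v', hS, hE, h0, fun w' hS' hE' h0' x t ht => ?_,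
    e', he', Ap, Bp, Am, Bm, hcn, hA v' hv' _, fun j hj hj' => ?_, fun j hj hj' => ?_⟩
  · exact NLS.nls_unique hμ1 (half_pos hθ.pos).le (NLS.strip_of_sBetaOn hβ hS)
      (NLS.strip_of_sBetaOn hβ hS') hE hE' (fun x => (h0' x).trans (h0 x).symm) x ht
  · obtain ⟨j', h1, h2, h3⟩ := hP j hj hj'
    exact ⟨j', h1, (hc j').1.continuous.continuousOn, (hc j').2.1.continuous.continuousOn,
      fun t _ => h2 t, fun m' hm' t _ => h3 m' hm' t⟩
  · obtain ⟨j', h1, h2, h3⟩ := hM j hj hj'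
    exact ⟨j', h1, (hc j').2.2.1.continuous.continuousOn,
      (hc j').2.2.2.continuous.continuousOn, fun t _ => h2 t, fun m' hm' t _ => h3 m' hm' t⟩
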